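/- arXiv:2010.08033 — 15 statements merged into one kernel-verified Lean document; each statement's English description precedes it below -/
import Mathlib

section
/- Let s > 0. Let W and X be independent real-valued random variables on a probability space, with X bounded and E[exp(-X/s)] ≤ 1. Suppose the law of W has a Lebesgue density g : ℝ → ℝ that is strictly positive everywhere, differentiable, and satisfies g'(a) ≤ g(a)/s for every a ∈ ℝ. Then W + X first-order stochastically dominates W, i.e., P(W + X ≤ a) ≤ P(W ≤ a) for every a ∈ ℝ. -/
open MeasureTheory ProbabilityTheory

/-- A differentiable function with `g' ≤ g / s` becomes antitone when multiplied by
`exp (-a / s)`. -/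
lemma antitone_mul_exp_neg_div_of_deriv_le {g : ℝ → ℝ} {s : ℝ} (hgdiff : Differentiable ℝ g)
    (hgtail : ∀ a, deriv g a ≤ g a / s) :
    Antitone fun a => g a * Real.exp (-a / s) := by
  have hderiv (a : ℝ) : HasDerivAt (fun a => g a * Real.exp (-a / s))
      (deriv g a * Real.exp (-a / s) + g a * (Real.exp (-a / s) * (-1 / s))) a :=
    (hgdiff a).hasDerivAt.mul (((hasDerivAt_id a).neg.div_const s).exp)
  refine antitone_of_deriv_nonpos (fun a => (hderiv a).differentiableAt) fun a => ?_
  rw [(hderiv a).deriv]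
  calc
    _ = (deriv g a - g a / s) * Real.exp (-a / s) := by ring
    _ ≤ 0 := mul_nonpos_of_nonpos_of_nonneg (sub_nonpos.2 (hgtail a)) (Real.exp_pos _).le

/-- The integral of the exponential of rate `1 / s` through `(a, c)`. -/
lemma integral_mul_exp_sub_div {s : ℝ} (hs : s ≠ 0) (a b c : ℝ) :
    ∫ u in a..b, c * Real.exp ((u - a) / s) = s * c * (Real.exp ((b - a) / s) - 1) := by
  have hderiv (u : ℝ) : HasDerivAt (fun u => s * c * Real.exp ((u - a) / s))
      (c * Real.exp ((u - a) / s)) u := by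
    refine ((((hasDerivAt_id' u).sub_const a).div_const s).exp.const_mul (s * c)).congr_deriv ?_
    field_simp
  rw [intervalIntegral.integral_eq_sub_of_hasDerivAt (fun u _ => hderiv u)
    (Continuous.intervalIntegrable (by fun_prop) _ _)]
  simp
  ring

/-- If `g * exp (-· / s)` is antitone, the integral of `g` from `a` to `b` is at most the integral
of the exponential of rate `1 / s` that agrees with `g` at `a`, for either order of `a`, `b`. -/
lemma integral_le_of_antitone_mul_exp_neg_div {g : ℝ → ℝ} {s : ℝ} (hs : s ≠ 0)
    (hg : Continuous g) (hanti : Antitone fun a => g a * Real.exp (-a / s)) (a b : ℝ) :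
    ∫ u in a..b, g u ≤ s * g a * (Real.exp ((b - a) / s) - 1) := by
  have hfactor (u : ℝ) :
      g u = g u * Real.exp (-u / s) * Real.exp (u / s) := by
    rw [mul_assoc, ← Real.exp_add, ← add_div]
    simp
  have hexp (u : ℝ) :
      g a * Real.exp ((u - a) / s) = g a * Real.exp (-a / s) * Real.exp (u / s) := by
    rw [mul_assoc, ← Real.exp_add]
    congr 2
    ring
  have hgi (x y : ℝ) : IntervalIntegrable g volume x y := hg.intervalIntegrable x y
  have hei (x y : ℝ) :
      IntervalIntegrable (fun u => g a * Real.exp ((u - a) / s)) volume x y :=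
    Continuous.intervalIntegrable (by fun_prop) x y
  rw [← integral_mul_exp_sub_div hs]
  rcases le_total a b with hab | hab
  · refine intervalIntegral.integral_mono_on hab (hgi a b) (hei a b) fun u hu => ?_
    rw [hfactor u, hexp u]
    exact mul_le_mul_of_nonneg_right (hanti hu.1) (Real.exp_pos _).le
  · rw [intervalIntegral.integral_symm b a, intervalIntegral.integral_symm b a, neg_le_neg_iff]
    refine intervalIntegral.integral_mono_on hab (hei b a) (hgi b a) fun u hu => ?_
    rw [hfactor u, hexp u]
    exact mul_le_mul_of_nonneg_right (hanti hu.2) (Real.exp_pos _).le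

/-- Increments of the distribution function of a finite measure with a nonnegative density. -/
lemma measureReal_Iic_sub_Iic_of_withDensity {μ : Measure ℝ} [IsFiniteMeasure μ] {g : ℝ → ℝ}
    (hg : Measurable g) (hgnonneg : ∀ a, 0 ≤ g a)
    (hdens : μ = volume.withDensity fun a => ENNReal.ofReal (g a)) (a b : ℝ) :
    μ.real (Set.Iic b) - μ.real (Set.Iic a) = ∫ u in a..b, g u := by
  have hg_int : Integrable g := by
    refine ⟨hg.aestronglyMeasurable, ?_⟩
    rw [hasFiniteIntegral_iff_ofReal (ae_of_all _ hgnonneg), ← setLIntegral_univ,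
      ← withDensity_apply _ MeasurableSet.univ, ← hdens]
    exact measure_lt_top μ _
  have hcdf (t : ℝ) : μ.real (Set.Iic t) = ∫ u in Set.Iic t, g u := by
    rw [measureReal_def, hdens, withDensity_apply _ measurableSet_Iic,
      integral_eq_lintegral_of_nonneg_ae (ae_of_all _ hgnonneg) hg.aestronglyMeasurable]
  rw [hcdf, hcdf, intervalIntegral.integral_Iic_sub_Iic hg_int.integrableOn hg_int.integrableOn]

/-- The distribution function of a sum of independent random variables. -/
lemma ProbabilityTheory.IndepFun.measure_add_le {Ω : Type*} [MeasurableSpace Ω] {P : Measure Ω}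
    [IsProbabilityMeasure P] {W X : Ω → ℝ} (hindep : IndepFun W X P) (hW : Measurable W)
    (hX : Measurable X) (a : ℝ) :
    P {ω | W ω + X ω ≤ a} = ∫⁻ ω, P.map W (Set.Iic (a - X ω)) ∂P := by
  have : IsProbabilityMeasure (P.map W) := Measure.isProbabilityMeasure_map hW.aemeasurable
  have : IsProbabilityMeasure (P.map X) := Measure.isProbabilityMeasure_map hX.aemeasurable
  have hset : MeasurableSet {p : ℝ × ℝ | p.1 + p.2 ≤ a} :=
    measurableSet_le (by fun_prop) measurable_const
  calc
    P {ω | W ω + X ω ≤ a} = P.map (fun ω => (W ω, X ω)) {p : ℝ × ℝ | p.1 + p.2 ≤ a} := by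
      rw [Measure.map_apply (hW.prodMk hX) hset]
      rfl
    _ = ∫⁻ ω, P.map W ((fun w => (w, X ω)) ⁻¹' {p : ℝ × ℝ | p.1 + p.2 ≤ a}) ∂P := by
      rw [(indepFun_iff_map_prod_eq_prod_map_map hW.aemeasurable hX.aemeasurable).1 hindep,
        Measure.prod_apply_symm hset, lintegral_map (measurable_measure_prodMk_right hset) hX]
    _ = ∫⁻ ω, P.map W (Set.Iic (a - X ω)) ∂P := by
      congr with ω
      congr with w
      simp [le_sub_iff_add_le]

/-- **Theorem 1 (main theorem).** If `X` is a bounded gamble with Aumann–Serrano riskiness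
at most `s` (i.e. `E[exp(-X/s)] ≤ 1`), `W` is an independent background risk whose law has a
strictly positive differentiable Lebesgue density `g` with `g' ≤ g / s`, then `W + X`
first-order stochastically dominates `W`. -/
theorem accepting_is_dominant_of_riskiness_le_exponential_size
    {Ω : Type*} [MeasurableSpace Ω] (P : Measure Ω) [IsProbabilityMeasure P]
    (s : ℝ) (hs : 0 < s)
    (W X : Ω → ℝ) (hWmeas : Measurable W) (hXmeas : Measurable X)
    (hindep : IndepFun W X P)
    (hXbdd : ∃ C : ℝ, ∀ ω, |X ω| ≤ C)
    (hrisk : ∫ ω, Real.exp (-X ω / s) ∂P ≤ 1)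
    (g : ℝ → ℝ) (hgpos : ∀ a, 0 < g a) (hgdiff : Differentiable ℝ g)
    (hgtail : ∀ a, deriv g a ≤ g a / s)
    (hdens : Measure.map W P = volume.withDensity (fun a => ENNReal.ofReal (g a))) :
    ∀ a : ℝ, P {ω | W ω + X ω ≤ a} ≤ P {ω | W ω ≤ a} := by
  intro a
  have : IsProbabilityMeasure (P.map W) := Measure.isProbabilityMeasure_map hWmeas.aemeasurable
  have hbound (x : ℝ) : (P.map W).real (Set.Iic (a - x)) ≤
      (P.map W).real (Set.Iic a) + s * g a * (Real.exp (-x / s) - 1) := by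
    have h := integral_le_of_antitone_mul_exp_neg_div hs.ne' hgdiff.continuous
      (antitone_mul_exp_neg_div_of_deriv_le hgdiff hgtail) a (a - x)
    rw [← measureReal_Iic_sub_Iic_of_withDensity hgdiff.continuous.measurable
      (fun u => (hgpos u).le) hdens, sub_sub_cancel_left] at h
    linarith
  have hexp_int : Integrable (fun ω => Real.exp (-X ω / s)) P := by
    obtain ⟨C, hC⟩ := hXbdd
    refine Integrable.of_bound (by fun_prop) (Real.exp (C / s)) (ae_of_all _ fun ω => ?_)
    rw [Real.norm_of_nonneg (Real.exp_pos _).le]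
    gcongr
    exact (neg_le_abs _).trans (hC ω)
  have hdiff_int : Integrable (fun ω => s * g a * (Real.exp (-X ω / s) - 1)) P :=
    (hexp_int.sub (integrable_const 1)).const_mul _
  calc
    P {ω | W ω + X ω ≤ a} = ∫⁻ ω, P.map W (Set.Iic (a - X ω)) ∂P :=
      hindep.measure_add_le hWmeas hXmeas a
    _ ≤ ∫⁻ ω, ENNReal.ofReal ((P.map W).real (Set.Iic a) +
          s * g a * (Real.exp (-X ω / s) - 1)) ∂P := by
      refine lintegral_mono fun ω => ?_
      rw [← ofReal_measureReal]
      exact ENNReal.ofReal_le_ofReal (hbound (X ω))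
    _ = ENNReal.ofReal (∫ ω, ((P.map W).real (Set.Iic a) +
          s * g a * (Real.exp (-X ω / s) - 1)) ∂P) :=
      (ofReal_integral_eq_lintegral_ofReal ((integrable_const _).add hdiff_int)
        (ae_of_all _ fun ω => measureReal_nonneg.trans (hbound (X ω)))).symm
    _ ≤ ENNReal.ofReal ((P.map W).real (Set.Iic a)) := by
      apply ENNReal.ofReal_le_ofReal
      rw [integral_add (integrable_const _) hdiff_int, integral_const_mul,
        integral_sub hexp_int (integrable_const 1)]
      simp only [integral_const, probReal_univ, one_smul]
      have := mul_nonneg (mul_pos hs (hgpos a)).le (sub_nonneg.2 hrisk)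
      linarith
    _ = P {ω | W ω ≤ a} := by
      rw [ofReal_measureReal, Measure.map_apply hWmeas measurableSet_Iic]
      rfl
end

section
/- Let s > 0. Let W and X be independent real-valued random variables, with X bounded and E[exp(-X/s)] ≤ 1. Suppose the law of W has a Lebesgue density g : ℝ → ℝ that is strictly positive everywhere and such that the map a ↦ g(a)·exp(-a/s) is antitone (non-increasing) on ℝ. Then P(W + X ≤ a) ≤ P(W ≤ a) for every a ∈ ℝ, i.e., W + X first-order stochastically dominates W. -/
open MeasureTheory ProbabilityTheory

/-- If `g t * exp (-t / s)` is antitone, then the increments of an antiderivative of `g` lie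
below its tangent in the variable `exp (t / s)`. -/
lemma intervalIntegral_le_of_antitone_mul_exp {s : ℝ} (hs : 0 < s) {g : ℝ → ℝ}
    (hganti : Antitone (fun a => g a * Real.exp (-a / s))) (hgint : Integrable g) (a b : ℝ) :
    ∫ t in a..b, g t ≤
      g a * Real.exp (-a / s) * (s * (Real.exp (b / s) - Real.exp (a / s))) := by
  have hexp : ∀ c d : ℝ, ∫ t in c..d, g a * Real.exp (-a / s) * Real.exp (t / s) =
      g a * Real.exp (-a / s) * (s * (Real.exp (d / s) - Real.exp (c / s))) := by
    intro c d
    rw [intervalIntegral.integral_const_mul,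
      intervalIntegral.integral_comp_div (fun t => Real.exp t) hs.ne', integral_exp, smul_eq_mul]
  have hcont : Continuous fun t : ℝ => g a * Real.exp (-a / s) * Real.exp (t / s) := by
    fun_prop
  have hg : ∀ t, g t = g t * Real.exp (-t / s) * Real.exp (t / s) := by
    intro t
    rw [mul_assoc, ← Real.exp_add, neg_div, neg_add_cancel, Real.exp_zero, mul_one]
  rcases le_total a b with hab | hba
  · rw [← hexp]
    refine intervalIntegral.integral_mono_on hab hgint.intervalIntegrable
      (hcont.intervalIntegrable a b) fun t ht => ?_
    rw [hg t]
    exact mul_le_mul_of_nonneg_right (hganti ht.1) (Real.exp_pos _).le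
  · rw [← hexp, intervalIntegral.integral_symm b a, intervalIntegral.integral_symm b a]
    refine neg_le_neg (intervalIntegral.integral_mono_on hba (hcont.intervalIntegrable b a)
      hgint.intervalIntegrable fun t ht => ?_)
    rw [hg t]
    exact mul_le_mul_of_nonneg_right (hganti ht.2) (Real.exp_pos _).le

/-- The cdf of a law with density `g` lies below its tangent in the variable `exp (a / s)`
when `g a * exp (-a / s)` is antitone. -/
lemma measureReal_Iic_le_of_antitone_mul_exp {s : ℝ} (hs : 0 < s) {g : ℝ → ℝ}
    (hg0 : ∀ a, 0 ≤ g a) (hganti : Antitone (fun a => g a * Real.exp (-a / s)))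
    (hgint : Integrable g) {μ : Measure ℝ}
    (hdens : μ = volume.withDensity (fun a => ENNReal.ofReal (g a))) (a b : ℝ) :
    μ.real (Set.Iic b) ≤ μ.real (Set.Iic a) +
      g a * Real.exp (-a / s) * (s * (Real.exp (b / s) - Real.exp (a / s))) := by
  have hcdf : ∀ c, μ.real (Set.Iic c) = ∫ t in Set.Iic c, g t := by
    intro c
    rw [measureReal_def, hdens, withDensity_apply _ measurableSet_Iic,
      integral_eq_lintegral_of_nonneg_ae (Filter.Eventually.of_forall hg0)
        hgint.integrableOn.aestronglyMeasurable]
  have hsub := intervalIntegral.integral_Iic_sub_Iic (hgint.integrableOn (s := Set.Iic a))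
    (hgint.integrableOn (s := Set.Iic b))
  have := intervalIntegral_le_of_antitone_mul_exp hs hganti hgint a b
  rw [hcdf, hcdf]
  linarith

/-- The cdf of a sum of independent variables, conditioning on the second summand. -/
lemma measure_add_le_eq_lintegral {Ω : Type*} [MeasurableSpace Ω] {P : Measure Ω}
    [IsProbabilityMeasure P] {W X : Ω → ℝ} (hW : Measurable W) (hX : Measurable X)
    (hindep : IndepFun W X P) (a : ℝ) :
    P {ω | W ω + X ω ≤ a} = ∫⁻ ω, (P.map W) (Set.Iic (a - X ω)) ∂P := by
  have hprod := (indepFun_iff_map_prod_eq_prod_map_map hW.aemeasurable hX.aemeasurable).1 hindep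
  have := Measure.isProbabilityMeasure_map (μ := P) hW.aemeasurable
  have := Measure.isProbabilityMeasure_map (μ := P) hX.aemeasurable
  have hset : MeasurableSet {p : ℝ × ℝ | p.1 + p.2 ≤ a} :=
    measurableSet_le (by fun_prop) measurable_const
  have hmap : P {ω | W ω + X ω ≤ a} =
      (P.map fun ω => (W ω, X ω)) {p : ℝ × ℝ | p.1 + p.2 ≤ a} := by
    rw [Measure.map_apply (hW.prodMk hX) hset]
    rfl
  rw [hmap, hprod, Measure.prod_apply_symm hset,
    lintegral_map (measurable_measure_prodMk_right hset) hX]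
  refine lintegral_congr fun ω => congrArg _ ?_
  ext w
  simp [le_sub_iff_add_le]

/-- **General sufficiency (end of Section 4).** If `X` is a bounded gamble with
Aumann–Serrano riskiness at most `s` (i.e. `E[exp(-X/s)] ≤ 1`) and `W` is an independent
background risk whose law has a strictly positive Lebesgue density `g` such that
`a ↦ g a * exp (-a/s)` is non-increasing, then `W + X` first-order stochastically
dominates `W`. -/
theorem accepting_is_dominant_of_antitone_density_ratio
    {Ω : Type*} [MeasurableSpace Ω] (P : Measure Ω) [IsProbabilityMeasure P]
    (s : ℝ) (hs : 0 < s)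
    (W X : Ω → ℝ) (hWmeas : Measurable W) (hXmeas : Measurable X)
    (hindep : IndepFun W X P)
    (hXbdd : ∃ C : ℝ, ∀ ω, |X ω| ≤ C)
    (hrisk : ∫ ω, Real.exp (-X ω / s) ∂P ≤ 1)
    (g : ℝ → ℝ) (hgpos : ∀ a, 0 < g a)
    (hganti : Antitone (fun a => g a * Real.exp (-a / s)))
    (hdens : Measure.map W P = volume.withDensity (fun a => ENNReal.ofReal (g a))) :
    ∀ a : ℝ, P {ω | W ω + X ω ≤ a} ≤ P {ω | W ω ≤ a} := by
  obtain ⟨C, hC⟩ := hXbdd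
  intro a
  have hμ := Measure.isProbabilityMeasure_map (μ := P) hWmeas.aemeasurable
  have hgmeas : Measurable g := by
    have hprod : Measurable fun t => g t * Real.exp (-t / s) * Real.exp (t / s) :=
      hganti.measurable.mul (by fun_prop)
    convert hprod using 2 with t
    rw [mul_assoc, ← Real.exp_add, neg_div, neg_add_cancel, Real.exp_zero, mul_one]
  have hgint : Integrable g := by
    refine ⟨hgmeas.aestronglyMeasurable, ?_⟩
    rw [hasFiniteIntegral_iff_ofReal (Filter.Eventually.of_forall fun t => (hgpos t).le),
      ← setLIntegral_univ, ← withDensity_apply _ MeasurableSet.univ, ← hdens]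
    exact measure_lt_top _ _
  have hexpint : Integrable (fun ω => Real.exp (-X ω / s)) P := by
    refine Integrable.of_bound (by fun_prop) (Real.exp (C / s))
      (Filter.Eventually.of_forall fun ω => ?_)
    rw [Real.norm_eq_abs, Real.abs_exp, Real.exp_le_exp]
    gcongr
    exact (neg_le_abs _).trans (hC ω)
  set μ := P.map W with hμ_def
  have hcdf_mono : Monotone fun c => μ.real (Set.Iic c) :=
    fun c d hcd => measureReal_mono (Set.Iic_subset_Iic.2 hcd)
  have hcdf_meas : Measurable fun ω => μ.real (Set.Iic (a - X ω)) :=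
    hcdf_mono.measurable.comp (hXmeas.const_sub a)
  have hcdf_int : Integrable (fun ω => μ.real (Set.Iic (a - X ω))) P := by
    refine Integrable.of_bound hcdf_meas.aestronglyMeasurable 1
      (Filter.Eventually.of_forall fun ω => ?_)
    rw [Real.norm_eq_abs, abs_of_nonneg measureReal_nonneg]
    exact measureReal_le_one
  have htangent : ∀ ω, μ.real (Set.Iic (a - X ω)) ≤
      μ.real (Set.Iic a) + s * g a * (Real.exp (-X ω / s) - 1) := by
    intro ω
    refine (measureReal_Iic_le_of_antitone_mul_exp hs (fun t => (hgpos t).le) hganti hgint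
      hdens a (a - X ω)).trans_eq ?_
    have h₁ : Real.exp ((a - X ω) / s) = Real.exp (a / s) * Real.exp (-X ω / s) := by
      rw [← Real.exp_add]
      ring_nf
    have h₂ : Real.exp (-a / s) * Real.exp (a / s) = 1 := by
      rw [← Real.exp_add, neg_div, neg_add_cancel, Real.exp_zero]
    rw [h₁]
    linear_combination s * g a * (Real.exp (-X ω / s) - 1) * h₂
  have hexpect : ∫ ω, μ.real (Set.Iic (a - X ω)) ∂P ≤ μ.real (Set.Iic a) := by
    have hsub : Integrable (fun ω => Real.exp (-X ω / s) - 1) P :=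
      hexpint.sub (integrable_const 1)
    refine (integral_mono hcdf_int
      ((integrable_const _).add (hsub.const_mul (s * g a))) htangent).trans ?_
    simp only [Pi.add_apply]
    rw [integral_add (integrable_const _) (hsub.const_mul _), integral_const_mul,
      integral_sub hexpint (integrable_const 1)]
    simp only [integral_const, probReal_univ, one_smul]
    have := mul_nonneg (mul_pos hs (hgpos a)).le (sub_nonneg.2 hrisk)
    linarith
  have hWcdf : P {ω | W ω ≤ a} = μ (Set.Iic a) :=
    (Measure.map_apply hWmeas measurableSet_Iic).symm
  rw [measure_add_le_eq_lintegral hWmeas hXmeas hindep, hWcdf, ← hμ_def]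
  have hofReal : ∀ c, μ (Set.Iic c) = ENNReal.ofReal (μ.real (Set.Iic c)) :=
    fun c => (ofReal_measureReal (measure_ne_top μ _)).symm
  simp_rw [hofReal]
  rw [← ofReal_integral_eq_lintegral_ofReal hcdf_int
    (Filter.Eventually.of_forall fun _ => measureReal_nonneg)]
  exact ENNReal.ofReal_le_ofReal hexpect
end

section
/- Let s > 0 and let W be a real-valued random variable with cumulative distribution function G(a) = P(W ≤ a). The following are equivalent: (i) the map t ↦ G(s · log t) is concave on the interval (0, ∞); (ii) for every compactly supported probability measure ν on ℝ with ∫ exp(-x/s) dν(x) ≤ 1, the convolution of the law of W with ν first-order stochastically dominates the law of W, i.e., (law(W) * ν)((-∞, a]) ≤ P(W ≤ a) for every a ∈ ℝ. -/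
open MeasureTheory ProbabilityTheory

theorem conv_map_Iic_eq_lintegral {Ω : Type*} [MeasurableSpace Ω] (P : Measure Ω)
    [IsProbabilityMeasure P] {W : Ω → ℝ} (hW : Measurable W) (ν : Measure ℝ) [SFinite ν] (a : ℝ) :
    (Measure.conv (Measure.map W P) ν) (Set.Iic a) = ∫⁻ x, P {ω | W ω ≤ a - x} ∂ν := by
  have : IsProbabilityMeasure (Measure.map W P) := Measure.isProbabilityMeasure_map hW.aemeasurable
  rw [Measure.conv, Measure.map_apply (by fun_prop) measurableSet_Iic,
    Measure.prod_apply_symm ((by fun_prop : Measurable fun p : ℝ × ℝ => p.1 + p.2)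
      measurableSet_Iic)]
  refine lintegral_congr fun x => ?_
  have h : (fun y : ℝ => (y, x)) ⁻¹' ((fun p : ℝ × ℝ => p.1 + p.2) ⁻¹' Set.Iic a)
      = Set.Iic (a - x) := by
    ext y
    simp [le_sub_iff_add_le]
  rw [h, Measure.map_apply hW measurableSet_Iic]
  rfl

theorem integral_le_of_concaveOn_comp_log {s : ℝ} (hs : 0 < s) {G : ℝ → ℝ} (hGmono : Monotone G)
    (hconc : ConcaveOn ℝ (Set.Ioi (0 : ℝ)) (fun t => G (s * Real.log t)))
    (ν : Measure ℝ) [IsProbabilityMeasure ν] {K : Set ℝ} (hK : IsCompact K) (hνK : ν Kᶜ = 0)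
    (hν : (∫ x, Real.exp (-x / s) ∂ν) ≤ 1) (a : ℝ) :
    ∫ x, G (a - x) ∂ν ≤ G a := by
  obtain ⟨M, hM⟩ := hK.isBounded.exists_norm_le
  have hae : ∀ᵐ x ∂ν, |x| ≤ M := by
    have hmem : ∀ᵐ x ∂ν, x ∈ K := hνK
    filter_upwards [hmem] with x hx using hM x hx
  set T : ℝ → ℝ := fun x => Real.exp ((a - x) / s) with hT
  set S : Set ℝ := Set.Icc (Real.exp ((a - M) / s)) (Real.exp ((a + M) / s)) with hS
  have hSpos : S ⊆ Set.Ioi 0 := fun t ht => (Real.exp_pos _).trans_le ht.1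
  have hTS : ∀ᵐ x ∂ν, T x ∈ S := by
    filter_upwards [hae] with x hx
    have hx' := abs_le.1 hx
    exact ⟨Real.exp_le_exp.2 (by gcongr; exact hx'.2),
      Real.exp_le_exp.2 (by gcongr; linarith)⟩
  have hGT : ∀ x, G (s * Real.log (T x)) = G (a - x) := fun x => by
    rw [hT, Real.log_exp, mul_div_cancel₀ _ hs.ne']
  have hTint : Integrable T ν :=
    Integrable.of_mem_Icc _ _ (by fun_prop) hTS
  have hGint : Integrable (fun x => G (a - x)) ν := by
    refine Integrable.of_mem_Icc (G (a - M)) (G (a + M))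
      (hGmono.measurable.comp (by fun_prop)).aemeasurable ?_
    filter_upwards [hae] with x hx
    have hx' := abs_le.1 hx
    exact ⟨hGmono (by linarith), hGmono (by linarith)⟩
  have hjensen := (hconc.subset hSpos (convex_Icc _ _)).le_map_integral
    ((hconc.continuousOn isOpen_Ioi).mono hSpos) isClosed_Icc hTS hTint
    (by simpa only [Function.comp_def, hGT] using hGint)
  simp only [hGT] at hjensen
  have hTle : ∫ x, T x ∂ν ≤ Real.exp (a / s) := by
    have h : T = fun x => Real.exp (a / s) * Real.exp (-x / s) := by
      funext x
      rw [hT, ← Real.exp_add]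
      ring_nf
    rw [h, integral_const_mul]
    exact mul_le_of_le_one_right (Real.exp_pos _).le hν
  have hTpos : 0 < ∫ x, T x ∂ν :=
    hSpos ((convex_Icc _ _).integral_mem isClosed_Icc hTS hTint)
  refine hjensen.trans (hGmono ?_)
  calc s * Real.log (∫ x, T x ∂ν) ≤ s * Real.log (Real.exp (a / s)) := by gcongr
    _ = a := by rw [Real.log_exp, mul_div_cancel₀ _ hs.ne']

theorem concaveOn_comp_log_of_integral_le {s : ℝ} (hs : 0 < s) {G : ℝ → ℝ}
    (h : ∀ ν : Measure ℝ, IsProbabilityMeasure ν → (∃ K : Set ℝ, IsCompact K ∧ ν Kᶜ = 0) →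
      (∫ x, Real.exp (-x / s) ∂ν) ≤ 1 → ∀ a : ℝ, ∫ x, G (a - x) ∂ν ≤ G a) :
    ConcaveOn ℝ (Set.Ioi (0 : ℝ)) (fun t => G (s * Real.log t)) := by
  refine ⟨convex_Ioi 0, fun u hu v hv α β hα hβ hαβ => ?_⟩
  rw [Set.mem_Ioi] at hu hv
  have ht : 0 < α • u + β • v := convex_Ioi (0 : ℝ) hu hv hα hβ hαβ
  simp only [smul_eq_mul] at ht ⊢
  set t := α * u + β * v with ht_def
  set x := s * Real.log t - s * Real.log u with hx
  set y := s * Real.log t - s * Real.log v with hy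
  set ν : Measure ℝ := ENNReal.ofReal α • Measure.dirac x + ENNReal.ofReal β • Measure.dirac y
    with hν
  have hint : ∀ f : ℝ → ℝ, ∫ z, f z ∂ν = α * f x + β * f y := fun f => by
    have hf : ∀ c : ℝ, Integrable f (Measure.dirac c) := fun c =>
      integrable_dirac (by simp)
    rw [hν, integral_add_measure ((hf x).smul_measure ENNReal.ofReal_ne_top)
      ((hf y).smul_measure ENNReal.ofReal_ne_top), integral_smul_measure, integral_smul_measure,
      integral_dirac, integral_dirac, ENNReal.toReal_ofReal hα, ENNReal.toReal_ofReal hβ,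
      smul_eq_mul, smul_eq_mul]
  have hprob : IsProbabilityMeasure ν := ⟨by
    simp [hν, ← ENNReal.ofReal_add hα hβ, hαβ]⟩
  have hexp : ∀ w : ℝ, 0 < w →
      Real.exp (-(s * Real.log t - s * Real.log w) / s) = w / t := fun w hw => by
    rw [show -(s * Real.log t - s * Real.log w) / s = Real.log w - Real.log t by
      field_simp; ring, Real.exp_sub, Real.exp_log hw, Real.exp_log ht]
  have hsupp : ∃ K : Set ℝ, IsCompact K ∧ ν Kᶜ = 0 :=
    ⟨{x, y}, (Set.toFinite _).isCompact, by simp [hν]⟩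
  have hrisk : ∫ z, Real.exp (-z / s) ∂ν ≤ 1 := by
    rw [hint, hx, hy, hexp u hu, hexp v hv, ← mul_div_assoc, ← mul_div_assoc, ← add_div,
      ← ht_def, div_self ht.ne']
  have hmain := h ν hprob hsupp hrisk (s * Real.log t)
  rw [hint] at hmain
  simpa only [hx, hy, sub_sub_cancel] using hmain

/-- **Sharp characterization (end of Section 4).** Given a background risk `W` with cdf `G`,
the map `t ↦ G (s * log t)` is concave on `(0, ∞)` if and only if every compactly supported
gamble `ν` with Aumann–Serrano riskiness at most `s` (i.e. `∫ exp (-x/s) dν ≤ 1`) is such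
that the law of `W + X` (the convolution of the law of `W` with `ν`) first-order
stochastically dominates the law of `W`. -/
theorem concave_iff_dominant_for_all_gambles
    {Ω : Type*} [MeasurableSpace Ω] (P : Measure Ω) [IsProbabilityMeasure P]
    (s : ℝ) (hs : 0 < s)
    (W : Ω → ℝ) (hWmeas : Measurable W)
    (G : ℝ → ℝ) (hG : ∀ a, G a = (P {ω | W ω ≤ a}).toReal) :
    ConcaveOn ℝ (Set.Ioi (0 : ℝ)) (fun t => G (s * Real.log t)) ↔
      ∀ ν : Measure ℝ, IsProbabilityMeasure ν →
        (∃ K : Set ℝ, IsCompact K ∧ ν Kᶜ = 0) →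
        (∫ x, Real.exp (-x / s) ∂ν) ≤ 1 →
        ∀ a : ℝ, (Measure.conv (Measure.map W P) ν) (Set.Iic a) ≤ P {ω | W ω ≤ a} := by
  have hP : ∀ a, P {ω | W ω ≤ a} = ENNReal.ofReal (G a) := fun a => by
    rw [hG, ENNReal.ofReal_toReal (measure_ne_top _ _)]
  have hG0 : ∀ a, 0 ≤ G a := fun a => by
    rw [hG]
    exact ENNReal.toReal_nonneg
  have hG1 : ∀ a, G a ≤ 1 := fun a => by
    rw [hG]
    exact measureReal_le_one
  have hGmono : Monotone G := fun a b hab => by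
    rw [hG, hG]
    exact measureReal_mono fun ω (hω : W ω ≤ a) => hω.trans hab
  have hiff : ∀ (ν : Measure ℝ) [IsProbabilityMeasure ν] (a : ℝ),
      (Measure.conv (Measure.map W P) ν) (Set.Iic a) ≤ P {ω | W ω ≤ a} ↔
        ∫ x, G (a - x) ∂ν ≤ G a := fun ν _ a => by
    have hint : Integrable (fun x => G (a - x)) ν :=
      Integrable.of_mem_Icc 0 1 (hGmono.measurable.comp (by fun_prop)).aemeasurable
        (.of_forall fun x => ⟨hG0 _, hG1 _⟩)
    simp only [conv_map_Iic_eq_lintegral P hWmeas, hP]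
    rw [← ofReal_integral_eq_lintegral_ofReal hint (.of_forall fun x => hG0 _),
      ENNReal.ofReal_le_ofReal_iff (hG0 a)]
  constructor
  · rintro hconc ν hν ⟨K, hK, hνK⟩ hrisk a
    exact (hiff ν a).2 (integral_le_of_concaveOn_comp_log hs hGmono hconc ν hK hνK hrisk a)
  · intro h
    exact concaveOn_comp_log_of_integral_le hs fun ν hν hsupp hrisk a =>
      (hiff ν a).1 (h ν hν hsupp hrisk a)
end

section
/- Let W and X be independent real-valued random variables, with X bounded, E[X] > 0. Suppose the law of W has a Lebesgue density g : ℝ → ℝ that is strictly positive everywhere, differentiable, and such that there exists s > 0 with g'(a) ≤ g(a)/s for every a ∈ ℝ. Then there exists t₀ > 0 such that for every t with 0 < t ≤ t₀ and every a ∈ ℝ, P(W + t·X ≤ a) ≤ P(W ≤ a); that is, W + t·X first-order stochastically dominates W for all sufficiently small t > 0. -/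
open MeasureTheory ProbabilityTheory

/-- If `g' ≤ g / s`, then `x ↦ exp (-x / s) * g x` is antitone. -/
lemma antitone_exp_mul_of_deriv_le_div {g : ℝ → ℝ} {s : ℝ} (hg : Differentiable ℝ g)
    (h : ∀ a, deriv g a ≤ g a / s) : Antitone fun x => Real.exp (-x / s) * g x := by
  have hd (x : ℝ) : HasDerivAt (fun x => Real.exp (-x / s) * g x)
      (Real.exp (-x / s) * (-1 / s) * g x + Real.exp (-x / s) * deriv g x) x :=
    (((hasDerivAt_id x).neg.div_const s).exp).mul (hg x).hasDerivAt
  refine antitone_of_deriv_nonpos (fun x => (hd x).differentiableAt) fun x => ?_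
  rw [(hd x).deriv]
  have := mul_le_mul_of_nonneg_left (h x) (Real.exp_pos (-x / s)).le
  have e : Real.exp (-x / s) * (-1 / s) * g x = -(Real.exp (-x / s) * (g x / s)) := by ring
  linarith

/-- If `g' ≤ g / s`, then `g` grows at most exponentially at rate `1 / s`. -/
lemma le_mul_exp_of_deriv_le_div {g : ℝ → ℝ} {s : ℝ} (hg : Differentiable ℝ g)
    (h : ∀ a, deriv g a ≤ g a / s) {x y : ℝ} (hxy : x ≤ y) :
    g y ≤ g x * Real.exp ((y - x) / s) := by
  have := mul_le_mul_of_nonneg_left (antitone_exp_mul_of_deriv_le_div hg h hxy)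
    (Real.exp_pos (y / s)).le
  simp only [← mul_assoc, ← Real.exp_add] at this
  rw [show y / s + -y / s = 0 by ring, show y / s + -x / s = (y - x) / s by ring] at this
  simpa [mul_comm] using this

/-- If `g' ≤ g / s`, then integrals of `g` from `a`, in either direction, are bounded by those of
the exponential with rate `1 / s` agreeing with `g` at `a`. -/
lemma intervalIntegral_le_of_deriv_le_div {g : ℝ → ℝ} {s : ℝ} (hs : 0 < s)
    (hg : Differentiable ℝ g) (h : ∀ a, deriv g a ≤ g a / s) (a b : ℝ) :
    ∫ u in a..b, g u ≤ g a * s * (Real.exp ((b - a) / s) - 1) := by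
  have hc : Continuous fun u => g a * Real.exp ((u - a) / s) := by fun_prop
  have hd (x : ℝ) : HasDerivAt (fun u => g a * s * Real.exp ((u - a) / s))
      (g a * Real.exp ((x - a) / s)) x := by
    have := ((((hasDerivAt_id' x).sub_const a).div_const s).exp).const_mul (g a * s)
    rwa [show g a * s * (Real.exp ((x - a) / s) * (1 / s)) = g a * Real.exp ((x - a) / s) by
      field_simp] at this
  have hI := intervalIntegral.integral_eq_sub_of_hasDerivAt (fun x _ => hd x)
    (hc.intervalIntegrable a b)
  have hle : ∫ u in a..b, g u ≤ ∫ u in a..b, g a * Real.exp ((u - a) / s) := by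
    rcases le_total a b with hab | hba
    · exact intervalIntegral.integral_mono_on hab (hg.continuous.intervalIntegrable _ _)
        (hc.intervalIntegrable _ _) fun u hu => le_mul_exp_of_deriv_le_div hg h hu.1
    · rw [intervalIntegral.integral_symm b a, intervalIntegral.integral_symm b a, neg_le_neg_iff]
      refine intervalIntegral.integral_mono_on hba (hc.intervalIntegrable _ _)
        (hg.continuous.intervalIntegrable _ _) fun u hu => ?_
      have := mul_le_mul_of_nonneg_right (le_mul_exp_of_deriv_le_div hg h hu.2)
        (Real.exp_pos ((u - a) / s)).le
      rwa [mul_assoc, ← Real.exp_add, show (a - u) / s + (u - a) / s = 0 by ring, Real.exp_zero,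
        mul_one] at this
  refine hle.trans_eq ?_
  rw [hI]
  simp
  ring

/-- The cumulative distribution function of a probability measure with density `g` increases from
`a` to `b` by `∫ u in a..b, g u`. -/
lemma measureReal_Iic_sub_of_withDensity {ν : Measure ℝ} [IsFiniteMeasure ν] {g : ℝ → ℝ}
    (hgm : Measurable g) (hg : ∀ a, 0 ≤ g a)
    (hν : ν = volume.withDensity fun a => ENNReal.ofReal (g a)) (a b : ℝ) :
    ν.real (Set.Iic b) - ν.real (Set.Iic a) = ∫ u in a..b, g u := by
  have hint : Integrable g := by
    refine ⟨hgm.aestronglyMeasurable, ?_⟩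
    rw [hasFiniteIntegral_iff_ofReal (Filter.Eventually.of_forall hg)]
    have := measure_lt_top ν Set.univ
    rwa [hν, withDensity_apply _ MeasurableSet.univ, Measure.restrict_univ] at this
  have hF (c : ℝ) : ν.real (Set.Iic c) = ∫ u in Set.Iic c, g u := by
    rw [integral_eq_lintegral_of_nonneg_ae (Filter.Eventually.of_forall hg)
      hgm.aestronglyMeasurable, hν, measureReal_def, withDensity_apply _ measurableSet_Iic]
  rw [hF, hF, intervalIntegral.integral_Iic_sub_Iic hint.integrableOn hint.integrableOn]

/-- If `g' ≤ g / s`, the cumulative distribution function of a probability measure with density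
`g` satisfies a quadratic upper bound on the interval of radius `s` around any point. -/
lemma measureReal_Iic_add_le {ν : Measure ℝ} [IsFiniteMeasure ν] {g : ℝ → ℝ} {s : ℝ}
    (hs : 0 < s) (hg : ∀ a, 0 ≤ g a) (hgd : Differentiable ℝ g)
    (h : ∀ a, deriv g a ≤ g a / s)
    (hν : ν = volume.withDensity fun a => ENNReal.ofReal (g a)) (a : ℝ) {y : ℝ} (hy : |y| ≤ s) :
    ν.real (Set.Iic (a + y)) ≤ ν.real (Set.Iic a) + g a * (y + y ^ 2 / s) := by
  have h₁ := measureReal_Iic_sub_of_withDensity hgd.continuous.measurable hg hν a (a + y)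
  have h₂ := intervalIntegral_le_of_deriv_le_div hs hgd h a (a + y)
  rw [add_sub_cancel_left] at h₂
  have hys : |y / s| ≤ 1 := by rwa [abs_div, abs_of_pos hs, div_le_one hs]
  have h₃ := (abs_le.1 (Real.abs_exp_sub_one_sub_id_le hys)).2
  have h₄ : g a * s * (Real.exp (y / s) - 1) ≤ g a * s * (y / s + (y / s) ^ 2) :=
    mul_le_mul_of_nonneg_left (by linarith) (mul_nonneg (hg a) hs.le)
  have h₅ : g a * s * (y / s + (y / s) ^ 2) = g a * (y + y ^ 2 / s) := by
    field_simp
  linarith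

/-- Conditioning on `X` in the distribution function of `W + t * X`. -/
lemma ProbabilityTheory.IndepFun.measure_add_mul_le_eq_lintegral {Ω : Type*} [MeasurableSpace Ω]
    {P : Measure Ω} [IsProbabilityMeasure P] {W X : Ω → ℝ} (hW : Measurable W)
    (hX : Measurable X) (hindep : IndepFun W X P) (t a : ℝ) :
    P {ω | W ω + t * X ω ≤ a} = ∫⁻ ω, P.map W (Set.Iic (a + -(t * X ω))) ∂P := by
  have : IsProbabilityMeasure (P.map W) := Measure.isProbabilityMeasure_map hW.aemeasurable
  have hS : MeasurableSet {p : ℝ × ℝ | p.2 + t * p.1 ≤ a} :=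
    measurableSet_le (by fun_prop) measurable_const
  have hmap := (indepFun_iff_map_prod_eq_prod_map_map hX.aemeasurable hW.aemeasurable).1
    hindep.symm
  have hP : P {ω | W ω + t * X ω ≤ a} =
      P.map (fun ω => (X ω, W ω)) {p : ℝ × ℝ | p.2 + t * p.1 ≤ a} := by
    rw [Measure.map_apply (hX.prodMk hW) hS]
    rfl
  rw [hP, hmap, Measure.prod_apply hS, lintegral_map (measurable_measure_prodMk_left hS) hX]
  refine lintegral_congr fun ω => ?_
  congr 1
  ext w
  simp only [Set.mem_preimage, Set.mem_ofPred_eq, Set.mem_Iic]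
  constructor <;> intro _ <;> linarith

/-- **Corollary 1 (heavy left-tailed case).** If the background risk `W` is heavy
left-tailed (its density `g` satisfies `g' ≤ g / s` for some `s > 0`) and `X` is a bounded
independent gamble with strictly positive expectation, then for all sufficiently small
`t > 0` the scaled gamble `t • X` is dominant: `W + t • X` first-order stochastically
dominates `W`. -/
theorem scaled_gamble_dominant_of_heavy_left_tail
    {Ω : Type*} [MeasurableSpace Ω] (P : Measure Ω) [IsProbabilityMeasure P]
    (W X : Ω → ℝ) (hWmeas : Measurable W) (hXmeas : Measurable X)
    (hindep : IndepFun W X P)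
    (hXbdd : ∃ C : ℝ, ∀ ω, |X ω| ≤ C)
    (hXmean : 0 < ∫ ω, X ω ∂P)
    (g : ℝ → ℝ) (hgpos : ∀ a, 0 < g a) (hgdiff : Differentiable ℝ g)
    (hgtail : ∃ s : ℝ, 0 < s ∧ ∀ a, deriv g a ≤ g a / s)
    (hdens : Measure.map W P = volume.withDensity (fun a => ENNReal.ofReal (g a))) :
    ∃ t₀ : ℝ, 0 < t₀ ∧ ∀ t : ℝ, 0 < t → t ≤ t₀ →
      ∀ a : ℝ, P {ω | W ω + t * X ω ≤ a} ≤ P {ω | W ω ≤ a} := by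
  obtain ⟨C₀, hC₀⟩ := hXbdd
  obtain ⟨s, hs, htail⟩ := hgtail
  obtain ⟨C, hCpos, hC⟩ : ∃ C : ℝ, 0 < C ∧ ∀ ω, |X ω| ≤ C :=
    ⟨|C₀| + 1, by positivity, fun ω => by linarith [hC₀ ω, le_abs_self C₀]⟩
  set m := ∫ ω, X ω ∂P with hm
  have hXint : Integrable X P :=
    .of_bound hXmeas.aestronglyMeasurable C (Filter.Eventually.of_forall hC)
  have : IsProbabilityMeasure (P.map W) := Measure.isProbabilityMeasure_map hWmeas.aemeasurable
  refine ⟨min (s / C) (s * m / C ^ 2), by positivity, fun t ht htle a => ?_⟩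
  have htC : t * C ≤ s := (le_div_iff₀ hCpos).1 (htle.trans (min_le_left _ _))
  have htm : t * C ^ 2 ≤ s * m := (le_div_iff₀ (by positivity)).1 (htle.trans (min_le_right _ _))
  set ν := P.map W with hν
  set F := ν.real (Set.Iic a) with hF
  let B : Ω → ℝ := fun ω => F + g a * (-(t * X ω) + (t * C) ^ 2 / s)
  have hbound (ω : Ω) : ν.real (Set.Iic (a + -(t * X ω))) ≤ B ω := by
    have habs : |t * X ω| ≤ t * C := by
      rw [abs_mul, abs_of_pos ht]
      exact mul_le_mul_of_nonneg_left (hC ω) ht.le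
    refine (measureReal_Iic_add_le hs (fun a => (hgpos a).le) hgdiff htail hdens a
      (y := -(t * X ω)) (by rw [abs_neg]; exact habs.trans htC)).trans ?_
    have hsq : (-(t * X ω)) ^ 2 ≤ (t * C) ^ 2 := by
      rw [neg_sq]
      exact sq_le_sq' (abs_le.1 habs).1 (abs_le.1 habs).2
    have := (hgpos a).le
    dsimp only [B]
    gcongr
  have hneg : Integrable (fun ω => -(t * X ω)) P := (hXint.const_mul t).neg
  have hlin : Integrable (fun ω => g a * (-(t * X ω) + (t * C) ^ 2 / s)) P :=
    (hneg.add (integrable_const _)).const_mul (g a)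
  have hBint : Integrable B P := (integrable_const F).add hlin
  have hBval : ∫ ω, B ω ∂P = F + g a * (-(t * m) + (t * C) ^ 2 / s) := by
    dsimp only [B]
    rw [integral_add (integrable_const _) hlin, integral_const_mul,
      integral_add hneg (integrable_const _), integral_neg, integral_const_mul]
    simp [hm]
  have hBle : ∫ ω, B ω ∂P ≤ F := by
    rw [hBval]
    have : (t * C) ^ 2 / s ≤ t * m := by
      rw [div_le_iff₀ hs]
      nlinarith
    nlinarith [hgpos a]
  calc P {ω | W ω + t * X ω ≤ a}
      = ∫⁻ ω, ν (Set.Iic (a + -(t * X ω))) ∂P :=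
        hindep.measure_add_mul_le_eq_lintegral hWmeas hXmeas t a
    _ ≤ ∫⁻ ω, ENNReal.ofReal (B ω) ∂P := lintegral_mono fun ω => by
        rw [← ofReal_measureReal (μ := ν)]
        exact ENNReal.ofReal_le_ofReal (hbound ω)
    _ = ENNReal.ofReal (∫ ω, B ω ∂P) :=
        (ofReal_integral_eq_lintegral_ofReal hBint
          (Filter.Eventually.of_forall fun ω => measureReal_nonneg.trans (hbound ω))).symm
    _ ≤ ENNReal.ofReal F := ENNReal.ofReal_le_ofReal hBle
    _ = P {ω | W ω ≤ a} := by
        rw [hF, ofReal_measureReal, hν, Measure.map_apply hWmeas measurableSet_Iic]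
        rfl
end

section
/- Let ℓ ∈ ℝ. Let W and X be independent real-valued random variables, with X bounded and E[X] > 0. Suppose the law of W has a Lebesgue density g : ℝ → ℝ that is strictly positive everywhere and differentiable, and suppose there exists a constant c > 0 such that g'(a) ≤ c·g(a) for every a ≥ ℓ - 1. Then there exists t₀ > 0 such that for every t with 0 < t ≤ t₀ and every a ≥ ℓ, P(W + t·X ≤ a) ≤ P(W ≤ a); that is, max(W + t·X, ℓ) first-order stochastically dominates max(W, ℓ) for all sufficiently small t > 0. -/
open MeasureTheory ProbabilityTheory

/-- If `g' ≤ c * g` on `[m, ∞)`, then `exp (-c * s) * g s` is nonincreasing there. -/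
theorem antitoneOn_exp_neg_mul_of_deriv_le_mul {g : ℝ → ℝ} (hg : Differentiable ℝ g) {c m : ℝ}
    (h : ∀ a, m ≤ a → deriv g a ≤ c * g a) :
    AntitoneOn (fun s => Real.exp (-c * s) * g s) (Set.Ici m) := by
  have hd (s : ℝ) : HasDerivAt (fun s => Real.exp (-c * s) * g s)
      (Real.exp (-c * s) * (-c) * g s + Real.exp (-c * s) * deriv g s) s :=
    (by simpa using ((hasDerivAt_id s).const_mul (-c)).exp :
      HasDerivAt (fun s => Real.exp (-c * s)) (Real.exp (-c * s) * (-c)) s).mul (hg s).hasDerivAt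
  refine antitoneOn_of_deriv_nonpos (convex_Ici m)
    (fun s _ => (hd s).continuousAt.continuousWithinAt)
    (fun s _ => (hd s).differentiableAt.differentiableWithinAt) fun s hs => ?_
  rw [interior_Ici] at hs
  rw [(hd s).deriv]
  nlinarith [h s (le_of_lt hs), Real.exp_pos (-c * s)]

/-- If `g' ≤ c * g` on `[m, ∞)`, then integrals of `g` from `a` are at most those of the
exponential of rate `c` which agrees with `g` at `a`. -/
theorem intervalIntegral_le_of_deriv_le_mul {g : ℝ → ℝ} (hg : Differentiable ℝ g) {c m : ℝ}
    (hc : 0 < c) (h : ∀ a, m ≤ a → deriv g a ≤ c * g a) {a y : ℝ} (ha : m ≤ a) (hy : m ≤ y) :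
    ∫ s in a..y, g s ≤ g a * ((Real.exp (c * (y - a)) - 1) / c) := by
  have hanti := antitoneOn_exp_neg_mul_of_deriv_le_mul hg h
  have hint : ∫ s in a..y, g a * Real.exp (c * (s - a)) =
      g a * ((Real.exp (c * (y - a)) - 1) / c) := by
    have hd (s : ℝ) : HasDerivAt (fun s => g a * (Real.exp (c * (s - a)) / c))
        (g a * Real.exp (c * (s - a))) s := by
      have h1 := ((((hasDerivAt_id s).sub_const a).const_mul c).exp.div_const c).const_mul (g a)
      exact h1.congr_deriv (by simp only [id]; field_simp)
    rw [intervalIntegral.integral_eq_sub_of_hasDerivAt (fun s _ => hd s)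
      (Continuous.intervalIntegrable (by fun_prop) _ _)]
    simp
    ring
  have hexp (s : ℝ) : g a * Real.exp (c * (s - a)) =
      Real.exp (c * s) * (Real.exp (-c * a) * g a) := by
    rw [show c * (s - a) = c * s + -c * a by ring, Real.exp_add]
    ring
  have hg' (s : ℝ) : g s = Real.exp (c * s) * (Real.exp (-c * s) * g s) := by
    rw [← mul_assoc, ← Real.exp_add]
    simp
  have hcont : Continuous g := hg.continuous
  have hI1 (u v : ℝ) : IntervalIntegrable g volume u v := hcont.intervalIntegrable u v
  have hI2 (u v : ℝ) : IntervalIntegrable (fun s => g a * Real.exp (c * (s - a))) volume u v :=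
    Continuous.intervalIntegrable (by fun_prop) u v
  rw [← hint]
  rcases le_total a y with hay | hya
  · refine intervalIntegral.integral_mono_on hay (hI1 _ _) (hI2 _ _) fun s hs => ?_
    rw [hexp, hg' s]
    exact mul_le_mul_of_nonneg_left (hanti ha (ha.trans hs.1) hs.1) (Real.exp_pos _).le
  · rw [intervalIntegral.integral_symm, intervalIntegral.integral_symm y a, neg_le_neg_iff]
    refine intervalIntegral.integral_mono_on hya (hI2 _ _) (hI1 _ _) fun s hs => ?_
    rw [hexp, hg' s]
    exact mul_le_mul_of_nonneg_left (hanti (hy.trans hs.1) ha hs.2) (Real.exp_pos _).le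

/-- Conditioning on `X`: the distribution function of `W + t * X` for independent `W`, `X`. -/
theorem ProbabilityTheory.IndepFun.measure_add_mul_le {Ω : Type*} [MeasurableSpace Ω]
    {P : Measure Ω} [IsProbabilityMeasure P] {W X : Ω → ℝ} (hW : Measurable W)
    (hX : Measurable X) (h : IndepFun W X P) (t a : ℝ) :
    P {ω | W ω + t * X ω ≤ a} = ∫⁻ ω, P.map W (Set.Iic (a - t * X ω)) ∂P := by
  have hS : MeasurableSet {p : ℝ × ℝ | p.1 + t * p.2 ≤ a} :=
    measurableSet_le (by fun_prop) measurable_const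
  have : IsProbabilityMeasure (P.map W) := Measure.isProbabilityMeasure_map hW.aemeasurable
  have : IsProbabilityMeasure (P.map X) := Measure.isProbabilityMeasure_map hX.aemeasurable
  have h1 : P {ω | W ω + t * X ω ≤ a} =
      P.map (fun ω => (W ω, X ω)) {p : ℝ × ℝ | p.1 + t * p.2 ≤ a} := by
    rw [Measure.map_apply (hW.prodMk hX) hS]
    rfl
  rw [h1, (indepFun_iff_map_prod_eq_prod_map_map hW.aemeasurable hX.aemeasurable).1 h,
    Measure.prod_apply_symm hS, lintegral_map (measurable_measure_prodMk_right hS) hX]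
  refine lintegral_congr fun ω => congrArg _ ?_
  ext w
  simp [le_sub_iff_add_le]

/-- **Corollary 1 (limited liability case).** Let `X` be a bounded gamble with strictly
positive expectation, independent of the background risk `W` whose strictly positive
differentiable density `g` satisfies `g' a ≤ c * g a` for all `a ≥ ℓ - 1` (some `c > 0`).
Then for all sufficiently small `t > 0` and all `a ≥ ℓ`,
`P(W + t • X ≤ a) ≤ P(W ≤ a)`; i.e. `max (W + t • X) ℓ` first-order stochastically
dominates `max W ℓ`. -/
theorem scaled_gamble_dominant_limited_liability
    {Ω : Type*} [MeasurableSpace Ω] (P : Measure Ω) [IsProbabilityMeasure P]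
    (ℓ : ℝ)
    (W X : Ω → ℝ) (hWmeas : Measurable W) (hXmeas : Measurable X)
    (hindep : IndepFun W X P)
    (hXbdd : ∃ C : ℝ, ∀ ω, |X ω| ≤ C)
    (hXmean : 0 < ∫ ω, X ω ∂P)
    (g : ℝ → ℝ) (hgpos : ∀ a, 0 < g a) (hgdiff : Differentiable ℝ g)
    (hgtail : ∃ c : ℝ, 0 < c ∧ ∀ a, ℓ - 1 ≤ a → deriv g a ≤ c * g a)
    (hdens : Measure.map W P = volume.withDensity (fun a => ENNReal.ofReal (g a))) :
    ∃ t₀ : ℝ, 0 < t₀ ∧ ∀ t : ℝ, 0 < t → t ≤ t₀ →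
      ∀ a : ℝ, ℓ ≤ a → P {ω | W ω + t * X ω ≤ a} ≤ P {ω | W ω ≤ a} := by
  obtain ⟨c, hc, hg⟩ := hgtail
  obtain ⟨C₀, hC₀⟩ := hXbdd
  obtain ⟨C, hC1, hC⟩ : ∃ C : ℝ, 1 ≤ C ∧ ∀ ω, |X ω| ≤ C :=
    ⟨max 1 C₀, le_max_left _ _, fun ω => (hC₀ ω).trans (le_max_right _ _)⟩
  have hCpos : 0 < C := one_pos.trans_le hC1
  have hXint : Integrable X P :=
    Integrable.of_bound hXmeas.aestronglyMeasurable C (Filter.Eventually.of_forall hC)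
  have hprob : IsProbabilityMeasure (P.map W) :=
    Measure.isProbabilityMeasure_map hWmeas.aemeasurable
  have hgint : Integrable g := by
    refine ⟨hgdiff.continuous.aestronglyMeasurable, ?_⟩
    rw [hasFiniteIntegral_iff_ofReal (Filter.Eventually.of_forall fun a => (hgpos a).le)]
    have h1 : P.map W Set.univ = 1 := measure_univ
    rw [hdens, withDensity_apply _ MeasurableSet.univ, Measure.restrict_univ] at h1
    simp [h1]
  have hF (y : ℝ) : P.map W (Set.Iic y) = ENNReal.ofReal (∫ s in Set.Iic y, g s) := by
    rw [hdens, withDensity_apply _ measurableSet_Iic,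
      ofReal_integral_eq_lintegral_ofReal hgint.integrableOn
        (Filter.Eventually.of_forall fun a => (hgpos a).le)]
  set m := ∫ ω, X ω ∂P with hm
  refine ⟨min (1 / C) (min (1 / (c * C)) (m / (c * C ^ 2))), by positivity, ?_⟩
  intro t ht htt a ha
  obtain ⟨ht1, ht2, ht3⟩ : t * C ≤ 1 ∧ t * (c * C) ≤ 1 ∧ t * (c * C ^ 2) ≤ m := by
    rw [le_min_iff, le_min_iff, le_div_iff₀ (by positivity), le_div_iff₀ (by positivity),
      le_div_iff₀ (by positivity)] at htt
    exact htt
  have hbound (ω : Ω) : ∫ s in Set.Iic (a - t * X ω), g s ≤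
      (∫ s in Set.Iic a, g s) + g a * (c * (t * C) ^ 2 - t * X ω) := by
    have htX : |t * X ω| ≤ t * C := by
      rw [abs_mul, abs_of_pos ht]
      exact mul_le_mul_of_nonneg_left (hC ω) ht.le
    have h1 := intervalIntegral_le_of_deriv_le_mul hgdiff hc hg (a := a) (y := a - t * X ω)
      (by linarith) (by linarith [le_abs_self (t * X ω)])
    rw [← intervalIntegral.integral_Iic_sub_Iic hgint.integrableOn hgint.integrableOn,
      sub_sub_cancel_left] at h1
    have hsmall : |c * -(t * X ω)| ≤ 1 := by
      rw [abs_mul, abs_neg, abs_of_pos hc]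
      nlinarith
    have h2 := (abs_le.1 (Real.abs_exp_sub_one_sub_id_le hsmall)).2
    have hsq : (t * X ω) ^ 2 ≤ (t * C) ^ 2 := sq_le_sq' (abs_le.1 htX).1 (abs_le.1 htX).2
    have h3 : (Real.exp (c * -(t * X ω)) - 1) / c ≤ c * (t * C) ^ 2 - t * X ω := by
      rw [div_le_iff₀ hc]
      nlinarith [mul_le_mul_of_nonneg_left hsq (sq_nonneg c)]
    linarith [mul_le_mul_of_nonneg_left h3 (hgpos a).le]
  have hint' : Integrable (fun ω => g a * (c * (t * C) ^ 2 - t * X ω)) P :=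
    ((integrable_const _).sub (hXint.const_mul t)).const_mul _
  have hint := (integrable_const (μ := P) (∫ s in Set.Iic a, g s)).add hint'
  have hWa : P {ω | W ω ≤ a} = P.map W (Set.Iic a) := by
    rw [Measure.map_apply hWmeas measurableSet_Iic]
    rfl
  rw [hindep.measure_add_mul_le hWmeas hXmeas, hWa]
  simp_rw [hF]
  calc ∫⁻ ω, ENNReal.ofReal (∫ s in Set.Iic (a - t * X ω), g s) ∂P
      ≤ ∫⁻ ω, ENNReal.ofReal ((∫ s in Set.Iic a, g s) +
          g a * (c * (t * C) ^ 2 - t * X ω)) ∂P :=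
        lintegral_mono fun ω => ENNReal.ofReal_le_ofReal (hbound ω)
    _ = ENNReal.ofReal (∫ ω, ((∫ s in Set.Iic a, g s) +
          g a * (c * (t * C) ^ 2 - t * X ω)) ∂P) :=
        (ofReal_integral_eq_lintegral_ofReal hint (Filter.Eventually.of_forall fun ω =>
          (integral_nonneg fun s => (hgpos s).le).trans (hbound ω))).symm
    _ = ENNReal.ofReal ((∫ s in Set.Iic a, g s) + g a * (c * (t * C) ^ 2 - t * m)) := by
        rw [integral_add (integrable_const _) hint', integral_const_mul,
          integral_sub (integrable_const _) (hXint.const_mul t)]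
        simp [hm, integral_const_mul]
    _ ≤ ENNReal.ofReal (∫ s in Set.Iic a, g s) := by
        refine ENNReal.ofReal_le_ofReal ?_
        have h4 : c * (t * C) ^ 2 - t * m ≤ 0 := by
          nlinarith [mul_le_mul_of_nonneg_left ht3 ht.le]
        linarith [mul_nonpos_of_nonneg_of_nonpos (hgpos a).le h4]
end

section
/- Let M > 0 and ε > 0. Let X be a real random variable taking values in the interval [-M, M] almost surely, with E[X] = ε. If r > 0 satisfies E[exp(-X/r)] = 1, then r ≤ M²/ε. -/
open MeasureTheory ProbabilityTheory

/-- **Proposition 2.** Any gamble `X` supported in `[-M, M]` with expectation `ε > 0` has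
Aumann–Serrano riskiness index at most `M² / ε`: if `r > 0` solves `E[exp(-X/r)] = 1`,
then `r ≤ M² / ε`. -/
theorem riskiness_le_sq_bound_div_mean
    {Ω : Type*} [MeasurableSpace Ω] (P : Measure Ω) [IsProbabilityMeasure P]
    (M ε : ℝ) (hM : 0 < M) (hε : 0 < ε)
    (X : Ω → ℝ) (hXmeas : Measurable X)
    (hXbdd : ∀ᵐ ω ∂P, X ω ∈ Set.Icc (-M) M)
    (hXmean : ∫ ω, X ω ∂P = ε)
    (r : ℝ) (hr : 0 < r)
    (hrisk : ∫ ω, Real.exp (-X ω / r) ∂P = 1) :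
    r ≤ M ^ 2 / ε := by
  have hoeffding := (hasSubgaussianMGF_of_mem_Icc hXmeas.aemeasurable hXbdd).mgf_le (-(1 / r))
  have hmgf : mgf (fun ω ↦ X ω - ∫ ω', X ω' ∂P) P (-(1 / r)) = Real.exp (ε / r) := by
    have hfactor (ω : Ω) :
        Real.exp (-(1 / r) * (X ω - ε)) = Real.exp (ε / r) * Real.exp (-X ω / r) := by
      rw [← Real.exp_add]
      ring_nf
    simp only [mgf, hXmean, hfactor, integral_const_mul, hrisk, mul_one]
  have hnorm : |M - -M| = 2 * M := by
    rw [sub_neg_eq_add, ← two_mul, abs_of_pos (by positivity)]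
  rw [hmgf, Real.exp_le_exp] at hoeffding
  push_cast at hoeffding
  rw [Real.norm_eq_abs, hnorm] at hoeffding
  have hbound : r * ε ≤ M ^ 2 / 2 := by
    calc r * ε = ε / r * r ^ 2 := by field_simp
      _ ≤ (2 * M / 2) ^ 2 * (-(1 / r)) ^ 2 / 2 * r ^ 2 := by gcongr
      _ = M ^ 2 / 2 := by field_simp
  rw [le_div_iff₀ hε]
  linarith [sq_nonneg M]
end

section
/- Let M > 0 and ε > 0. Let X be a real random variable taking values in the interval [-M, M] almost surely, with E[X] = ε. Then E[exp(-(ε/M²)·X)] ≤ 1. -/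
open MeasureTheory ProbabilityTheory

/-- **Key step in the proof of Proposition 2.** If `X ∈ [-M, M]` almost surely and
`E[X] = ε > 0`, then `E[exp(-(ε/M²) • X)] ≤ 1`. -/
theorem exp_neg_mean_div_sq_bound_le_one
    {Ω : Type*} [MeasurableSpace Ω] (P : Measure Ω) [IsProbabilityMeasure P]
    (M ε : ℝ) (hM : 0 < M) (hε : 0 < ε)
    (X : Ω → ℝ) (hXmeas : Measurable X)
    (hXbdd : ∀ᵐ ω ∂P, X ω ∈ Set.Icc (-M) M)
    (hXmean : ∫ ω, X ω ∂P = ε) :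
    ∫ ω, Real.exp (-(ε / M ^ 2) * X ω) ∂P ≤ 1 := by
  have hXint : Integrable X P :=
    Integrable.of_mem_Icc (-M) M hXmeas.aemeasurable hXbdd
  have hεM : ε ≤ M := by
    have h := integral_mono_ae hXint (integrable_const M) (hXbdd.mono fun ω hω => hω.2)
    simpa [hXmean] using h
  set c := ε / M ^ 2 with hc
  have hc0 : 0 ≤ c := by positivity
  have hcM : c * M ≤ 1 := by
    rw [hc, div_mul_eq_mul_div, div_le_one (by positivity)]
    nlinarith
  have hcε : c ^ 2 * M ^ 2 = c * ε := by
    rw [hc]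
    field_simp
  have hbound : ∀ᵐ ω ∂P, Real.exp (-c * X ω) ≤ (1 + c * ε) - c * X ω := by
    filter_upwards [hXbdd] with ω hω
    have hy : |-c * X ω| ≤ 1 := by
      rw [abs_mul, abs_neg, abs_of_nonneg hc0]
      exact (mul_le_mul_of_nonneg_left (abs_le.2 hω) hc0).trans hcM
    have hexp := (abs_le.1 (Real.abs_exp_sub_one_sub_id_le hy)).2
    have hsq : c ^ 2 * X ω ^ 2 ≤ c ^ 2 * M ^ 2 :=
      mul_le_mul_of_nonneg_left (sq_le_sq' hω.1 hω.2) (sq_nonneg c)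
    linarith [show (-c * X ω) ^ 2 = c ^ 2 * X ω ^ 2 by ring]
  calc ∫ ω, Real.exp (-c * X ω) ∂P
      ≤ ∫ ω, ((1 + c * ε) - c * X ω) ∂P :=
        integral_mono_of_nonneg (ae_of_all _ fun ω => (Real.exp_pos _).le)
          ((integrable_const _).sub (hXint.const_mul c)) hbound
    _ = 1 := by
        rw [integral_sub (integrable_const _) (hXint.const_mul c), integral_const_mul, hXmean]
        simp
end

section
/- Let X be a bounded real random variable with E[X] > 0 and P(X < 0) > 0. Then there exists a unique r > 0 such that E[exp(-X/r)] = 1. -/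
open MeasureTheory ProbabilityTheory

/-- The moment generating function of a random variable that is not almost surely zero is
strictly convex, provided it is finite everywhere. -/
theorem strictConvexOn_mgf {Ω : Type*} [MeasurableSpace Ω] {μ : Measure Ω} {Y : Ω → ℝ}
    (hint : ∀ t : ℝ, Integrable (fun ω ↦ Real.exp (t * Y ω)) μ) (hY : ¬ Y =ᵐ[μ] 0) :
    StrictConvexOn ℝ Set.univ (mgf Y μ) := by
  refine ⟨convex_univ, fun x _ y _ hxy a b ha hb hab ↦ ?_⟩
  set g : Ω → ℝ := fun ω ↦ a * Real.exp (x * Y ω) + b * Real.exp (y * Y ω)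
    - Real.exp ((a * x + b * y) * Y ω) with hg
  have hexp (ω : Ω) : a • (x * Y ω) + b • (y * Y ω) = (a * x + b * y) * Y ω := by
    simp only [smul_eq_mul]; ring
  have hg_nonneg (ω : Ω) : 0 ≤ g ω := by
    have := convexOn_exp.2 (Set.mem_univ (x * Y ω)) (Set.mem_univ (y * Y ω)) ha.le hb.le hab
    rw [hexp] at this
    exact sub_nonneg.2 this
  have hg_pos (ω : Ω) (hω : Y ω ≠ 0) : 0 < g ω := by
    have := strictConvexOn_exp.2 (Set.mem_univ (x * Y ω)) (Set.mem_univ (y * Y ω))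
      (fun h ↦ hxy (mul_right_cancel₀ hω h)) ha hb hab
    rw [hexp] at this
    exact sub_pos.2 this
  have hab_int : Integrable (fun ω ↦ a * Real.exp (x * Y ω) + b * Real.exp (y * Y ω)) μ :=
    ((hint x).const_mul a).add ((hint y).const_mul b)
  have hg_int : Integrable g μ := hab_int.sub (hint (a * x + b * y))
  have hg_integral : ∫ ω, g ω ∂μ = a * mgf Y μ x + b * mgf Y μ y - mgf Y μ (a * x + b * y) := by
    simp only [hg, mgf]
    rw [integral_sub hab_int (hint _), integral_add ((hint x).const_mul a) ((hint y).const_mul b),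
      integral_const_mul, integral_const_mul]
  have hne : ∫ ω, g ω ∂μ ≠ 0 := fun h ↦ by
    rw [integral_eq_zero_iff_of_nonneg hg_nonneg hg_int] at h
    refine hY ?_
    filter_upwards [h] with ω hω
    by_contra hω'
    exact (hg_pos ω hω').ne' hω
  have hpos := (integral_nonneg hg_nonneg).lt_of_ne' hne
  rw [hg_integral] at hpos
  simpa only [smul_eq_mul] using sub_pos.1 hpos

/-- The moment generating function of a random variable that is positive with positive
probability tends to infinity at infinity. -/
theorem tendsto_mgf_atTop {Ω : Type*} [MeasurableSpace Ω] {μ : Measure Ω} {Y : Ω → ℝ}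
    (hint : ∀ t : ℝ, Integrable (fun ω ↦ Real.exp (t * Y ω)) μ) (hY : Integrable Y μ)
    (hpos : 0 < μ {ω | 0 < Y ω}) :
    Filter.Tendsto (mgf Y μ) Filter.atTop Filter.atTop := by
  have hc : 0 < ∫ ω, max (Y ω) 0 ∂μ := by
    refine (integral_pos_iff_support_of_nonneg (fun ω ↦ le_max_right _ _) hY.pos_part).2 ?_
    refine hpos.trans_le (measure_mono fun ω hω ↦ ?_)
    exact (lt_max_of_lt_left hω).ne'
  refine Filter.tendsto_atTop_mono' _ ?_ (Filter.tendsto_id.atTop_mul_const hc)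
  filter_upwards [Filter.eventually_ge_atTop 0] with t ht
  rw [id, ← integral_const_mul]
  refine integral_mono (hY.pos_part.const_mul t) (hint t) fun ω ↦ ?_
  simp only [mul_max_of_nonneg _ _ ht, mul_zero]
  exact max_le (by linarith [Real.add_one_le_exp (t * Y ω)]) (Real.exp_pos _).le

/-- A strictly convex function on the line that has a negative derivative at `0` and tends to
infinity at infinity returns to its value at `0` exactly once on the positive half-line. -/
theorem StrictConvexOn.existsUnique_pos_eq_zero_value {f : ℝ → ℝ} {f' : ℝ}
    (hf : StrictConvexOn ℝ Set.univ f) (hderiv : HasDerivAt f f' 0) (hf' : f' < 0)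
    (hlim : Filter.Tendsto f Filter.atTop Filter.atTop) :
    ∃! t : ℝ, 0 < t ∧ f t = f 0 := by
  have hslope := (hasDerivAt_iff_tendsto_slope.1 hderiv).mono_left
    (nhdsWithin_mono (0 : ℝ) (s := Set.Ioi 0) fun t ht ↦ ht.ne')
  obtain ⟨s, hs_slope, hs : 0 < s⟩ :=
    ((hslope.eventually_lt_const hf').and self_mem_nhdsWithin).exists
  have hfs : f s < f 0 := by
    rw [slope_def_field, sub_zero, div_neg_iff] at hs_slope
    rcases hs_slope with h | h <;> linarith
  obtain ⟨u, hfu, hsu⟩ :=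
    ((hlim.eventually_ge_atTop (f 0)).and (Filter.eventually_ge_atTop s)).exists
  have hcont : ContinuousOn f (Set.Icc s u) :=
    (hf.convexOn.continuousOn isOpen_univ).mono (Set.subset_univ _)
  obtain ⟨t, ht, hft⟩ := intermediate_value_Icc hsu hcont ⟨hfs.le, hfu⟩
  have hunique {a b : ℝ} (ha : 0 < a) (hab : a < b) (hfa : f a = f 0) : f b ≠ f 0 := fun hfb ↦ by
    have := hf.slope_strict_mono_adjacent (Set.mem_univ 0) (Set.mem_univ b) ha hab
    simp [hfa, hfb] at this
  refine ⟨t, ⟨hs.trans_le ht.1, hft⟩, fun v ⟨hv, hfv⟩ ↦ ?_⟩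
  rcases lt_trichotomy v t with h | h | h
  · exact absurd hft (hunique hv h hfv)
  · exact h
  · exact absurd hfv (hunique (hs.trans_le ht.1) h hft)

/-- **Well-definedness of the Aumann–Serrano riskiness index.** For every bounded gamble
`X` with strictly positive expectation and strictly positive probability of a loss, there
is a unique `r > 0` with `E[exp(-X/r)] = 1`. -/
theorem exists_unique_riskiness_index
    {Ω : Type*} [MeasurableSpace Ω] (P : Measure Ω) [IsProbabilityMeasure P]
    (X : Ω → ℝ) (hXmeas : Measurable X)
    (hXbdd : ∃ C : ℝ, ∀ ω, |X ω| ≤ C)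
    (hXmean : 0 < ∫ ω, X ω ∂P)
    (hXloss : 0 < P {ω | X ω < 0}) :
    ∃! r : ℝ, 0 < r ∧ ∫ ω, Real.exp (-X ω / r) ∂P = 1 := by
  obtain ⟨C, hC⟩ := hXbdd
  have hint (t : ℝ) : Integrable (fun ω ↦ Real.exp (t * (-X) ω)) P :=
    integrable_exp_mul_of_mem_Icc (a := -C) (b := C) hXmeas.neg.aemeasurable
      (.of_forall fun ω ↦ abs_le.1 (by simpa using hC ω))
  have hX_int : Integrable (-X) P := (Integrable.of_bound hXmeas.aestronglyMeasurable C
    (.of_forall hC)).neg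
  have hX_ne : ¬ -X =ᵐ[P] 0 := fun h ↦ by
    have := integral_congr_ae h
    simp only [Pi.neg_apply, Pi.zero_apply, integral_neg, integral_zero] at this
    linarith
  have hderiv : HasDerivAt (mgf (-X) P) (∫ ω, -X ω ∂P) 0 := by
    have h0 : (0 : ℝ) ∈ interior (integrableExpSet (-X) P) := by
      simp [Set.eq_univ_of_forall (s := integrableExpSet (-X) P) hint]
    simpa using hasDerivAt_mgf h0
  have key := (strictConvexOn_mgf hint hX_ne).existsUnique_pos_eq_zero_value hderiv
    (by rw [integral_neg]; linarith)
    (tendsto_mgf_atTop hint hX_int (by simpa using hXloss))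
  have hmgf (r : ℝ) : ∫ ω, Real.exp (-X ω / r) ∂P = mgf (-X) P r⁻¹ := by
    simp only [mgf, Pi.neg_apply, div_eq_inv_mul]
  simp only [mgf_zero] at key
  obtain ⟨t, ⟨ht, hmt⟩, huniq⟩ := key
  refine ⟨t⁻¹, ⟨inv_pos.2 ht, by rw [hmgf, inv_inv, hmt]⟩, fun r ⟨hr, hmr⟩ ↦ ?_⟩
  rw [← huniq r⁻¹ ⟨inv_pos.2 hr, hmgf r ▸ hmr⟩, inv_inv]
end

section
/- Let s > 0. Let W and X be independent real-valued random variables, with X bounded, E[exp(-X/s)] ≤ 1, and E[|W|] < ∞. Suppose the law of W has a Lebesgue density g : ℝ → ℝ that is strictly positive everywhere and satisfies g(a) ≤ (1/s)·∫_{-∞}^{a} g(t) dt for every a ∈ ℝ. Then for every a ∈ ℝ, ∫_{-∞}^{a} P(W + X ≤ t) dt ≤ ∫_{-∞}^{a} P(W ≤ t) dt; that is, W + X second-order stochastically dominates W. -/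
open MeasureTheory ProbabilityTheory

/-- Tonelli: integrating a distribution function up to `a` gives the expected shortfall below `a`. -/
lemma lintegral_Iic_measure_le_eq_lintegral_ofReal_sub {Ω : Type*} [MeasurableSpace Ω]
    (P : Measure Ω) [SFinite P] {Y : Ω → ℝ} (hY : Measurable Y) (a : ℝ) :
    ∫⁻ t in Set.Iic a, P {ω | Y ω ≤ t} = ∫⁻ ω, ENNReal.ofReal (a - Y ω) ∂P := by
  have hS : MeasurableSet {z : ℝ × Ω | Y z.2 ≤ z.1} :=
    measurableSet_le (hY.comp measurable_snd) measurable_fst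
  calc ∫⁻ t in Set.Iic a, P {ω | Y ω ≤ t}
      = ((volume.restrict (Set.Iic a)).prod P) {z : ℝ × Ω | Y z.2 ≤ z.1} :=
        (Measure.prod_apply hS).symm
    _ = ∫⁻ ω, volume.restrict (Set.Iic a) (Set.Ici (Y ω)) ∂P := Measure.prod_apply_symm hS
    _ = ∫⁻ ω, ENNReal.ofReal (a - Y ω) ∂P := by
        refine lintegral_congr fun ω => ?_
        rw [Measure.restrict_apply measurableSet_Ici, Set.Ici_inter_Iic, Real.volume_Icc]

/-- The distribution function of an integrable variable is integrable near `-∞`. -/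
lemma integrableOn_Iic_measureReal_le {Ω : Type*} [MeasurableSpace Ω]
    (P : Measure Ω) [IsFiniteMeasure P] {Y : Ω → ℝ} (hY : Measurable Y) (hint : Integrable Y P)
    (a : ℝ) : IntegrableOn (fun t => (P {ω | Y ω ≤ t}).toReal) (Set.Iic a) := by
  have hmono : Monotone fun t => P {ω | Y ω ≤ t} :=
    fun t u htu => measure_mono fun ω (hω : Y ω ≤ t) => hω.trans htu
  refine integrable_toReal_of_lintegral_ne_top hmono.measurable.aemeasurable ?_
  rw [lintegral_Iic_measure_le_eq_lintegral_ofReal_sub P hY]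
  exact (((integrable_const a).sub hint).lintegral_lt_top).ne

lemma ofReal_integral_Iic_measureReal_le {Ω : Type*} [MeasurableSpace Ω]
    (P : Measure Ω) [IsFiniteMeasure P] {Y : Ω → ℝ} (hY : Measurable Y) (hint : Integrable Y P)
    (a : ℝ) : ENNReal.ofReal (∫ t in Set.Iic a, (P {ω | Y ω ≤ t}).toReal)
      = ∫⁻ ω, ENNReal.ofReal (a - Y ω) ∂P := by
  rw [← lintegral_Iic_measure_le_eq_lintegral_ofReal_sub P hY,
    ofReal_integral_eq_lintegral_ofReal (integrableOn_Iic_measureReal_le P hY hint a)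
      (Filter.Eventually.of_forall fun _ => ENNReal.toReal_nonneg)]
  exact lintegral_congr fun t => ENNReal.ofReal_toReal (measure_ne_top _ _)

/-- The shortfall of a sum of independent variables, computed by conditioning on one of them. -/
lemma lintegral_ofReal_sub_add_of_indepFun {Ω : Type*} [MeasurableSpace Ω]
    (P : Measure Ω) [IsProbabilityMeasure P] {W X : Ω → ℝ}
    (hW : Measurable W) (hX : Measurable X) (h : IndepFun W X P) (a : ℝ) :
    ∫⁻ ω, ENNReal.ofReal (a - (W ω + X ω)) ∂P
      = ∫⁻ ω, ∫⁻ ω', ENNReal.ofReal (a - X ω - W ω') ∂P ∂P := by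
  have hf : Measurable fun z : ℝ × ℝ => ENNReal.ofReal (a - z.1 - z.2) := by fun_prop
  have hprod := (indepFun_iff_map_prod_eq_prod_map_map hX.aemeasurable hW.aemeasurable).1 h.symm
  have : IsProbabilityMeasure (P.map W) := Measure.isProbabilityMeasure_map hW.aemeasurable
  calc ∫⁻ ω, ENNReal.ofReal (a - (W ω + X ω)) ∂P
      = ∫⁻ z, ENNReal.ofReal (a - z.1 - z.2) ∂(P.map fun ω => (X ω, W ω)) := by
        rw [lintegral_map hf (hX.prodMk hW)]
        exact lintegral_congr fun ω => by congr 1; ring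
    _ = ∫⁻ x, ∫⁻ w, ENNReal.ofReal (a - x - w) ∂(P.map W) ∂(P.map X) := by
        rw [hprod, lintegral_prod _ hf.aemeasurable]
    _ = ∫⁻ ω, ∫⁻ ω', ENNReal.ofReal (a - X ω - W ω') ∂P ∂P := by
        rw [lintegral_map hf.lintegral_prod_right' hX]
        exact lintegral_congr fun ω => lintegral_map (by fun_prop) hW

/-- Integral form of Grönwall's inequality. -/
lemma le_mul_exp_of_sub_le_integral {G : ℝ → ℝ} (hG : Continuous G) {s : ℝ} (hs : 0 < s)
    (h : ∀ a b, a ≤ b → G b - G a ≤ (1 / s) * ∫ t in a..b, G t) {a b : ℝ} (hab : a ≤ b) :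
    G b ≤ G a * Real.exp ((b - a) / s) := by
  set F : ℝ → ℝ := fun t => G a + (1 / s) * ∫ u in a..t, G u with hF
  have hFd (t : ℝ) : HasDerivAt F ((1 / s) * G t) t :=
    ((hG.integral_hasStrictDerivAt a t).hasDerivAt.const_mul (1 / s)).const_add (G a)
  have hEd (t : ℝ) : HasDerivAt (fun t => Real.exp (-(t - a) / s))
      (Real.exp (-(t - a) / s) * (-1 / s)) t :=
    ((((hasDerivAt_id t).sub_const a).neg).div_const s).exp
  have hd (t : ℝ) := (hFd t).mul (hEd t)
  have hanti : AntitoneOn (fun t => F t * Real.exp (-(t - a) / s)) (Set.Ici a) := by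
    refine antitoneOn_of_deriv_nonpos (convex_Ici a)
      (fun t _ => (hd t).continuousAt.continuousWithinAt)
      (fun t _ => (hd t).differentiableAt.differentiableWithinAt) fun t ht => ?_
    rw [interior_Ici] at ht
    have hGF : G t ≤ F t := by have := h a t ht.le; simp only [hF]; linarith
    have he : deriv (fun t => F t * Real.exp (-(t - a) / s)) t
        = Real.exp (-(t - a) / s) * (1 / s) * (G t - F t) := by
      refine (hd t).deriv.trans ?_
      ring
    rw [he]
    exact mul_nonpos_of_nonneg_of_nonpos (by positivity) (by linarith)
  have hb : F b * Real.exp (-(b - a) / s) ≤ G a := by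
    simpa [hF] using hanti Set.self_mem_Ici hab hab
  have hGb : G b ≤ F b := by have := h a b hab; simp only [hF]; linarith
  calc G b ≤ F b := hGb
    _ = F b * Real.exp (-(b - a) / s) * Real.exp ((b - a) / s) := by
        rw [mul_assoc, ← Real.exp_add, neg_div, neg_add_cancel, Real.exp_zero, mul_one]
    _ ≤ _ := by gcongr

/-- If `G t * exp (-t / s)` is antitone, an antiderivative of `G` is a concave function of
`exp (t / s)`, so it lies below its tangent. -/
lemma integral_le_mul_exp_sub_one {G : ℝ → ℝ} (hG : Continuous G) {s : ℝ} (hs : 0 < s)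
    (h : ∀ a b, a ≤ b → G b ≤ G a * Real.exp ((b - a) / s)) (a b : ℝ) :
    ∫ t in a..b, G t ≤ s * G a * (Real.exp ((b - a) / s) - 1) := by
  have hd (t : ℝ) : HasDerivAt (fun t => s * G a * Real.exp ((t - a) / s))
      (G a * Real.exp ((t - a) / s)) t := by
    refine (((((hasDerivAt_id t).sub_const a).div_const s).exp).const_mul (s * G a)).congr_deriv ?_
    simp only [id]
    field_simp
  have hcont : Continuous fun t => G a * Real.exp ((t - a) / s) := by fun_prop
  have hint : ∫ t in a..b, G a * Real.exp ((t - a) / s)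
      = s * G a * (Real.exp ((b - a) / s) - 1) := by
    rw [intervalIntegral.integral_eq_sub_of_hasDerivAt (fun t _ => hd t)
      (hcont.intervalIntegrable a b)]
    simp
    ring
  rw [← hint]
  rcases le_total a b with hab | hba
  · exact intervalIntegral.integral_mono_on hab (hG.intervalIntegrable a b)
      (hcont.intervalIntegrable a b) fun t ht => h a t ht.1
  · rw [intervalIntegral.integral_symm b a, intervalIntegral.integral_symm b a, neg_le_neg_iff]
    refine intervalIntegral.integral_mono_on hba (hcont.intervalIntegrable b a)
      (hG.intervalIntegrable b a) fun t ht => ?_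
    calc G a * Real.exp ((t - a) / s)
        ≤ G t * Real.exp ((a - t) / s) * Real.exp ((t - a) / s) := by gcongr; exact h t a ht.2
      _ = G t := by
          rw [mul_assoc, ← Real.exp_add, ← add_div]
          simp

/-- **Theorem 2 (second-order stochastic dominance).** Let `X` be a bounded gamble with
Aumann–Serrano riskiness at most `s` (i.e. `E[exp(-X/s)] ≤ 1`), independent of the
integrable background risk `W` whose law has a strictly positive Lebesgue density `g`
with `g a ≤ (1/s) * ∫_{-∞}^a g` for all `a` (modified exponential size at least `s`).
Then `W + X` second-order stochastically dominates `W`. -/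
theorem accepting_is_second_order_dominant
    {Ω : Type*} [MeasurableSpace Ω] (P : Measure Ω) [IsProbabilityMeasure P]
    (s : ℝ) (hs : 0 < s)
    (W X : Ω → ℝ) (hWmeas : Measurable W) (hXmeas : Measurable X)
    (hindep : IndepFun W X P)
    (hXbdd : ∃ C : ℝ, ∀ ω, |X ω| ≤ C)
    (hrisk : ∫ ω, Real.exp (-X ω / s) ∂P ≤ 1)
    (hWint : Integrable W P)
    (g : ℝ → ℝ) (hgpos : ∀ a, 0 < g a)
    (hgtail : ∀ a, g a ≤ (1 / s) * ∫ t in Set.Iic a, g t)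
    (hdens : Measure.map W P = volume.withDensity (fun a => ENNReal.ofReal (g a))) :
    ∀ a : ℝ, ∫ t in Set.Iic a, (P {ω | W ω + X ω ≤ t}).toReal
      ≤ ∫ t in Set.Iic a, (P {ω | W ω ≤ t}).toReal := by
  obtain ⟨C, hC⟩ := hXbdd
  intro a
  have hgint (t : ℝ) : IntegrableOn g (Set.Iic t) := by
    by_contra hni
    have hle := hgtail t
    rw [integral_undef hni, mul_zero] at hle
    exact (hgpos t).not_ge hle
  set G : ℝ → ℝ := fun t => (P {ω | W ω ≤ t}).toReal with hGdef
  have hGg (t : ℝ) : G t = ∫ u in Set.Iic t, g u := by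
    have hmap : P {ω | W ω ≤ t} = P.map W (Set.Iic t) :=
      (Measure.map_apply hWmeas measurableSet_Iic).symm
    simp only [hGdef]
    rw [hmap, hdens, withDensity_apply _ measurableSet_Iic,
      ← ofReal_integral_eq_lintegral_ofReal (hgint t)
        (Filter.Eventually.of_forall fun u => (hgpos u).le),
      ENNReal.toReal_ofReal (setIntegral_nonneg measurableSet_Iic fun u _ => (hgpos u).le)]
  have hgii (t u : ℝ) : IntervalIntegrable g volume t u :=
    ⟨(hgint u).mono_set Set.Ioc_subset_Iic_self, (hgint t).mono_set Set.Ioc_subset_Iic_self⟩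
  have hGsub (t u : ℝ) : G u - G t = ∫ v in t..u, g v := by
    rw [hGg, hGg, intervalIntegral.integral_Iic_sub_Iic (hgint t) (hgint u)]
  have hGcont : Continuous G := by
    have hG0 : G = fun t => G 0 + ∫ v in (0 : ℝ)..t, g v := by
      funext t
      rw [← hGsub 0 t]
      ring
    rw [hG0]
    exact continuous_const.add (intervalIntegral.continuous_primitive hgii 0)
  have hgrowth (t u : ℝ) (htu : t ≤ u) : G u ≤ G t * Real.exp ((u - t) / s) := by
    refine le_mul_exp_of_sub_le_integral hGcont hs (fun t u htu => ?_) htu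
    rw [hGsub, ← intervalIntegral.integral_const_mul]
    refine intervalIntegral.integral_mono_on htu (hgii t u)
      ((hGcont.const_mul (1 / s)).intervalIntegrable t u) fun v _ => ?_
    rw [hGg]
    exact hgtail v
  set H : ℝ → ℝ := fun b => ∫ t in Set.Iic b, G t
  have hGint (b : ℝ) : IntegrableOn G (Set.Iic b) :=
    integrableOn_Iic_measureReal_le P hWmeas hWint b
  have hHnonneg (b : ℝ) : 0 ≤ H b := integral_nonneg fun _ => ENNReal.toReal_nonneg
  have htangent (x : ℝ) : H (a - x) ≤ H a + s * G a * (Real.exp (-x / s) - 1) := by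
    have hle := integral_le_mul_exp_sub_one hGcont hs hgrowth a (a - x)
    rw [← intervalIntegral.integral_Iic_sub_Iic (hGint a) (hGint (a - x)),
      show a - x - a = -x by ring] at hle
    linarith
  have hXint : Integrable X P :=
    .of_bound hXmeas.aestronglyMeasurable C (Filter.Eventually.of_forall hC)
  have hexp : Integrable (fun ω => Real.exp (-X ω / s)) P := by
    refine .of_bound (by fun_prop) (Real.exp (C / s)) (Filter.Eventually.of_forall fun ω => ?_)
    rw [Real.norm_eq_abs, Real.abs_exp]
    gcongr
    exact (neg_le_abs _).trans (hC ω)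
  have hdiff : Integrable (fun ω => Real.exp (-X ω / s) - 1) P := hexp.sub (integrable_const 1)
  have htint : Integrable (fun ω => H a + s * G a * (Real.exp (-X ω / s) - 1)) P :=
    (integrable_const _).add (hdiff.const_mul _)
  refine (ENNReal.ofReal_le_ofReal_iff (hHnonneg a)).1 ?_
  calc ENNReal.ofReal (∫ t in Set.Iic a, (P {ω | W ω + X ω ≤ t}).toReal)
      = ∫⁻ ω, ENNReal.ofReal (a - (W ω + X ω)) ∂P :=
        ofReal_integral_Iic_measureReal_le P (hWmeas.add hXmeas) (hWint.add hXint) a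
    _ = ∫⁻ ω, ∫⁻ ω', ENNReal.ofReal (a - X ω - W ω') ∂P ∂P :=
        lintegral_ofReal_sub_add_of_indepFun P hWmeas hXmeas hindep a
    _ = ∫⁻ ω, ENNReal.ofReal (H (a - X ω)) ∂P :=
        lintegral_congr fun ω => (ofReal_integral_Iic_measureReal_le P hWmeas hWint _).symm
    _ ≤ ∫⁻ ω, ENNReal.ofReal (H a + s * G a * (Real.exp (-X ω / s) - 1)) ∂P :=
        lintegral_mono fun ω => ENNReal.ofReal_le_ofReal (htangent (X ω))
    _ = ENNReal.ofReal (∫ ω, (H a + s * G a * (Real.exp (-X ω / s) - 1)) ∂P) :=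
        (ofReal_integral_eq_lintegral_ofReal htint
          (Filter.Eventually.of_forall fun ω => (hHnonneg _).trans (htangent (X ω)))).symm
    _ ≤ ENNReal.ofReal (H a) := by
        refine ENNReal.ofReal_le_ofReal ?_
        rw [integral_add (integrable_const _) (hdiff.const_mul _),
          integral_const_mul, integral_sub hexp (integrable_const 1)]
        simp only [integral_const, probReal_univ, one_smul]
        have hGa : 0 ≤ s * G a := mul_nonneg hs.le ENNReal.toReal_nonneg
        nlinarith
end

section
/- Let s > 0 and let g : ℝ → ℝ be a strictly positive, differentiable Lebesgue probability density (so ∫_ℝ g = 1) satisfying g'(a) ≤ g(a)/s for every a ∈ ℝ. Then g(a) ≤ (1/s)·∫_{-∞}^{a} g(t) dt for every a ∈ ℝ. -/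
open MeasureTheory

/-- An integrable real function on a left half-line takes values below any positive level. -/
lemma exists_le_lt_of_integrableOn_Iic {f : ℝ → ℝ} {a ε : ℝ}
    (hf : IntegrableOn f (Set.Iic a)) (hε : 0 < ε) : ∃ y ≤ a, f y < ε := by
  by_contra! h
  have hconst : IntegrableOn (fun _ : ℝ => ε) (Set.Iic a) := by
    refine Integrable.mono' hf aestronglyMeasurable_const ?_
    filter_upwards [ae_restrict_mem measurableSet_Iic] with x hx
    rw [Real.norm_of_nonneg hε.le]
    exact h x hx
  simp [integrableOn_const_iff, hε.ne'] at hconst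

/-- **`S₂(W) ≥ S(W)` (footnote to Theorem 2).** If `g` is a strictly positive,
differentiable Lebesgue probability density with `g' ≤ g / s`, then
`g a ≤ (1/s) * ∫_{-∞}^a g` for every `a`. -/
theorem density_le_inv_smul_integral_of_deriv_bound
    (s : ℝ) (hs : 0 < s)
    (g : ℝ → ℝ) (hgpos : ∀ a, 0 < g a) (hgdiff : Differentiable ℝ g)
    (hgint : ∫ t, g t = 1)
    (hgtail : ∀ a, deriv g a ≤ g a / s) :
    ∀ a : ℝ, g a ≤ (1 / s) * ∫ t in Set.Iic a, g t := by
  intro a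
  have hg : Integrable g := .of_integral_ne_zero (by simp [hgint])
  refine le_of_forall_pos_le_add fun ε hε => ?_
  obtain ⟨y, hya, hy⟩ := exists_le_lt_of_integrableOn_Iic hg.integrableOn (a := a) hε
  have hftc : g a - g y ≤ ∫ t in y..a, g t / s :=
    intervalIntegral.sub_le_integral_of_hasDeriv_right_of_le hya hgdiff.continuous.continuousOn
      (fun x _ => (hgdiff x).hasDerivAt.hasDerivWithinAt) (hg.div_const s).integrableOn
      (fun x _ => hgtail x)
  have hmono : ∫ t in Set.Ioc y a, g t ≤ ∫ t in Set.Iic a, g t :=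
    setIntegral_mono_set hg.integrableOn (.of_forall fun x => (hgpos x).le)
      Set.Ioc_subset_Iic_self.eventuallyLE
  rw [intervalIntegral.integral_div, intervalIntegral.integral_of_le hya, div_eq_inv_mul,
    ← one_div] at hftc
  have := mul_le_mul_of_nonneg_left hmono (one_div_pos.2 hs).le
  linarith
end

section
/- Let ℓ ∈ ℝ. Let u : ℝ → ℝ be differentiable, strictly increasing, concave, and bounded above. Let W and X be independent real-valued random variables such that P(W = ℓ) = 0 and P(W > ℓ) > 0, and such that X is bounded with E[X] < 0. Then there exists t₀ > 0 such that for every t with 0 < t ≤ t₀, E[u(max(W + t·X, ℓ))] < E[u(max(W, ℓ))]. -/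
open MeasureTheory ProbabilityTheory

open Set Filter Topology

/-- A differentiable, strictly increasing, concave function has positive derivative. -/
lemma ConcaveOn.deriv_pos_of_strictMono {u : ℝ → ℝ} (hu_conc : ConcaveOn ℝ univ u)
    (hu_diff : Differentiable ℝ u) (hu_mono : StrictMono u) (x : ℝ) : 0 < deriv u x := by
  have h := hu_conc.slope_le_deriv (mem_univ x) (mem_univ (x + 1)) (lt_add_one x) (hu_diff x)
  have h' := hu_mono (lt_add_one x)
  rw [slope_def_field, add_sub_cancel_left, div_one] at h
  linarith

/-- A differentiable, increasing, concave function is Lipschitz on `[ℓ, ∞)` with constant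
its derivative at `ℓ`. -/
lemma ConcaveOn.abs_sub_le_deriv_mul {u : ℝ → ℝ} (hu_conc : ConcaveOn ℝ univ u)
    (hu_diff : Differentiable ℝ u) (hu_mono : Monotone u) {ℓ a b : ℝ} (ha : ℓ ≤ a) (hb : ℓ ≤ b) :
    |u a - u b| ≤ deriv u ℓ * |a - b| := by
  wlog hab : a ≤ b generalizing a b
  · rw [abs_sub_comm, abs_sub_comm a]
    exact this hb ha (le_of_not_ge hab)
  rcases hab.eq_or_lt with rfl | hab
  · simp
  have h := hu_conc.slope_le_deriv (mem_univ a) (mem_univ b) hab (hu_diff a)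
  have h' := hu_conc.antitoneOn_deriv (fun x _ ↦ hu_diff x) (mem_univ ℓ) (mem_univ a) ha
  rw [slope_def_field, div_le_iff₀ (sub_pos.2 hab)] at h
  rw [abs_sub_comm, abs_sub_comm a, abs_of_nonneg (sub_nonneg.2 (hu_mono hab.le)),
    abs_of_pos (sub_pos.2 hab)]
  exact h.trans (mul_le_mul_of_nonneg_right h' (sub_pos.2 hab).le)

/-- The derivative at `0` of the truncated utility of `w + t * x`, away from the kink `w = ℓ`. -/
lemma hasDerivAt_comp_max_add_mul {u : ℝ → ℝ} (hu_diff : Differentiable ℝ u) {ℓ w : ℝ}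
    (hw : w ≠ ℓ) (x : ℝ) :
    HasDerivAt (fun t : ℝ ↦ u (max (w + t * x) ℓ)) ((Ioi ℓ).indicator (deriv u) w * x) 0 := by
  have hcont : Tendsto (fun t : ℝ ↦ w + t * x) (𝓝 0) (𝓝 w) := by
    have : Continuous fun t : ℝ ↦ w + t * x := by fun_prop
    simpa using this.tendsto 0
  rcases hw.lt_or_gt with h | h
  · have h0 : (Ioi ℓ).indicator (deriv u) w = 0 := indicator_of_notMem (by simp [h.le]) _
    rw [h0, zero_mul]
    refine (hasDerivAt_const (0 : ℝ) (u ℓ)).congr_of_eventuallyEq ?_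
    filter_upwards [hcont.eventually_lt_const h] with t ht
    rw [max_eq_right ht.le]
  · rw [indicator_of_mem (show w ∈ Ioi ℓ from h)]
    have hlin : HasDerivAt (fun t : ℝ ↦ w + t * x) x 0 := by
      simpa using ((hasDerivAt_id (0 : ℝ)).mul_const x).const_add w
    have hu : HasDerivAt u (deriv u w) (w + 0 * x) := by simpa using (hu_diff w).hasDerivAt
    refine (hu.comp 0 hlin).congr_of_eventuallyEq ?_
    filter_upwards [hcont.eventually_const_lt h] with t ht
    simp [max_eq_left ht.le]

/-- **Proposition 3 (limited liability does not induce risk-loving behavior).** Let `u` be a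
differentiable, strictly increasing, concave utility bounded above, and let `X` be a bounded
gamble with strictly negative expectation, independent of the background risk `W` with
`P(W = ℓ) = 0` and `P(W > ℓ) > 0`. Then for all sufficiently small `t > 0` the decision
maker rejects `t • X` under limited liability with bound `ℓ`:
`E[u(max (W + t • X) ℓ)] < E[u(max W ℓ)]`. -/
theorem reject_small_unfavorable_gamble_limited_liability
    {Ω : Type*} [MeasurableSpace Ω] (P : Measure Ω) [IsProbabilityMeasure P]
    (ℓ : ℝ)
    (u : ℝ → ℝ) (hu_diff : Differentiable ℝ u) (hu_mono : StrictMono u)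
    (hu_conc : ConcaveOn ℝ Set.univ u) (hu_bdd : BddAbove (Set.range u))
    (W X : Ω → ℝ) (hWmeas : Measurable W) (hXmeas : Measurable X)
    (hindep : IndepFun W X P)
    (hWeq : P {ω | W ω = ℓ} = 0) (hWgt : 0 < P {ω | ℓ < W ω})
    (hXbdd : ∃ C : ℝ, ∀ ω, |X ω| ≤ C)
    (hXmean : ∫ ω, X ω ∂P < 0) :
    ∃ t₀ : ℝ, 0 < t₀ ∧ ∀ t : ℝ, 0 < t → t ≤ t₀ →
      ∫ ω, u (max (W ω + t * X ω) ℓ) ∂P < ∫ ω, u (max (W ω) ℓ) ∂P := by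
  obtain ⟨C, hC⟩ := hXbdd
  have hpos := hu_conc.deriv_pos_of_strictMono hu_diff hu_mono
  have hmeas_u : Measurable u := hu_diff.continuous.measurable
  have hh_meas : Measurable ((Ioi ℓ).indicator (deriv u)) :=
    (measurable_deriv u).indicator measurableSet_Ioi
  have hh_nonneg : ∀ w, 0 ≤ (Ioi ℓ).indicator (deriv u) w :=
    indicator_nonneg fun w _ ↦ (hpos w).le
  have hh_le : ∀ w, (Ioi ℓ).indicator (deriv u) w ≤ deriv u ℓ := fun w ↦
    indicator_apply_le' (fun hw ↦ hu_conc.antitoneOn_deriv (fun x _ ↦ hu_diff x) (mem_univ ℓ)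
      (mem_univ w) (le_of_lt hw)) fun _ ↦ (hpos ℓ).le
  have hh_int : Integrable (fun ω ↦ (Ioi ℓ).indicator (deriv u) (W ω)) P :=
    Integrable.of_bound (hh_meas.comp hWmeas).aestronglyMeasurable (deriv u ℓ)
      (ae_of_all _ fun ω ↦ by
        rw [Real.norm_of_nonneg (hh_nonneg _)]
        exact hh_le _)
  have hh_integral_pos : 0 < ∫ ω, (Ioi ℓ).indicator (deriv u) (W ω) ∂P := by
    rw [integral_pos_iff_support_of_nonneg (fun ω ↦ hh_nonneg _) hh_int]
    refine hWgt.trans_le (measure_mono fun ω hω ↦ ?_)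
    rw [Function.mem_support, indicator_of_mem (show W ω ∈ Ioi ℓ from hω)]
    exact (hpos _).ne'
  have hmeas_F : ∀ t : ℝ, Measurable fun ω ↦ u (max (W ω + t * X ω) ℓ) := fun t ↦
    hmeas_u.comp ((hWmeas.add (hXmeas.const_mul t)).max measurable_const)
  have hF_int : Integrable (fun ω ↦ u (max (W ω + 0 * X ω) ℓ)) P := by
    obtain ⟨M, hM⟩ := hu_bdd
    exact Integrable.of_mem_Icc (u ℓ) M (hmeas_F 0).aemeasurable
      (ae_of_all _ fun ω ↦ ⟨hu_mono.monotone (le_max_right _ _), hM (mem_range_self _)⟩)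
  have hlip : ∀ ω, LipschitzOnWith (Real.nnabs (deriv u ℓ * C))
      (fun t : ℝ ↦ u (max (W ω + t * X ω) ℓ)) univ := fun ω ↦ by
    refine LipschitzOnWith.of_dist_le_mul fun s _ t _ ↦ ?_
    have hC0 : 0 ≤ C := (abs_nonneg _).trans (hC ω)
    rw [Real.coe_nnabs, abs_of_nonneg (mul_nonneg (hpos ℓ).le hC0), Real.dist_eq, Real.dist_eq,
      mul_assoc]
    refine (hu_conc.abs_sub_le_deriv_mul hu_diff hu_mono.monotone (le_max_right _ _)
      (le_max_right _ _)).trans (mul_le_mul_of_nonneg_left ?_ (hpos ℓ).le)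
    refine (abs_max_sub_max_le_abs _ _ _).trans ?_
    rw [add_sub_add_left_eq_sub, ← sub_mul, abs_mul, mul_comm]
    exact mul_le_mul_of_nonneg_right (hC ω) (abs_nonneg _)
  have hW_ne : ∀ᵐ ω ∂P, W ω ≠ ℓ := by
    rw [ae_iff]
    simpa using hWeq
  obtain ⟨-, hderiv⟩ := hasDerivAt_integral_of_dominated_loc_of_lip
    (F' := fun ω ↦ (Ioi ℓ).indicator (deriv u) (W ω) * X ω) (bound := fun _ ↦ deriv u ℓ * C)
    (univ_mem : univ ∈ 𝓝 (0 : ℝ)) (Eventually.of_forall fun t ↦ (hmeas_F t).aestronglyMeasurable)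
    hF_int ((hh_meas.comp hWmeas).mul hXmeas).aestronglyMeasurable (ae_of_all _ hlip)
    (integrable_const _) (hW_ne.mono fun ω hω ↦ hasDerivAt_comp_max_add_mul hu_diff hω (X ω))
  have hneg : ∫ ω, (Ioi ℓ).indicator (deriv u) (W ω) * X ω ∂P < 0 := by
    have hind : IndepFun (fun ω ↦ (Ioi ℓ).indicator (deriv u) (W ω)) X P :=
      hindep.comp hh_meas measurable_id
    rw [hind.integral_fun_mul_eq_mul_integral (hh_meas.comp hWmeas).aestronglyMeasurable
      hXmeas.aestronglyMeasurable]
    exact mul_neg_of_pos_of_neg hh_integral_pos hXmean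
  obtain ⟨t₀, ht₀, hsub⟩ := mem_nhdsGT_iff_exists_Ioc_subset.1
    (hderiv.tendsto_slope_zero_right.eventually_lt_const hneg)
  refine ⟨t₀, ht₀, fun t ht htt₀ ↦ ?_⟩
  have h : t⁻¹ * ((∫ ω, u (max (W ω + (0 + t) * X ω) ℓ) ∂P) -
      ∫ ω, u (max (W ω + 0 * X ω) ℓ) ∂P) < 0 := hsub ⟨ht, htt₀⟩
  simp only [zero_add, zero_mul, add_zero] at h
  exact sub_neg.1 (neg_of_mul_neg_right h (inv_pos.2 ht).le)
end

section
/- Let X and Y be bounded real random variables whose laws are distinct. Then the following are equivalent: (i) E[X] > E[Y]; (ii) there exists s > 0 such that for every probability measure μ on ℝ having a strictly positive Lebesgue density g for which the function a ↦ log(g(a)) is Lipschitz with Lipschitz constant at most 1/s, the convolution μ * law(X) first-order stochastically dominates the convolution μ * law(Y), i.e., (μ * law(X))((-∞, a]) ≤ (μ * law(Y))((-∞, a]) for every a ∈ ℝ. -/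
open MeasureTheory ProbabilityTheory

section BoundedRandomVariable

variable {Ω : Type*} [MeasurableSpace Ω] {P : Measure Ω}

/-- A continuous function of a bounded random variable is integrable. -/
lemma integrable_continuous_comp_of_abs_le [IsFiniteMeasure P] {Z : Ω → ℝ} {C : ℝ}
    (hZ : Measurable Z) (hC : ∀ ω, |Z ω| ≤ C) {φ : ℝ → ℝ} (hφ : Continuous φ) :
    Integrable (fun ω => φ (Z ω)) P := by
  obtain ⟨B, hB⟩ := (isCompact_Icc (a := -C) (b := C)).exists_bound_of_continuousOn
    hφ.continuousOn
  exact Integrable.of_bound (hφ.measurable.comp hZ).aestronglyMeasurable B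
    (Filter.Eventually.of_forall fun ω => hB _ (abs_le.mp (hC ω)))

/-- The distribution function of `W + Z`, for `W` with law `μ` independent of `Z`. -/
lemma conv_map_Iic_eq_ofReal_integral (μ : Measure ℝ) [IsProbabilityMeasure μ]
    [IsProbabilityMeasure P] {Z : Ω → ℝ} (hZ : Measurable Z) (a : ℝ) :
    Measure.conv μ (Measure.map Z P) (Set.Iic a)
      = ENNReal.ofReal (∫ ω, μ.real (Set.Iic (a - Z ω)) ∂P) := by
  have hmono : Monotone fun x => μ.real (Set.Iic x) := fun x y hxy =>
    measureReal_mono (Set.Iic_subset_Iic.mpr hxy)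
  have hmeas : Measurable fun ω => μ.real (Set.Iic (a - Z ω)) :=
    hmono.measurable.comp (measurable_const.sub hZ)
  have hint : Integrable (fun ω => μ.real (Set.Iic (a - Z ω))) P :=
    Integrable.of_bound hmeas.aestronglyMeasurable 1 (Filter.Eventually.of_forall fun ω => by
      rw [Real.norm_of_nonneg measureReal_nonneg]; exact measureReal_le_one)
  have : IsProbabilityMeasure (Measure.map Z P) := Measure.isProbabilityMeasure_map hZ.aemeasurable
  rw [ofReal_integral_eq_lintegral_ofReal hint
    (Filter.Eventually.of_forall fun ω => measureReal_nonneg), Measure.conv,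
    Measure.map_apply measurable_add measurableSet_Iic,
    Measure.prod_apply_symm (measurable_add measurableSet_Iic), lintegral_map _ hZ]
  · refine lintegral_congr fun ω => ?_
    rw [ofReal_measureReal]
    congr 1
    ext x
    simp [le_sub_iff_add_le]
  · exact measurable_measure_prodMk_right (measurable_add measurableSet_Iic)

/-- Bounded random variables whose moment-generating functions agree near a point have the
same law. -/
lemma map_eq_map_of_mgf_eventuallyEq [IsProbabilityMeasure P] {X Y : Ω → ℝ} {C : ℝ}
    (hX : Measurable X) (hY : Measurable Y) (hXC : ∀ ω, |X ω| ≤ C) (hYC : ∀ ω, |Y ω| ≤ C)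
    {t : ℝ} (h : mgf X P =ᶠ[nhds t] mgf Y P) : Measure.map X P = Measure.map Y P := by
  have huniv : ∀ {Z : Ω → ℝ}, Measurable Z → (∀ ω, |Z ω| ≤ C) →
      integrableExpSet Z P = Set.univ := fun hZ hZC => Set.eq_univ_of_forall fun u =>
    integrable_continuous_comp_of_abs_le hZ hZC (φ := fun x => Real.exp (u * x)) (by fun_prop)
  have hXan : AnalyticOnNhd ℝ (mgf X P) Set.univ := by
    simpa [huniv hX hXC] using analyticOnNhd_mgf (X := X) (μ := P)
  have hYan : AnalyticOnNhd ℝ (mgf Y P) Set.univ := by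
    simpa [huniv hY hYC] using analyticOnNhd_mgf (X := Y) (μ := P)
  have heq : mgf X P = mgf Y P := hXan.eq_of_eventuallyEq hYan h
  refine Measure.ext_of_complexMGF_eq hX.aemeasurable hY.aemeasurable (funext fun z => ?_)
  exact eqOn_complexMGF_of_mgf heq (by simp [huniv hX hXC])

/-- Differentiation under the integral sign for `a ↦ E[G (a - Z)]` with `G` Lipschitz. -/
lemma hasDerivAt_integral_comp_sub [IsFiniteMeasure P] {Z : Ω → ℝ} {C B : ℝ}
    (hZ : Measurable Z) (hC : ∀ ω, |Z ω| ≤ C) {G F : ℝ → ℝ}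
    (hG : ∀ x, HasDerivAt G (F x) x) (hF : ∀ x, |F x| ≤ B) (a : ℝ) :
    HasDerivAt (fun b => ∫ ω, G (b - Z ω) ∂P) (∫ ω, F (a - Z ω) ∂P) a := by
  have hGc : Continuous G := continuous_iff_continuousAt.mpr fun x => (hG x).continuousAt
  have hFm : Measurable F := by
    rw [show F = deriv G from funext fun x => (hG x).deriv.symm]
    exact measurable_deriv G
  have hGm : ∀ b, Integrable (fun ω => G (b - Z ω)) P := fun b =>
    integrable_continuous_comp_of_abs_le hZ hC (φ := fun x => G (b - x)) (by fun_prop)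
  refine (hasDerivAt_integral_of_dominated_loc_of_deriv_le (F := fun b ω => G (b - Z ω))
    (F' := fun b ω => F (b - Z ω)) (bound := fun _ => B) Filter.univ_mem
    (Filter.Eventually.of_forall fun b => (hGm b).aestronglyMeasurable) (hGm a)
    (hFm.comp (measurable_const.sub hZ)).aestronglyMeasurable
    (Filter.Eventually.of_forall fun ω b _ => hF _) (integrable_const B)
    (Filter.Eventually.of_forall fun ω b _ => ?_)).2
  exact (hG (b - Z ω)).comp_sub_const b (Z ω)

end BoundedRandomVariable

section LogLipschitzDensity

lemma continuous_of_lipschitzWith_log {g : ℝ → ℝ} {K : NNReal} (hpos : ∀ a, 0 < g a)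
    (hlip : LipschitzWith K fun a => Real.log (g a)) : Continuous g := by
  have h := Real.continuous_exp.comp hlip.continuous
  refine h.congr fun a => ?_
  simp [Real.exp_log (hpos a)]

lemma integrable_of_isFiniteMeasure_withDensity_ofReal {g : ℝ → ℝ} (hg : Continuous g)
    (hpos : ∀ a, 0 < g a)
    [IsFiniteMeasure (volume.withDensity fun a => ENNReal.ofReal (g a))] : Integrable g := by
  refine ⟨hg.aestronglyMeasurable, ?_⟩
  rw [hasFiniteIntegral_iff_ofReal (Filter.Eventually.of_forall fun a => (hpos a).le)]
  have h := measure_lt_top (volume.withDensity fun a => ENNReal.ofReal (g a)) Set.univ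
  rwa [withDensity_apply _ MeasurableSet.univ, Measure.restrict_univ] at h

lemma withDensity_ofReal_real_Iic {g : ℝ → ℝ} (hg : Continuous g) (hpos : ∀ a, 0 < g a)
    (x : ℝ) : (volume.withDensity fun a => ENNReal.ofReal (g a)).real (Set.Iic x)
      = ∫ t in Set.Iic x, g t := by
  rw [measureReal_def, withDensity_apply _ measurableSet_Iic,
    integral_eq_lintegral_of_nonneg_ae (Filter.Eventually.of_forall fun a => (hpos a).le)
      hg.aestronglyMeasurable]

/-- A density whose logarithm is `K`-Lipschitz varies by a factor at most `exp (K * |t - a|)`. -/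
lemma abs_sub_le_of_lipschitzWith_log {g : ℝ → ℝ} {K : NNReal} (hpos : ∀ a, 0 < g a)
    (hlip : LipschitzWith K fun a => Real.log (g a)) {t a C : ℝ} (ht : |t - a| ≤ C) :
    |g t - g a| ≤ g a * (Real.exp (K * C) - 1) := by
  have h := hlip.dist_le_mul t a
  rw [Real.dist_eq, Real.dist_eq] at h
  have hK : |Real.log (g t) - Real.log (g a)| ≤ K * C :=
    h.trans (mul_le_mul_of_nonneg_left ht K.2)
  set u := Real.log (g t) - Real.log (g a) with hu
  have hgt : g t = g a * Real.exp u := by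
    rw [hu, Real.exp_sub, Real.exp_log (hpos t), Real.exp_log (hpos a),
      mul_div_cancel₀ _ (hpos a).ne']
  have h1 : Real.exp u ≤ Real.exp (K * C) := Real.exp_le_exp.mpr (abs_le.mp hK).2
  have h2 : Real.exp (-(K * C)) ≤ Real.exp u := Real.exp_le_exp.mpr (abs_le.mp hK).1
  have h3 : 1 - Real.exp u ≤ Real.exp (K * C) - 1 := by
    have := Real.add_one_le_exp (-(K * C : ℝ))
    have := Real.add_one_le_exp (K * C : ℝ)
    linarith
  rw [hgt, show g a * Real.exp u - g a = g a * (Real.exp u - 1) by ring, abs_mul,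
    abs_of_pos (hpos a)]
  refine mul_le_mul_of_nonneg_left (abs_le.mpr ⟨by linarith, by linarith⟩) (hpos a).le

/-- First-order expansion of the distribution function of a log-Lipschitz density. -/
lemma abs_real_Iic_sub_add_le {g : ℝ → ℝ} {K : NNReal} (hpos : ∀ a, 0 < g a)
    (hlip : LipschitzWith K fun a => Real.log (g a)) (μ : Measure ℝ) [IsProbabilityMeasure μ]
    (hμ : μ = volume.withDensity fun a => ENNReal.ofReal (g a)) {x C : ℝ} (hx : |x| ≤ C)
    (a : ℝ) :
    |μ.real (Set.Iic (a - x)) - μ.real (Set.Iic a) + x * g a|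
      ≤ C * (g a * (Real.exp (K * C) - 1)) := by
  have hg := continuous_of_lipschitzWith_log hpos hlip
  subst hμ
  have hint := integrable_of_isFiniteMeasure_withDensity_ofReal hg hpos
  rw [withDensity_ofReal_real_Iic hg hpos, withDensity_ofReal_real_Iic hg hpos,
    intervalIntegral.integral_Iic_sub_Iic hint.integrableOn hint.integrableOn]
  have hsub : (∫ t in a..(a - x), g t) + x * g a = ∫ t in a..(a - x), (g t - g a) := by
    rw [intervalIntegral.integral_sub (hg.intervalIntegrable _ _) (by simp),
      intervalIntegral.integral_const, smul_eq_mul]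
    ring
  have hb : ∀ t ∈ Set.uIoc a (a - x), ‖g t - g a‖ ≤ g a * (Real.exp (K * C) - 1) := by
    intro t ht
    refine abs_sub_le_of_lipschitzWith_log hpos hlip (le_trans ?_ hx)
    have := Set.abs_sub_left_of_mem_uIcc (Set.uIoc_subset_uIcc ht)
    simpa using this
  have hC : 0 ≤ C := (abs_nonneg x).trans hx
  have hD : 0 ≤ g a * (Real.exp (K * C) - 1) :=
    mul_nonneg (hpos a).le (sub_nonneg.mpr (Real.one_le_exp (mul_nonneg K.2 hC)))
  have hle := intervalIntegral.norm_integral_le_of_norm_le_const hb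
  rw [hsub, ← Real.norm_eq_abs]
  refine hle.trans ?_
  rw [show a - x - a = -x by ring, abs_neg, mul_comm]
  exact mul_le_mul_of_nonneg_right hx hD

end LogLipschitzDensity

section Laplace

/-- The density of the centered Laplace distribution with rate `k`. -/
noncomputable def laplaceDensity (k x : ℝ) : ℝ := k / 2 * Real.exp (-(k * |x|))

/-- The distribution function of the centered Laplace distribution with rate `k`. -/
noncomputable def laplaceCDF (k x : ℝ) : ℝ :=
  if x ≤ 0 then Real.exp (k * x) / 2 else 1 - Real.exp (-(k * x)) / 2

/-- The antiderivative of the Laplace distribution function that vanishes at `-∞`. -/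
noncomputable def laplaceIntegratedCDF (k x : ℝ) : ℝ :=
  if x ≤ 0 then Real.exp (k * x) / (2 * k) else x + Real.exp (-(k * x)) / (2 * k)

variable {k : ℝ}

lemma laplaceDensity_pos (hk : 0 < k) (x : ℝ) : 0 < laplaceDensity k x := by
  unfold laplaceDensity
  positivity

lemma lipschitzWith_log_laplaceDensity (hk : 0 < k) :
    LipschitzWith k.toNNReal fun x => Real.log (laplaceDensity k x) := by
  refine LipschitzWith.of_dist_le_mul fun x y => ?_
  have hlog : ∀ z, Real.log (laplaceDensity k z) = Real.log (k / 2) - k * |z| := fun z => by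
    rw [laplaceDensity, Real.log_mul (by positivity) (Real.exp_ne_zero _), Real.log_exp]
    ring
  rw [Real.dist_eq, Real.dist_eq, hlog, hlog, Real.coe_toNNReal k hk.le,
    show Real.log (k / 2) - k * |x| - (Real.log (k / 2) - k * |y|) = k * (|y| - |x|) by ring,
    abs_mul, abs_of_pos hk, abs_sub_comm x y]
  exact mul_le_mul_of_nonneg_left (abs_abs_sub_abs_le y x) hk.le

lemma laplaceDensity_integrableOn_Iic (hk : 0 < k) {x : ℝ} (hx : x ≤ 0) :
    IntegrableOn (laplaceDensity k) (Set.Iic x) ∧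
      ∫ t in Set.Iic x, laplaceDensity k t = Real.exp (k * x) / 2 := by
  have heq : Set.EqOn (fun t => k / 2 * Real.exp (k * t)) (laplaceDensity k) (Set.Iic x) := by
    intro t ht
    have ht' : t ≤ 0 := le_trans ht hx
    simp [laplaceDensity, abs_of_nonpos ht']
  refine ⟨IntegrableOn.congr_fun ((integrableOn_exp_mul_Iic hk x).const_mul (k / 2)) heq
    measurableSet_Iic, ?_⟩
  rw [← setIntegral_congr_fun measurableSet_Iic heq, integral_const_mul,
    integral_exp_mul_Iic hk]
  field_simp

lemma laplaceDensity_integrableOn_Ioi (hk : 0 < k) {x : ℝ} (hx : 0 ≤ x) :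
    IntegrableOn (laplaceDensity k) (Set.Ioi x) ∧
      ∫ t in Set.Ioi x, laplaceDensity k t = Real.exp (-(k * x)) / 2 := by
  have heq : Set.EqOn (fun t => k / 2 * Real.exp (-k * t)) (laplaceDensity k) (Set.Ioi x) := by
    intro t ht
    have ht' : 0 ≤ t := le_trans hx (le_of_lt ht)
    simp [laplaceDensity, abs_of_nonneg ht']
  refine ⟨IntegrableOn.congr_fun ((integrableOn_exp_mul_Ioi (neg_lt_zero.mpr hk) x).const_mul (k / 2))
    heq measurableSet_Ioi, ?_⟩
  rw [← setIntegral_congr_fun measurableSet_Ioi heq, integral_const_mul,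
    integral_exp_mul_Ioi (neg_lt_zero.mpr hk), neg_mul]
  field_simp

lemma integrable_laplaceDensity (hk : 0 < k) : Integrable (laplaceDensity k) := by
  rw [← integrableOn_univ, ← Set.Iic_union_Ioi (a := (0 : ℝ))]
  exact (laplaceDensity_integrableOn_Iic hk le_rfl).1.union
    (laplaceDensity_integrableOn_Ioi hk le_rfl).1

lemma integral_laplaceDensity (hk : 0 < k) : ∫ x, laplaceDensity k x = 1 := by
  rw [← intervalIntegral.integral_Iic_add_Ioi
    (laplaceDensity_integrableOn_Iic hk le_rfl).1 (laplaceDensity_integrableOn_Ioi hk le_rfl).1,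
    (laplaceDensity_integrableOn_Iic hk le_rfl).2, (laplaceDensity_integrableOn_Ioi hk le_rfl).2]
  norm_num

lemma isProbabilityMeasure_withDensity_laplaceDensity (hk : 0 < k) :
    IsProbabilityMeasure (volume.withDensity fun x => ENNReal.ofReal (laplaceDensity k x)) := by
  refine ⟨?_⟩
  rw [withDensity_apply _ MeasurableSet.univ, Measure.restrict_univ,
    ← ofReal_integral_eq_lintegral_ofReal (integrable_laplaceDensity hk)
      (Filter.Eventually.of_forall fun x => (laplaceDensity_pos hk x).le),
    integral_laplaceDensity hk, ENNReal.ofReal_one]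

lemma withDensity_laplaceDensity_real_Iic (hk : 0 < k) (x : ℝ) :
    (volume.withDensity fun x => ENNReal.ofReal (laplaceDensity k x)).real (Set.Iic x)
      = laplaceCDF k x := by
  rw [withDensity_ofReal_real_Iic
    (continuous_of_lipschitzWith_log (laplaceDensity_pos hk) (lipschitzWith_log_laplaceDensity hk))
    (laplaceDensity_pos hk), laplaceCDF]
  split_ifs with hx
  · exact (laplaceDensity_integrableOn_Iic hk hx).2
  · have h := intervalIntegral.integral_Iic_add_Ioi (b := x)
      (integrable_laplaceDensity hk).integrableOn (integrable_laplaceDensity hk).integrableOn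
    rw [(laplaceDensity_integrableOn_Ioi hk (not_le.mp hx).le).2, integral_laplaceDensity hk] at h
    linarith

lemma hasDerivAt_laplaceIntegratedCDF (hk : 0 < k) (x : ℝ) :
    HasDerivAt (laplaceIntegratedCDF k) (laplaceCDF k x) x := by
  have hl : ∀ y, HasDerivAt (fun z => Real.exp (k * z) / (2 * k)) (Real.exp (k * y) / 2) y := by
    intro y
    have h := (((hasDerivAt_id y).const_mul k).exp).div_const (2 * k)
    refine h.congr_deriv ?_
    simp only [id]
    field_simp
  have hr : ∀ y, HasDerivAt (fun z => z + Real.exp (-(k * z)) / (2 * k))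
      (1 - Real.exp (-(k * y)) / 2) y := by
    intro y
    have h := (hasDerivAt_id y).add (((((hasDerivAt_id y).const_mul k).neg).exp).div_const (2 * k))
    refine h.congr_deriv ?_
    simp only [id, Pi.neg_apply]
    field_simp
    ring
  rcases lt_trichotomy x 0 with hx | rfl | hx
  · rw [laplaceCDF, if_pos hx.le]
    refine (hl x).congr_of_eventuallyEq ?_
    filter_upwards [Iio_mem_nhds hx] with y hy
    rw [laplaceIntegratedCDF, if_pos (le_of_lt hy)]
  · have h1 : HasDerivWithinAt (laplaceIntegratedCDF k) (laplaceCDF k 0) (Set.Iic 0) 0 := by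
      rw [laplaceCDF, if_pos le_rfl]
      exact (hl 0).hasDerivWithinAt.congr (fun y hy => by
        rw [laplaceIntegratedCDF, if_pos (Set.mem_Iic.mp hy)])
        (by rw [laplaceIntegratedCDF, if_pos le_rfl])
    have h2 : HasDerivWithinAt (laplaceIntegratedCDF k) (laplaceCDF k 0) (Set.Ioi 0) 0 := by
      have h3 := (hr 0).hasDerivWithinAt (s := Set.Ioi 0)
      have h4 : laplaceCDF k 0 = 1 - Real.exp (-(k * 0)) / 2 := by
        simp [laplaceCDF]; norm_num
      rw [h4]
      exact h3.congr (fun y hy => by rw [laplaceIntegratedCDF, if_neg (not_le.mpr hy)])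
        (by simp [laplaceIntegratedCDF])
    have h := h1.union h2
    rwa [Set.Iic_union_Ioi, hasDerivWithinAt_univ] at h
  · rw [laplaceCDF, if_neg (not_le.mpr hx)]
    refine (hr x).congr_of_eventuallyEq ?_
    filter_upwards [Ioi_mem_nhds hx] with y hy
    rw [laplaceIntegratedCDF, if_neg (not_le.mpr hy)]

lemma abs_laplaceCDF_le_one (hk : 0 < k) (x : ℝ) : |laplaceCDF k x| ≤ 1 := by
  have := isProbabilityMeasure_withDensity_laplaceDensity hk
  rw [← withDensity_laplaceDensity_real_Iic hk, abs_of_nonneg measureReal_nonneg]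
  exact measureReal_le_one

end Laplace

section Comparison

variable {Ω : Type*} [MeasurableSpace Ω] {P : Measure Ω} {Z : Ω → ℝ} {C k a : ℝ}

lemma integral_laplaceIntegratedCDF_of_le (hC : ∀ ω, |Z ω| ≤ C) (ha : a ≤ -C) :
    ∫ ω, laplaceIntegratedCDF k (a - Z ω) ∂P = Real.exp (k * a) / (2 * k) * mgf Z P (-k) := by
  rw [mgf, ← integral_const_mul]
  refine integral_congr_ae (Filter.Eventually.of_forall fun ω => ?_)
  have := (abs_le.mp (hC ω)).1
  simp only [laplaceIntegratedCDF]
  rw [if_pos (by linarith), mul_sub, sub_eq_add_neg, Real.exp_add, neg_mul]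
  ring

lemma integral_laplaceIntegratedCDF_of_lt [IsProbabilityMeasure P] (hZ : Measurable Z)
    (hC : ∀ ω, |Z ω| ≤ C) (ha : C < a) :
    ∫ ω, laplaceIntegratedCDF k (a - Z ω) ∂P
      = a - ∫ ω, Z ω ∂P + Real.exp (-(k * a)) / (2 * k) * mgf Z P k := by
  have hZi : Integrable Z P := integrable_continuous_comp_of_abs_le hZ hC continuous_id
  have hei : Integrable (fun ω => Real.exp (k * Z ω)) P :=
    integrable_continuous_comp_of_abs_le hZ hC (φ := fun x => Real.exp (k * x)) (by fun_prop)
  have h : ∀ ω, laplaceIntegratedCDF k (a - Z ω)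
      = (a - Z ω) + Real.exp (-(k * a)) / (2 * k) * Real.exp (k * Z ω) := fun ω => by
    have := (abs_le.mp (hC ω)).2
    rw [laplaceIntegratedCDF, if_neg (by linarith),
      show -(k * (a - Z ω)) = -(k * a) + k * Z ω by ring, Real.exp_add]
    ring
  have hsub : Integrable (fun ω => a - Z ω) P := (integrable_const a).sub hZi
  simp_rw [h]
  rw [integral_add hsub (hei.const_mul _),
    integral_sub (integrable_const a) hZi, integral_const_mul, mgf]
  simp

/-- If the gamble `X` dominates `Y` under a Laplace background risk, then its mean is at least
as large, and in case of equality the moment-generating functions agree at `-k`. -/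
lemma integral_le_and_mgf_eq_of_laplaceCDF_le [IsProbabilityMeasure P] {X Y : Ω → ℝ}
    (hX : Measurable X) (hY : Measurable Y) (hXC : ∀ ω, |X ω| ≤ C) (hYC : ∀ ω, |Y ω| ≤ C)
    (hk : 0 < k)
    (hdom : ∀ a, ∫ ω, laplaceCDF k (a - X ω) ∂P ≤ ∫ ω, laplaceCDF k (a - Y ω) ∂P) :
    ∫ ω, Y ω ∂P ≤ ∫ ω, X ω ∂P ∧
      (∫ ω, Y ω ∂P = ∫ ω, X ω ∂P → mgf X P (-k) = mgf Y P (-k)) := by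
  set H : ℝ → ℝ := fun a => ∫ ω, laplaceIntegratedCDF k (a - Y ω) ∂P
    - ∫ ω, laplaceIntegratedCDF k (a - X ω) ∂P with hH
  have hderiv : ∀ a, HasDerivAt H
      (∫ ω, laplaceCDF k (a - Y ω) ∂P - ∫ ω, laplaceCDF k (a - X ω) ∂P) a := fun a =>
    (hasDerivAt_integral_comp_sub hY hYC (hasDerivAt_laplaceIntegratedCDF hk)
      (abs_laplaceCDF_le_one hk) a).sub
    (hasDerivAt_integral_comp_sub hX hXC (hasDerivAt_laplaceIntegratedCDF hk)
      (abs_laplaceCDF_le_one hk) a)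
  have hmono : Monotone H := monotone_of_deriv_nonneg (fun a => (hderiv a).differentiableAt)
    fun a => by rw [(hderiv a).deriv]; exact sub_nonneg.mpr (hdom a)
  have hleft : ∀ a ≤ -C, H a = Real.exp (k * a) / (2 * k) * (mgf Y P (-k) - mgf X P (-k)) := by
    intro a ha
    simp only [hH]
    rw [integral_laplaceIntegratedCDF_of_le hYC ha, integral_laplaceIntegratedCDF_of_le hXC ha]
    ring
  have hright : ∀ a, C < a → H a = ∫ ω, X ω ∂P - ∫ ω, Y ω ∂P
      + Real.exp (-(k * a)) / (2 * k) * (mgf Y P k - mgf X P k) := by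
    intro a ha
    simp only [hH]
    rw [integral_laplaceIntegratedCDF_of_lt hY hYC ha,
      integral_laplaceIntegratedCDF_of_lt hX hXC ha]
    ring
  have hbot : Filter.Tendsto H Filter.atBot (nhds 0) := by
    have h := ((Real.tendsto_exp_atBot.comp (Filter.tendsto_id.const_mul_atBot hk)).div_const
      (2 * k)).mul_const (mgf Y P (-k) - mgf X P (-k))
    rw [zero_div, zero_mul] at h
    refine h.congr' ?_
    filter_upwards [Filter.eventually_le_atBot (-C)] with a ha
    rw [hleft a ha]
    rfl
  have htop : Filter.Tendsto H Filter.atTop (nhds (∫ ω, X ω ∂P - ∫ ω, Y ω ∂P)) := by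
    have h := (((Real.tendsto_exp_neg_atTop_nhds_zero.comp
      (Filter.tendsto_id.const_mul_atTop hk)).div_const (2 * k)).mul_const
      (mgf Y P k - mgf X P k)).const_add (∫ ω, X ω ∂P - ∫ ω, Y ω ∂P)
    rw [zero_div, zero_mul, add_zero] at h
    refine h.congr' ?_
    filter_upwards [Filter.eventually_gt_atTop C] with a ha
    rw [hright a ha]
    rfl
  have h0 : ∀ a, 0 ≤ H a := hmono.le_of_tendsto hbot
  have h1 : ∀ a, H a ≤ ∫ ω, X ω ∂P - ∫ ω, Y ω ∂P := hmono.ge_of_tendsto htop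
  refine ⟨sub_nonneg.mp ((h0 0).trans (h1 0)), fun heq => ?_⟩
  have hz : H (-C) = 0 := le_antisymm ((h1 _).trans (by rw [heq, sub_self])) (h0 _)
  rw [hleft _ le_rfl] at hz
  rcases mul_eq_zero.mp hz with h | h
  · exact absurd h (by positivity)
  · linarith

/-- A log-Lipschitz background risk with a small enough Lipschitz constant makes the gamble with
the higher mean dominant. -/
lemma integral_real_Iic_sub_le [IsProbabilityMeasure P] {X Y : Ω → ℝ}
    (hX : Measurable X) (hY : Measurable Y) (hXC : ∀ ω, |X ω| ≤ C) (hYC : ∀ ω, |Y ω| ≤ C)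
    {g : ℝ → ℝ} {K : NNReal} (hpos : ∀ a, 0 < g a)
    (hlip : LipschitzWith K fun a => Real.log (g a)) (μ : Measure ℝ) [IsProbabilityMeasure μ]
    (hμ : μ = volume.withDensity fun a => ENNReal.ofReal (g a))
    (hK : 2 * C * (Real.exp (K * C) - 1) ≤ ∫ ω, X ω ∂P - ∫ ω, Y ω ∂P) (a : ℝ) :
    ∫ ω, μ.real (Set.Iic (a - X ω)) ∂P ≤ ∫ ω, μ.real (Set.Iic (a - Y ω)) ∂P := by
  have hmono : Monotone fun x => μ.real (Set.Iic x) := fun x y hxy =>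
    measureReal_mono (Set.Iic_subset_Iic.mpr hxy)
  have hint : ∀ {Z : Ω → ℝ}, Measurable Z →
      Integrable (fun ω => μ.real (Set.Iic (a - Z ω))) P := fun hZ =>
    Integrable.of_bound (hmono.measurable.comp (measurable_const.sub hZ)).aestronglyMeasurable 1
      (Filter.Eventually.of_forall fun ω => by
        rw [Real.norm_of_nonneg measureReal_nonneg]; exact measureReal_le_one)
  have hXi : Integrable X P := integrable_continuous_comp_of_abs_le hX hXC continuous_id
  have hYi : Integrable Y P := integrable_continuous_comp_of_abs_le hY hYC continuous_id
  set E := g a * (Real.exp (K * C) - 1) with hE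
  have hYsum : Integrable (fun ω => μ.real (Set.Iic (a - Y ω)) + g a * Y ω) P :=
    (hint hY).add (hYi.const_mul _)
  have hle : ∫ ω, (μ.real (Set.Iic (a - X ω)) + g a * X ω) ∂P
      ≤ ∫ ω, (μ.real (Set.Iic (a - Y ω)) + g a * Y ω + 2 * (C * E)) ∂P := by
    refine integral_mono ((hint hX).add (hXi.const_mul _))
      (hYsum.add (integrable_const _)) fun ω => ?_
    have h1 := (abs_le.mp (abs_real_Iic_sub_add_le hpos hlip μ hμ (hXC ω) a)).2
    have h2 := (abs_le.mp (abs_real_Iic_sub_add_le hpos hlip μ hμ (hYC ω) a)).1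
    simp only
    linarith
  rw [integral_add (hint hX) (hXi.const_mul _), integral_add hYsum (integrable_const _),
    integral_add (hint hY) (hYi.const_mul _), integral_const_mul, integral_const_mul,
    integral_const, probReal_univ, one_smul] at hle
  have h := mul_le_mul_of_nonneg_left hK (hpos a).le
  rw [hE] at hle
  linarith

end Comparison

/-- **Theorem 3 (choice between two gambles, two-sided heavy tails).** For bounded gambles
`X` and `Y` with distinct laws, `E[X] > E[Y]` holds if and only if there exists `s > 0`
such that under every background risk with a strictly positive Lebesgue density `g` whose
logarithm is Lipschitz with constant at most `1/s` (two-sided exponential size at least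
`s`), choosing `X` over `Y` is dominant: the law of `W + X` first-order stochastically
dominates the law of `W + Y`. -/
theorem mean_gt_iff_dominant_under_two_sided_heavy_tails
    {Ω : Type*} [MeasurableSpace Ω] (P : Measure Ω) [IsProbabilityMeasure P]
    (X Y : Ω → ℝ) (hXmeas : Measurable X) (hYmeas : Measurable Y)
    (hXbdd : ∃ C : ℝ, ∀ ω, |X ω| ≤ C) (hYbdd : ∃ C : ℝ, ∀ ω, |Y ω| ≤ C)
    (hdistinct : Measure.map X P ≠ Measure.map Y P) :
    (∫ ω, Y ω ∂P < ∫ ω, X ω ∂P) ↔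
      ∃ s : ℝ, 0 < s ∧
        ∀ μ : Measure ℝ, IsProbabilityMeasure μ →
          ∀ g : ℝ → ℝ, (∀ a, 0 < g a) →
            μ = volume.withDensity (fun a => ENNReal.ofReal (g a)) →
            LipschitzWith (Real.toNNReal (1 / s)) (fun a => Real.log (g a)) →
            ∀ a : ℝ, (Measure.conv μ (Measure.map X P)) (Set.Iic a)
              ≤ (Measure.conv μ (Measure.map Y P)) (Set.Iic a) := by
  obtain ⟨C₁, hC₁⟩ := hXbdd
  obtain ⟨C₂, hC₂⟩ := hYbdd
  obtain ⟨C, hC, hXC, hYC⟩ : ∃ C : ℝ, 0 < C ∧ (∀ ω, |X ω| ≤ C) ∧ ∀ ω, |Y ω| ≤ C :=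
    ⟨max 1 (max C₁ C₂), by positivity, fun ω => (hC₁ ω).trans (by simp),
      fun ω => (hC₂ ω).trans (by simp)⟩
  constructor
  · intro hlt
    set d := ∫ ω, X ω ∂P - ∫ ω, Y ω ∂P with hd
    have hdpos : 0 < d := sub_pos.mpr hlt
    have hlog : 0 < Real.log (1 + d / (2 * C)) :=
      Real.log_pos (by linarith [div_pos hdpos (mul_pos two_pos hC)])
    refine ⟨C / Real.log (1 + d / (2 * C)), by positivity, ?_⟩
    intro μ hμp g hpos hμ hlip a
    rw [conv_map_Iic_eq_ofReal_integral μ hXmeas, conv_map_Iic_eq_ofReal_integral μ hYmeas]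
    refine ENNReal.ofReal_le_ofReal
      (integral_real_Iic_sub_le hXmeas hYmeas hXC hYC hpos hlip μ hμ ?_ a)
    rw [Real.coe_toNNReal _ (by positivity), one_div_div, div_mul_cancel₀ _ hC.ne',
      Real.exp_log (by positivity)]
    refine le_of_eq ?_
    rw [← hd]
    field_simp
    ring
  · rintro ⟨s, hs, hdom⟩
    have key : ∀ k : ℝ, 0 < k → k ≤ 1 / s → ∫ ω, Y ω ∂P ≤ ∫ ω, X ω ∂P ∧
        (∫ ω, Y ω ∂P = ∫ ω, X ω ∂P → mgf X P (-k) = mgf Y P (-k)) := by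
      intro k hk hks
      have := isProbabilityMeasure_withDensity_laplaceDensity hk
      refine integral_le_and_mgf_eq_of_laplaceCDF_le hXmeas hYmeas hXC hYC hk fun a => ?_
      have h := hdom _ this (laplaceDensity k) (laplaceDensity_pos hk) rfl
        ((lipschitzWith_log_laplaceDensity hk).weaken (Real.toNNReal_le_toNNReal hks)) a
      rw [conv_map_Iic_eq_ofReal_integral _ hXmeas, conv_map_Iic_eq_ofReal_integral _ hYmeas,
        ENNReal.ofReal_le_ofReal_iff (integral_nonneg fun ω => measureReal_nonneg)] at h
      simpa only [withDensity_laplaceDensity_real_Iic hk] using h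
    have hs' : 0 < 1 / s := one_div_pos.mpr hs
    refine lt_of_le_of_ne (key _ hs' le_rfl).1 fun heq => hdistinct ?_
    refine map_eq_map_of_mgf_eventuallyEq hXmeas hYmeas hXC hYC (t := -(1 / s / 2)) ?_
    filter_upwards [Ioo_mem_nhds (show -(1 / s) < -(1 / s / 2) by linarith)
      (show -(1 / s / 2) < 0 by linarith)] with t ht
    have h := (key (-t) (by linarith [ht.2]) (by linarith [ht.1])).2 heq
    rwa [neg_neg] at h
end

section
/- Let X and Y be bounded real random variables with cumulative distribution functions F_X and F_Y, and suppose the essential supremum of X differs from the essential supremum of Y. Then the following are equivalent: (i) esssup X > esssup Y and ∫_{a}^{∞} (F_Y(z) - F_X(z)) dz > 0 for every a < esssup X; (ii) there exists s > 0 such that for every probability measure μ on ℝ having a strictly positive Lebesgue density g for which the function a ↦ g(a)·exp(-a/s) is antitone (non-increasing), the convolution μ * law(X) first-order stochastically dominates the convolution μ * law(Y), i.e., (μ * law(X))((-∞, a]) ≤ (μ * law(Y))((-∞, a]) for every a ∈ ℝ. -/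
open MeasureTheory ProbabilityTheory

/-- Two measures on `ℝ` comparable on open right half-lines are comparable on upper sets. -/
lemma measure_le_of_isUpperSet {m₁ m₂ : Measure ℝ} [NullSingletonClass m₁] [NullSingletonClass m₂]
    (h : ∀ a, m₁ (Set.Ioi a) ≤ m₂ (Set.Ioi a)) {U : Set ℝ} (hU : IsUpperSet U) :
    m₁ U ≤ m₂ U := by
  have hIci : ∀ a, m₁ (Set.Ici a) ≤ m₂ (Set.Ici a) := fun a => by
    rw [← measure_congr (Ioi_ae_eq_Ici (μ := m₁) (a := a)),
      ← measure_congr (Ioi_ae_eq_Ici (μ := m₂) (a := a))]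
    exact h a
  rcases U.eq_empty_or_nonempty with rfl | hne
  · simp
  by_cases hb : BddBelow U
  · have h1 : Set.Ioi (sInf U) ⊆ U := fun x hx => by
      obtain ⟨y, hy, hyx⟩ := exists_lt_of_csInf_lt hne hx
      exact hU hyx.le hy
    have h2 : U ⊆ Set.Ici (sInf U) := fun x hx => csInf_le hb hx
    calc m₁ U ≤ m₁ (Set.Ici (sInf U)) := measure_mono h2
      _ = m₁ (Set.Ioi (sInf U)) := (measure_congr Ioi_ae_eq_Ici).symm
      _ ≤ m₂ (Set.Ioi (sInf U)) := h _
      _ ≤ m₂ U := measure_mono h1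
  · have huniv : U = Set.univ := Set.eq_univ_of_forall fun x => by
      obtain ⟨y, hy, hyx⟩ := not_bddBelow_iff.1 hb x
      exact hU hyx.le hy
    rw [huniv]
    exact le_of_tendsto_of_tendsto' (tendsto_measure_Ici_atBot m₁)
      (tendsto_measure_Ici_atBot m₂) hIci

/-- If all right tails of `w` have nonnegative integral, so does the product of `w` with any
nonnegative monotone weight. -/
lemma integral_monotone_mul_nonneg {w φ : ℝ → ℝ} (hw : Integrable w)
    (htail : ∀ a, 0 ≤ ∫ z in Set.Ioi a, w z) (hφ : Monotone φ) (hφ0 : ∀ z, 0 ≤ φ z)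
    (hi : Integrable fun z => φ z * w z) : 0 ≤ ∫ z, φ z * w z := by
  have layer : ∀ v : ℝ → ℝ, Integrable v →
      ∫⁻ z, ENNReal.ofReal (φ z * v z) = ∫⁻ t in Set.Ioi (0 : ℝ),
        (volume.withDensity fun z => ENNReal.ofReal (v z)) {z | t < φ z} := fun v hv => by
    rw [← lintegral_eq_lintegral_meas_lt _ (ae_of_all _ hφ0) hφ.measurable.aemeasurable,
      lintegral_withDensity_eq_lintegral_mul₀ hv.1.aemeasurable.ennreal_ofReal
        hφ.measurable.ennreal_ofReal.aemeasurable]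
    refine lintegral_congr fun z => ?_
    rw [ENNReal.ofReal_mul (hφ0 z), Pi.mul_apply, mul_comm]
  have half : ∀ a, (volume.withDensity fun z => ENNReal.ofReal (-w z)) (Set.Ioi a) ≤
      (volume.withDensity fun z => ENNReal.ofReal (w z)) (Set.Ioi a) := fun a => by
    rw [withDensity_apply _ measurableSet_Ioi, withDensity_apply _ measurableSet_Ioi]
    have h := htail a
    rw [integral_eq_lintegral_pos_part_sub_lintegral_neg_part hw.integrableOn, sub_nonneg] at h
    exact (ENNReal.toReal_le_toReal hw.neg.integrableOn.lintegral_lt_top.ne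
      hw.integrableOn.lintegral_lt_top.ne).1 h
  rw [integral_eq_lintegral_pos_part_sub_lintegral_neg_part hi, sub_nonneg]
  refine ENNReal.toReal_mono hi.lintegral_lt_top.ne ?_
  simp_rw [← mul_neg]
  rw [layer w hw, layer (fun z => -w z) hw.neg]
  exact lintegral_mono fun t => measure_le_of_isUpperSet half
    fun x y hxy hx => lt_of_lt_of_le hx (hφ hxy)

/-- The distribution function of the convolution with an absolutely continuous measure. -/
lemma conv_withDensity_Iic {g : ℝ → ℝ} (hg : Measurable g) (hg0 : ∀ b, 0 ≤ g b)
    (hgi : Integrable g) (ν : Measure ℝ) [IsProbabilityMeasure ν] (a : ℝ) :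
    Integrable (fun z => g (a - z) * ν.real (Set.Iic z)) ∧
    ((volume.withDensity fun b => ENNReal.ofReal (g b)) ∗ ν) (Set.Iic a) =
      ENNReal.ofReal (∫ z, g (a - z) * ν.real (Set.Iic z)) := by
  have hmono : Monotone fun z => ν.real (Set.Iic z) := fun x y hxy =>
    measureReal_mono (Set.Iic_subset_Iic.2 hxy)
  have hint : Integrable fun z => g (a - z) * ν.real (Set.Iic z) :=
    (hgi.comp_sub_left a).mul_bdd (c := 1) hmono.measurable.aestronglyMeasurable
      (ae_of_all _ fun z => by simp [abs_of_nonneg measureReal_nonneg, measureReal_le_one])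
  have hmono' : Monotone fun z => ν (Set.Iic z) := fun x y hxy =>
    measure_mono (Set.Iic_subset_Iic.2 hxy)
  refine ⟨hint, ?_⟩
  rw [ofReal_integral_eq_lintegral_ofReal hint
      (ae_of_all _ fun z => mul_nonneg (hg0 _) measureReal_nonneg),
    ← lintegral_sub_left_eq_self _ a,
    ← lintegral_indicator_one measurableSet_Iic,
    Measure.lintegral_conv (measurable_one.indicator measurableSet_Iic)]
  have inner : ∀ x, ∫⁻ y, (Set.Iic a).indicator 1 (x + y) ∂ν = ν (Set.Iic (a - x)) := fun x => by
    rw [← lintegral_indicator_one measurableSet_Iic]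
    refine lintegral_congr fun y => ?_
    simp only [Set.indicator_apply, Set.mem_Iic, le_sub_iff_add_le', Pi.one_apply]
  simp_rw [inner]
  have hmeas : Measurable fun x => ν (Set.Iic (a - x)) :=
    hmono'.measurable.comp (measurable_const.sub measurable_id)
  rw [lintegral_withDensity_eq_lintegral_mul _ hg.ennreal_ofReal hmeas]
  refine lintegral_congr fun x => ?_
  rw [sub_sub_cancel, ENNReal.ofReal_mul (hg0 _), ofReal_measureReal, Pi.mul_apply]

/-- Under an absolutely continuous background risk, first-order dominance at `a` amounts to
nonnegativity of the integral of the difference of distribution functions against the density. -/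
lemma conv_withDensity_Iic_le_iff {g : ℝ → ℝ} (hg : Measurable g) (hg0 : ∀ b, 0 ≤ g b)
    (hgi : Integrable g) (ν₁ ν₂ : Measure ℝ) [IsProbabilityMeasure ν₁] [IsProbabilityMeasure ν₂]
    (a : ℝ) :
    ((volume.withDensity fun b => ENNReal.ofReal (g b)) ∗ ν₁) (Set.Iic a) ≤
        ((volume.withDensity fun b => ENNReal.ofReal (g b)) ∗ ν₂) (Set.Iic a) ↔
      0 ≤ ∫ z, g (a - z) * (ν₂.real (Set.Iic z) - ν₁.real (Set.Iic z)) := by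
  obtain ⟨i₁, e₁⟩ := conv_withDensity_Iic hg hg0 hgi ν₁ a
  obtain ⟨i₂, e₂⟩ := conv_withDensity_Iic hg hg0 hgi ν₂ a
  rw [e₁, e₂, ENNReal.ofReal_le_ofReal_iff
    (integral_nonneg fun z => mul_nonneg (hg0 _) measureReal_nonneg)]
  simp_rw [mul_sub]
  rw [integral_sub i₂ i₁, sub_nonneg]

/-- A nonnegative integrable function that is positive on a subinterval of `(a, ∞)` has positive
integral over `(a, ∞)`. -/
lemma setIntegral_Ioi_pos {f : ℝ → ℝ} {a b c : ℝ} (hf : IntegrableOn f (Set.Ioi a))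
    (h0 : ∀ z, a < z → 0 ≤ f z) (hab : a ≤ b) (hbc : b < c)
    (hpos : ∀ z, b < z → z < c → 0 < f z) : 0 < ∫ z in Set.Ioi a, f z := by
  rw [setIntegral_pos_iff_support_of_nonneg_ae
    ((ae_restrict_iff' measurableSet_Ioi).2 (ae_of_all _ h0)) hf]
  refine lt_of_lt_of_le (b := volume (Set.Ioo b c)) (by simpa using hbc) (measure_mono ?_)
  exact fun z hz => ⟨(hpos z hz.1 hz.2).ne', hab.trans_lt hz.1⟩

/-- A continuous function times a bounded function of bounded support is integrable. -/
lemma Continuous.integrable_mul_of_bounded_support {h D : ℝ → ℝ} {B C : ℝ} (hh : Continuous h)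
    (hD : Measurable D) (hB : ∀ z, |D z| ≤ B) (hC : ∀ z, C < |z| → D z = 0) :
    Integrable fun z => h z * D z := by
  rw [← integrableOn_iff_integrable_of_support_subset (s := Set.Icc (-C) C)]
  · exact (hh.integrableOn_Icc).mul_bdd (c := B) hD.aestronglyMeasurable
      (ae_of_all _ fun z => by simpa using hB z)
  · intro z hz
    by_contra hcon
    refine hz ?_
    have : C < |z| := by
      rw [Set.mem_Icc, ← abs_le] at hcon
      exact not_le.1 hcon
    simp [hC z this]

/-- If `D` has bounded support and is nonnegative beyond a point before which its tail integrals
are positive, its tail integrals remain nonnegative under a slowly decaying exponential weight. -/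
lemma exists_exp_tail_nonneg {D : ℝ → ℝ} {C m M : ℝ} (hD : Measurable D) (hB : ∀ z, |D z| ≤ 1)
    (hC : ∀ z, C < |z| → D z = 0) (hmM : m < M) (hm : ∀ z, m ≤ z → 0 ≤ D z)
    (htail : ∀ a, a < M → 0 < ∫ z in Set.Ioi a, D z) :
    ∃ s : ℝ, 0 < s ∧ ∀ a, 0 ≤ ∫ z in Set.Ioi a, Real.exp (-z / s) * D z := by
  obtain ⟨K, hCK, hK1, hmK⟩ : ∃ K : ℝ, C < K ∧ 1 ≤ K ∧ |m| ≤ K :=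
    ⟨max (C + 1) (max 1 |m|), by simp, by simp, by simp⟩
  have hK : ∀ z, K < |z| → D z = 0 := fun z hz => hC z (hCK.trans hz)
  have hK' : ∀ z, z ∉ Set.Icc (-K) K → D z = 0 := fun z hz =>
    hK z (by rwa [Set.mem_Icc, ← abs_le, not_le] at hz)
  have hDi : Integrable D := by
    have h : Integrable fun z => (1 : ℝ) * D z :=
      continuous_const.integrable_mul_of_bounded_support hD hB hK
    simpa only [one_mul] using h
  obtain ⟨δ, hδ, hδle⟩ : ∃ δ : ℝ, 0 < δ ∧ ∀ a, a ≤ m → δ ≤ ∫ z in Set.Ioi a, D z := by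
    have hcont : Continuous fun a => ∫ z in Set.Ioi a, D z := by
      have : (fun a => ∫ z in Set.Ioi a, D z) =
          fun a => (∫ z in Set.Ioi 0, D z) - ∫ z in (0 : ℝ)..a, D z := by
        funext a
        rw [eq_sub_iff_add_eq']
        exact intervalIntegral.integral_interval_add_Ioi hDi.integrableOn hDi.integrableOn
      rw [this]
      exact continuous_const.sub (hDi.continuous_primitive 0)
    obtain ⟨a₀, ha₀, hmin⟩ := (isCompact_Icc (a := -K) (b := m)).exists_isMinOn
      ⟨m, (abs_le.1 hmK).1, le_rfl⟩ hcont.continuousOn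
    refine ⟨_, htail a₀ (ha₀.2.trans_lt hmM), fun a ha => ?_⟩
    by_cases haK : -K ≤ a
    · exact hmin ⟨haK, ha⟩
    · push Not at haK
      rw [setIntegral_eq_of_subset_of_forall_sdiff_eq_zero measurableSet_Ioi
        (Set.Ioi_subset_Ioi haK.le)]
      · exact hmin ⟨le_rfl, (abs_le.1 hmK).1⟩
      · intro z hz
        have : z ≤ -K := not_lt.1 hz.2
        exact hC z (by linarith [neg_le_abs z])
  have hKpos : 0 < K := by linarith
  have hs : 0 < max K (4 * K ^ 2 / δ) := lt_max_of_lt_left hKpos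
  refine ⟨max K (4 * K ^ 2 / δ), hs, fun a => ?_⟩
  set s := max K (4 * K ^ 2 / δ)
  have hEi : Integrable fun z => Real.exp (-z / s) * D z :=
    Continuous.integrable_mul_of_bounded_support (by fun_prop) hD hB hK
  rcases le_total a m with ham | ham
  · have hdiff : |∫ z in Set.Ioi a, (Real.exp (-z / s) * D z - D z)| ≤ δ := by
      rw [← integral_indicator measurableSet_Ioi,
        ← setIntegral_eq_integral_of_forall_compl_eq_zero (s := Set.Icc (-K) K),
        ← Real.norm_eq_abs]
      · refine le_trans (norm_setIntegral_le_of_norm_le_const (C := 2 * (K / s)) measure_Icc_lt_top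
          fun z hz => ?_) ?_
        · have hz' : |-z / s| ≤ K / s := by
            rw [abs_div, abs_neg, abs_of_pos hs]
            exact div_le_div_of_nonneg_right (abs_le.2 hz) hs.le
          have h1 : K / s ≤ 1 := (div_le_one hs).2 (le_max_left _ _)
          refine (norm_indicator_le_norm_self _ _).trans ?_
          rw [← sub_one_mul, norm_mul, Real.norm_eq_abs, Real.norm_eq_abs]
          have := Real.abs_exp_sub_one_le (hz'.trans h1)
          nlinarith [hB z, abs_nonneg (D z), abs_nonneg (Real.exp (-z / s) - 1)]
        · rw [Real.volume_real_Icc_of_le (by linarith)]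
          have : 4 * K ^ 2 ≤ δ * s := by
            rw [← div_le_iff₀' hδ]
            exact le_max_right _ _
          rw [← mul_div_assoc, div_mul_eq_mul_div, div_le_iff₀ hs]
          linarith
      · intro z hz
        simp [Set.indicator_apply, hK' z hz]
    rw [integral_sub hEi.integrableOn hDi.integrableOn] at hdiff
    linarith [(abs_le.1 hdiff).1, hδle a ham]
  · exact setIntegral_nonneg measurableSet_Ioi fun z hz =>
      mul_nonneg (Real.exp_pos _).le (hm z (ham.trans (le_of_lt hz)))

/-- Nonnegative exponentially weighted tails together with positivity near the upper end point
force the unweighted tails to be positive. -/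
lemma tail_pos_of_exp_tail_nonneg {D : ℝ → ℝ} {C s m M a : ℝ} (hD : Measurable D)
    (hB : ∀ z, |D z| ≤ 1) (hC : ∀ z, C < |z| → D z = 0) (hs : 0 < s)
    (hexp : ∀ a, 0 ≤ ∫ z in Set.Ioi a, Real.exp (-z / s) * D z) (hmM : m < M)
    (hm : ∀ z, m ≤ z → 0 ≤ D z) (hmpos : ∀ z, m ≤ z → z < M → 0 < D z) (ha : a < M) :
    0 < ∫ z in Set.Ioi a, D z := by
  set b := max a m
  have hbM : b < M := max_lt ha hmM
  have hmono : Monotone fun z : ℝ => Real.exp (z / s) := fun x y hxy =>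
    Real.exp_le_exp.2 (div_le_div_of_nonneg_right hxy hs.le)
  set φ : ℝ → ℝ := fun z => if a < z then min (Real.exp (z / s)) (Real.exp (b / s)) else 0
  set ψ : ℝ → ℝ := fun z => max (Real.exp (z / s) - Real.exp (b / s)) 0
  have hφ0 : ∀ z, 0 ≤ φ z := fun z => by
    simp only [φ]
    split_ifs <;> positivity
  have hφ : Monotone φ := fun x y hxy => by
    by_cases hx : a < x
    · simp only [φ, hx, hx.trans_le hxy, if_true]
      exact min_le_min_right _ (hmono hxy)
    · simpa only [φ, hx, if_false] using hφ0 y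
  have hEi : Integrable fun z => Real.exp (-z / s) * D z :=
    Continuous.integrable_mul_of_bounded_support (by fun_prop) hD hB hC
  have hφi : Integrable fun z => φ z * (Real.exp (-z / s) * D z) :=
    hEi.bdd_mul (c := Real.exp (b / s)) hφ.measurable.aestronglyMeasurable
      (ae_of_all _ fun z => by
        rw [Real.norm_eq_abs, abs_of_nonneg (hφ0 z)]
        simp only [φ]
        split_ifs
        · exact min_le_right _ _
        · positivity)
  have hψi : Integrable fun z => ψ z * (Real.exp (-z / s) * D z) := by
    simp_rw [← mul_assoc]
    exact Continuous.integrable_mul_of_bounded_support (by fun_prop) hD hB hC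
  have hψb : ∀ z, z ≤ b → ψ z = 0 := fun z hz => max_eq_right (sub_nonpos.2 (hmono hz))
  have hsplit : ∫ z in Set.Ioi a, D z = (∫ z, φ z * (Real.exp (-z / s) * D z)) +
      ∫ z in Set.Ioi b, ψ z * (Real.exp (-z / s) * D z) := by
    rw [setIntegral_eq_integral_of_forall_compl_eq_zero (s := Set.Ioi b)
      (fun z hz => by rw [hψb z (not_lt.1 hz), zero_mul]),
      ← integral_add hφi hψi, ← integral_indicator measurableSet_Ioi]
    congr 1
    funext z
    rw [← add_mul]
    by_cases hz : a < z
    · have : φ z + ψ z = Real.exp (z / s) := by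
        simp only [φ, ψ, hz, if_true]
        rcases le_total (Real.exp (z / s)) (Real.exp (b / s)) with h | h
        · rw [min_eq_left h, max_eq_right (sub_nonpos.2 h), add_zero]
        · rw [min_eq_right h, max_eq_left (sub_nonneg.2 h), add_sub_cancel]
      rw [this, ← mul_assoc, ← Real.exp_add, neg_div, add_neg_cancel, Real.exp_zero, one_mul,
        Set.indicator_of_mem (Set.mem_Ioi.2 hz)]
    · rw [hψb z ((not_lt.1 hz).trans (le_max_left _ _)),
        Set.indicator_of_notMem (Set.notMem_Ioi.2 (not_lt.1 hz))]
      simp [φ, hz]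
  rw [hsplit]
  refine add_pos_of_nonneg_of_pos (integral_monotone_mul_nonneg hEi hexp hφ hφ0 hφi)
    (setIntegral_Ioi_pos hψi.integrableOn (fun z hz => ?_) le_rfl hbM fun z hz hzM => ?_)
  · exact mul_nonneg (le_max_right _ _)
      (mul_nonneg (Real.exp_pos _).le (hm z ((le_max_right _ _).trans hz.le)))
  · refine mul_pos (lt_max_of_lt_left (sub_pos.2 (Real.exp_lt_exp.2 ?_)))
      (mul_pos (Real.exp_pos _) (hmpos z ((le_max_right _ _).trans hz.le) hzM))
    exact div_lt_div_of_pos_right hz hs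

/-- Testing against all positive integrable densities of exponential size at least `s` shows that
the exponentially weighted tail integrals are nonnegative. -/
lemma exp_tail_nonneg_of_forall_density {D : ℝ → ℝ} {s : ℝ} (hD : Measurable D)
    (hB : ∀ z, |D z| ≤ 1) (hs : 0 < s)
    (H : ∀ g : ℝ → ℝ, (∀ b, 0 < g b) → Integrable g →
      Antitone (fun b => g b * Real.exp (-b / s)) → ∀ a, 0 ≤ ∫ z, g (a - z) * D z) (a : ℝ) :
    0 ≤ ∫ z in Set.Ioi a, Real.exp (-z / s) * D z := by
  have key : ∀ ε ∈ Set.Ioc (0 : ℝ) 1, 0 ≤ (∫ z in Set.Ioi a, Real.exp ((a - z) / s) * D z) +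
      ε * ∫ z in (Set.Ioi a)ᶜ, Real.exp (-(a - z) / s) * D z := by
    rintro ε ⟨hε0, hε1⟩
    let g : ℝ → ℝ := fun b => if b < 0 then Real.exp (b / s) else ε * Real.exp (-b / s)
    have hg0 : ∀ b, 0 < g b := fun b => by
      simp only [g]
      split_ifs <;> positivity
    have hgi : Integrable g := by
      rw [← integrableOn_univ, ← Set.Iio_union_Ici (a := (0 : ℝ)), integrableOn_union]
      constructor
      · refine (((integrableOn_exp_mul_Iic (inv_pos.2 hs) 0).mono_set
          Set.Iio_subset_Iic_self).congr_fun (fun b hb => ?_) measurableSet_Iio)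
        simp only [g, Set.mem_Iio.1 hb, if_true]
        congr 1
        ring
      · rw [integrableOn_Ici_iff_integrableOn_Ioi]
        refine IntegrableOn.congr_fun ((exp_neg_integrableOn_Ioi 0 (inv_pos.2 hs)).const_mul ε)
          (fun b hb => ?_) measurableSet_Ioi
        simp only [g, (Set.mem_Ioi.1 hb).not_gt, if_false]
        ring_nf
    have hanti : Antitone fun b => g b * Real.exp (-b / s) := by
      have hval : ∀ b, g b * Real.exp (-b / s) =
          if b < 0 then 1 else ε * Real.exp (-(2 * b) / s) := fun b => by
        simp only [g]
        split_ifs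
        · rw [← Real.exp_add, ← add_div, add_neg_cancel, zero_div, Real.exp_zero]
        · rw [mul_assoc, ← Real.exp_add]
          congr 2
          ring
      intro x y hxy
      simp only [hval]
      by_cases hy : y < 0
      · simp [hy, hxy.trans_lt hy]
      · rw [if_neg hy]
        split_ifs
        · have : Real.exp (-(2 * y) / s) ≤ 1 :=
            Real.exp_le_one_iff.2 (div_nonpos_of_nonpos_of_nonneg (by linarith) hs.le)
          nlinarith [Real.exp_pos (-(2 * y) / s)]
        · gcongr
    have h := H g hg0 hgi hanti a
    have hgm : Integrable fun z => g (a - z) * D z :=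
      (hgi.comp_sub_left a).mul_bdd (c := 1) hD.aestronglyMeasurable (ae_of_all _ hB)
    rw [← integral_add_compl measurableSet_Ioi hgm (s := Set.Ioi a)] at h
    rw [← integral_const_mul]
    convert h using 2
    · refine setIntegral_congr_fun measurableSet_Ioi fun z hz => ?_
      simp [g, Set.mem_Ioi.1 hz]
    · refine setIntegral_congr_fun measurableSet_Ioi.compl fun z hz => ?_
      have : ¬ a - z < 0 := fun h => hz (by simpa using h)
      simp only [g, this, if_false, mul_assoc]
  have hlim : 0 ≤ ∫ z in Set.Ioi a, Real.exp ((a - z) / s) * D z := by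
    have ht : Filter.Tendsto (fun ε => (∫ z in Set.Ioi a, Real.exp ((a - z) / s) * D z) +
        ε * ∫ z in (Set.Ioi a)ᶜ, Real.exp (-(a - z) / s) * D z) (nhdsWithin 0 (Set.Ioi 0))
        (nhds (∫ z in Set.Ioi a, Real.exp ((a - z) / s) * D z)) := by
      refine (Continuous.tendsto' (by fun_prop) _ _ (by simp)).mono_left nhdsWithin_le_nhds
    exact ge_of_tendsto ht (Filter.mem_of_superset (Ioc_mem_nhdsGT one_pos) key)
  have hfac : ∫ z in Set.Ioi a, Real.exp ((a - z) / s) * D z =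
      Real.exp (a / s) * ∫ z in Set.Ioi a, Real.exp (-z / s) * D z := by
    rw [← integral_const_mul]
    congr 1
    funext z
    rw [← mul_assoc, ← Real.exp_add]
    congr 2
    ring
  rw [hfac] at hlim
  exact nonneg_of_mul_nonneg_right hlim (Real.exp_pos _)

lemma measureReal_le_eq_one_of_essSup_le {Ω : Type*} [MeasurableSpace Ω] {P : Measure Ω}
    [IsProbabilityMeasure P] {X : Ω → ℝ} (hX : ∃ C : ℝ, ∀ ω, |X ω| ≤ C) {z : ℝ}
    (hz : essSup X P ≤ z) : P.real {ω | X ω ≤ z} = 1 := by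
  obtain ⟨C, hC⟩ := hX
  have hbdd : Filter.IsBoundedUnder (· ≤ ·) (ae P) X :=
    Filter.isBoundedUnder_of ⟨C, fun ω => (abs_le.1 (hC ω)).2⟩
  have h : ∀ᵐ ω ∂P, X ω ≤ z := (ae_le_essSup hbdd).mono fun ω hω => hω.trans hz
  rw [measureReal_def, measure_congr (Filter.eventuallyEq_univ.2 h), measure_univ,
    ENNReal.toReal_one]

lemma measureReal_le_lt_one_of_lt_essSup {Ω : Type*} [MeasurableSpace Ω] {P : Measure Ω}
    [IsProbabilityMeasure P] {X : Ω → ℝ} (hXmeas : Measurable X) (hX : ∃ C : ℝ, ∀ ω, |X ω| ≤ C)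
    {z : ℝ} (hz : z < essSup X P) : P.real {ω | X ω ≤ z} < 1 := by
  obtain ⟨C, hC⟩ := hX
  refine lt_of_le_of_ne measureReal_le_one fun h => hz.not_ge ?_
  have hco : Filter.IsCoboundedUnder (· ≤ ·) (ae P) X :=
    (Filter.isBoundedUnder_of ⟨-C, fun ω => (abs_le.1 (hC ω)).1⟩ :
      Filter.IsBoundedUnder (· ≥ ·) (ae P) X).isCoboundedUnder_le
  refine essSup_le_of_ae_le z ?_ hco
  rw [measureReal_def, ENNReal.toReal_eq_one_iff] at h
  exact (prob_compl_eq_zero_iff (hXmeas measurableSet_Iic)).2 h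

/-- A positive integrable density of exponential size at least `s` has nonnegative convolution
with any function whose exponentially weighted tails are nonnegative. -/
lemma integral_density_mul_nonneg {D g : ℝ → ℝ} {C s : ℝ} (hD : Measurable D)
    (hB : ∀ z, |D z| ≤ 1) (hC : ∀ z, C < |z| → D z = 0)
    (hexp : ∀ a, 0 ≤ ∫ z in Set.Ioi a, Real.exp (-z / s) * D z) (hg0 : ∀ b, 0 < g b)
    (hgi : Integrable g) (hanti : Antitone fun b => g b * Real.exp (-b / s)) (a : ℝ) :
    0 ≤ ∫ z, g (a - z) * D z := by
  have hfac : ∀ z, g (a - z) * D z = g (a - z) * Real.exp (-(a - z) / s) * Real.exp (a / s) *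
      (Real.exp (-z / s) * D z) := fun z => by
    have : Real.exp (-(a - z) / s) * Real.exp (a / s) * Real.exp (-z / s) = 1 := by
      rw [← Real.exp_add, ← Real.exp_add, Real.exp_eq_one_iff]
      ring
    linear_combination (-(g (a - z) * D z)) * this
  have hint : Integrable fun z => g (a - z) * D z :=
    (hgi.comp_sub_left a).mul_bdd (c := 1) hD.aestronglyMeasurable (ae_of_all _ hB)
  simp_rw [hfac] at hint ⊢
  refine integral_monotone_mul_nonneg
    (Continuous.integrable_mul_of_bounded_support (by fun_prop) hD hB hC) hexp
    (fun x y hxy => ?_) (fun z => ?_) hint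
  · exact mul_le_mul_of_nonneg_right (hanti (sub_le_sub_left hxy a)) (Real.exp_pos _).le
  · have := hg0 (a - z)
    positivity

lemma measurable_of_antitone_mul_exp {g : ℝ → ℝ} {s : ℝ}
    (hanti : Antitone fun b => g b * Real.exp (-b / s)) : Measurable g := by
  have : g = fun b => g b * Real.exp (-b / s) * Real.exp (b / s) := by
    funext b
    rw [mul_assoc, ← Real.exp_add, ← add_div, neg_add_cancel, zero_div, Real.exp_zero, mul_one]
  rw [this]
  exact hanti.measurable.mul (by fun_prop)

/-- **Theorem 4 (choice between two gambles, heavy left tail).** For bounded gambles `X`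
and `Y` with distinct essential suprema, `X` strongly dominates `Y` in the convex order
(i.e. `esssup X > esssup Y` and `∫_a^∞ (F_Y - F_X) > 0` for all `a < esssup X`) if and
only if there exists `s > 0` such that under every background risk with a strictly
positive Lebesgue density `g` with `a ↦ g a * exp (-a/s)` non-increasing (exponential
size at least `s`), the law of `W + X` first-order stochastically dominates the law of
`W + Y`. -/
theorem strong_convex_dominance_iff_dominant_under_heavy_left_tail
    {Ω : Type*} [MeasurableSpace Ω] (P : Measure Ω) [IsProbabilityMeasure P]
    (X Y : Ω → ℝ) (hXmeas : Measurable X) (hYmeas : Measurable Y)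
    (hXbdd : ∃ C : ℝ, ∀ ω, |X ω| ≤ C) (hYbdd : ∃ C : ℝ, ∀ ω, |Y ω| ≤ C)
    (FX FY : ℝ → ℝ)
    (hFX : ∀ a, FX a = (P {ω | X ω ≤ a}).toReal)
    (hFY : ∀ a, FY a = (P {ω | Y ω ≤ a}).toReal)
    (hne : essSup X P ≠ essSup Y P) :
    (essSup Y P < essSup X P ∧
        ∀ a : ℝ, a < essSup X P → 0 < ∫ z in Set.Ioi a, (FY z - FX z)) ↔
      ∃ s : ℝ, 0 < s ∧
        ∀ μ : Measure ℝ, IsProbabilityMeasure μ →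
          ∀ g : ℝ → ℝ, (∀ a, 0 < g a) →
            μ = volume.withDensity (fun a => ENNReal.ofReal (g a)) →
            Antitone (fun a => g a * Real.exp (-a / s)) →
            ∀ a : ℝ, (Measure.conv μ (Measure.map X P)) (Set.Iic a)
              ≤ (Measure.conv μ (Measure.map Y P)) (Set.Iic a) := by
  have hν₁ : IsProbabilityMeasure (Measure.map X P) :=
    Measure.isProbabilityMeasure_map hXmeas.aemeasurable
  have hν₂ : IsProbabilityMeasure (Measure.map Y P) :=
    Measure.isProbabilityMeasure_map hYmeas.aemeasurable
  have eX : ∀ z, (Measure.map X P).real (Set.Iic z) = FX z := fun z => by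
    rw [map_measureReal_apply hXmeas measurableSet_Iic, hFX]
    rfl
  have eY : ∀ z, (Measure.map Y P).real (Set.Iic z) = FY z := fun z => by
    rw [map_measureReal_apply hYmeas measurableSet_Iic, hFY]
    rfl
  have hX1 : ∀ z, essSup X P ≤ z → FX z = 1 := fun z hz =>
    (hFX z).trans (measureReal_le_eq_one_of_essSup_le hXbdd hz)
  have hY1 : ∀ z, essSup Y P ≤ z → FY z = 1 := fun z hz =>
    (hFY z).trans (measureReal_le_eq_one_of_essSup_le hYbdd hz)
  have hXlt : ∀ z, z < essSup X P → FX z < 1 := fun z hz =>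
    (hFX z).trans_lt (measureReal_le_lt_one_of_lt_essSup hXmeas hXbdd hz)
  have hYlt : ∀ z, z < essSup Y P → FY z < 1 := fun z hz =>
    (hFY z).trans_lt (measureReal_le_lt_one_of_lt_essSup hYmeas hYbdd hz)
  have hX01 : ∀ z, 0 ≤ FX z ∧ FX z ≤ 1 := fun z =>
    eX z ▸ ⟨measureReal_nonneg, measureReal_le_one⟩
  have hY01 : ∀ z, 0 ≤ FY z ∧ FY z ≤ 1 := fun z =>
    eY z ▸ ⟨measureReal_nonneg, measureReal_le_one⟩
  have hXmono : Monotone FX := fun x y hxy => by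
    rw [← eX, ← eX]
    exact measureReal_mono (Set.Iic_subset_Iic.2 hxy)
  have hYmono : Monotone FY := fun x y hxy => by
    rw [← eY, ← eY]
    exact measureReal_mono (Set.Iic_subset_Iic.2 hxy)
  set D : ℝ → ℝ := fun z => FY z - FX z
  have hD : Measurable D := hYmono.measurable.sub hXmono.measurable
  have hB : ∀ z, |D z| ≤ 1 := fun z =>
    abs_le.2 ⟨by linarith [(hX01 z).2, (hY01 z).1], by linarith [(hX01 z).1, (hY01 z).2]⟩
  obtain ⟨C, hC⟩ : ∃ C : ℝ, ∀ z, C < |z| → D z = 0 := by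
    obtain ⟨CX, hCX⟩ := hXbdd
    obtain ⟨CY, hCY⟩ := hYbdd
    refine ⟨max CX CY, fun z hz => ?_⟩
    obtain ⟨hzX, hzY⟩ := max_lt_iff.1 hz
    simp only [D, hFX, hFY]
    rcases lt_abs.1 hz with h | h
    · obtain ⟨h1, h2⟩ := max_lt_iff.1 h
      have sX : {ω | X ω ≤ z} = Set.univ :=
        Set.eq_univ_of_forall fun ω => (abs_le.1 (hCX ω)).2.trans h1.le
      have sY : {ω | Y ω ≤ z} = Set.univ :=
        Set.eq_univ_of_forall fun ω => (abs_le.1 (hCY ω)).2.trans h2.le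
      rw [sX, sY, sub_self]
    · obtain ⟨h1, h2⟩ := max_lt_iff.1 h
      have sX : {ω | X ω ≤ z} = ∅ := Set.eq_empty_of_forall_notMem fun ω hω => by
        have : X ω ≤ z := hω
        linarith [(abs_le.1 (hCX ω)).1]
      have sY : {ω | Y ω ≤ z} = ∅ := Set.eq_empty_of_forall_notMem fun ω hω => by
        have : Y ω ≤ z := hω
        linarith [(abs_le.1 (hCY ω)).1]
      rw [sX, sY, sub_self]
  have hDnonneg : ∀ z, essSup Y P ≤ z → 0 ≤ D z := fun z hz => by
    have := hY1 z hz
    linarith [(hX01 z).2]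
  have conv_iff : ∀ g : ℝ → ℝ, Measurable g → (∀ b, 0 < g b) → Integrable g → ∀ a,
      ((volume.withDensity fun b => ENNReal.ofReal (g b)) ∗ Measure.map X P) (Set.Iic a) ≤
        ((volume.withDensity fun b => ENNReal.ofReal (g b)) ∗ Measure.map Y P) (Set.Iic a) ↔
      0 ≤ ∫ z, g (a - z) * D z := fun g hg hg0 hgi a => by
    rw [conv_withDensity_Iic_le_iff hg (fun b => (hg0 b).le) hgi]
    simp only [eX, eY, D]
  constructor
  · rintro ⟨hlt, htail⟩
    obtain ⟨s, hs, hexp⟩ := exists_exp_tail_nonneg hD hB hC hlt hDnonneg htail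
    refine ⟨s, hs, ?_⟩
    rintro μ hμ g hg0 rfl hanti a
    have hg := measurable_of_antitone_mul_exp hanti
    have hgi : Integrable g := by
      refine ⟨hg.aestronglyMeasurable, ?_⟩
      rw [hasFiniteIntegral_iff_ofReal (ae_of_all _ fun b => (hg0 b).le),
        ← setLIntegral_univ, ← withDensity_apply _ MeasurableSet.univ]
      exact measure_lt_top _ _
    exact (conv_iff g hg hg0 hgi a).2
      (integral_density_mul_nonneg hD hB hC hexp hg0 hgi hanti a)
  · rintro ⟨s, hs, H⟩
    have hexp := exp_tail_nonneg_of_forall_density hD hB hs fun g hg0 hgi hanti a => by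
      have hc : 0 < ∫ b, g b := by
        rw [integral_pos_iff_support_of_nonneg (fun b => (hg0 b).le) hgi,
          Set.eq_univ_of_forall (s := Function.support g) fun b => (hg0 b).ne']
        simp
      have hc' := inv_pos.2 hc
      have hprob : IsProbabilityMeasure
          (volume.withDensity fun b => ENNReal.ofReal ((∫ b, g b)⁻¹ * g b)) := ⟨by
        rw [withDensity_apply _ MeasurableSet.univ, setLIntegral_univ,
          ← ofReal_integral_eq_lintegral_ofReal (hgi.const_mul _)
            (ae_of_all _ fun b => (mul_pos hc' (hg0 b)).le),
          integral_const_mul, inv_mul_cancel₀ hc.ne', ENNReal.ofReal_one]⟩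
      have h := H _ hprob _ (fun b => mul_pos hc' (hg0 b)) rfl
        (by simpa only [mul_assoc] using hanti.const_mul hc'.le) a
      rw [conv_iff _ ((measurable_of_antitone_mul_exp hanti).const_mul _)
        (fun b => mul_pos hc' (hg0 b)) (hgi.const_mul _)] at h
      simp_rw [mul_assoc] at h
      rw [integral_const_mul] at h
      exact nonneg_of_mul_nonneg_right h hc'
    have hlt : essSup Y P < essSup X P := by
      refine (lt_or_gt_of_ne hne).resolve_left fun hXY => ?_
      have hEi : Integrable fun z => Real.exp (-z / s) * D z :=
        Continuous.integrable_mul_of_bounded_support (by fun_prop) hD hB hC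
      have hneg : 0 < ∫ z in Set.Ioi (essSup X P), -(Real.exp (-z / s) * D z) := by
        refine setIntegral_Ioi_pos hEi.neg.integrableOn (fun z hz => ?_) le_rfl hXY
          fun z hz hzY => ?_
        · have : D z ≤ 0 := by linarith [hX1 z hz.le, (hY01 z).2]
          linarith [mul_nonpos_of_nonneg_of_nonpos (Real.exp_pos (-z / s)).le this]
        · have : D z < 0 := by linarith [hX1 z hz.le, hYlt z hzY]
          linarith [mul_neg_of_pos_of_neg (Real.exp_pos (-z / s)) this]
      rw [integral_neg] at hneg
      linarith [hexp (essSup X P)]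
    refine ⟨hlt, fun a ha => tail_pos_of_exp_tail_nonneg hD hB hC hs hexp hlt hDnonneg
      (fun z hz hzX => ?_) ha⟩
    linarith [hY1 z hz, hXlt z hzX]
end

section
/- Let X and Y be bounded real random variables with cumulative distribution functions F_X and F_Y. Suppose esssup X > esssup Y and ∫_{a}^{∞} (F_Y(z) - F_X(z)) dz > 0 for every a < esssup X. Then there exists s > 0 such that for every a ∈ ℝ, ∫_{a}^{∞} (F_Y(z) - F_X(z))·exp(-z/s) dz ≥ 0. -/
open MeasureTheory ProbabilityTheory

open Set in
/-- If the tail integrals of a compactly supported integrable function are positive up to `m`,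
they are bounded away from zero there. -/
lemma exists_pos_le_integral_Ioi {h : ℝ → ℝ} (hi : Integrable h) {C m : ℝ}
    (hsupp : ∀ z, C ≤ |z| → h z = 0) (hpos : ∀ a ≤ m, 0 < ∫ z in Ioi a, h z) :
    ∃ δ > 0, ∀ a ≤ m, δ ≤ ∫ z in Ioi a, h z := by
  set c := min (-C) m
  have hcont : Continuous fun a => ∫ z in Ioi a, h z := by
    have hprim : (fun a => ∫ z in Ioi a, h z) =
        fun a => (∫ z in Ioi c, h z) - ∫ z in c..a, h z := by
      funext a
      have := intervalIntegral.integral_Ioi_sub_Ioi' (hi.integrableOn (s := Ioi c))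
        (hi.integrableOn (s := Ioi a))
      linarith
    rw [hprim]
    exact continuous_const.sub
      (intervalIntegral.continuous_primitive (fun _ _ => hi.intervalIntegrable) c)
  obtain ⟨x, hx, hmin⟩ := isCompact_Icc.exists_isMinOn
    (nonempty_Icc.2 (min_le_right (-C) m)) hcont.continuousOn
  refine ⟨_, hpos x hx.2, fun a ha => ?_⟩
  rcases le_or_gt c a with hca | hca
  · exact hmin ⟨hca, ha⟩
  · have hzero : ∫ z in a..c, h z = 0 := by
      refine intervalIntegral.integral_zero_ae (ae_of_all _ fun z hz => hsupp z ?_)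
      rw [uIoc_of_le hca.le] at hz
      have : z ≤ -C := hz.2.trans (min_le_left _ _)
      linarith [neg_le_abs z]
    have hsub := intervalIntegral.integral_Ioi_sub_Ioi (hi.integrableOn (s := Ioi a)) hca.le
    have hc : ∫ z in Ioi x, h z ≤ ∫ z in Ioi c, h z := hmin ⟨le_rfl, min_le_right _ _⟩
    linarith

open Set in
/-- If a compactly supported integrable function is nonnegative beyond `m` and its tail integrals
from points up to `m` are positive, then its tail integrals remain nonnegative under a
sufficiently flat exponential weight. -/
lemma exists_forall_integral_Ioi_mul_exp_nonneg {h : ℝ → ℝ} (hi : Integrable h) {C m : ℝ}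
    (hC : 0 < C) (hsupp : ∀ z, C ≤ |z| → h z = 0) (hnonneg : ∀ z, m < z → 0 ≤ h z)
    (hpos : ∀ a ≤ m, 0 < ∫ z in Ioi a, h z) :
    ∃ s : ℝ, 0 < s ∧ ∀ a : ℝ, 0 ≤ ∫ z in Ioi a, h z * Real.exp (-z / s) := by
  obtain ⟨δ, hδ, hle⟩ := exists_pos_le_integral_Ioi hi hsupp hpos
  set K := ∫ z, |h z|
  have hK : 0 ≤ K := integral_nonneg fun z => abs_nonneg _
  set s := C + 2 * C * K / δ with hs
  have hCs : C ≤ s := le_add_of_nonneg_right (by positivity)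
  have hs0 : 0 < s := hC.trans_le hCs
  have hεK : 2 * (C / s) * K ≤ δ := by
    have : 2 * C * K ≤ δ * s := by
      rw [hs, mul_add, mul_div_cancel₀ _ hδ.ne']
      linarith [mul_pos hδ hC]
    calc 2 * (C / s) * K = 2 * C * K / s := by ring
      _ ≤ δ := (div_le_iff₀ hs0).2 this
  have hbound : ∀ z, |h z * (Real.exp (-z / s) - 1)| ≤ 2 * (C / s) * |h z| := by
    intro z
    rcases le_or_gt C |z| with hz | hz
    · simp [hsupp z hz]
    · have habs : |-z / s| ≤ C / s := by
        rw [abs_div, abs_neg, abs_of_pos hs0]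
        gcongr
      have hexp := Real.abs_exp_sub_one_le (habs.trans ((div_le_one hs0).2 hCs))
      rw [abs_mul, mul_comm]
      gcongr
      linarith
  have hgi : Integrable fun z => h z * (Real.exp (-z / s) - 1) :=
    (hi.abs.const_mul _).mono'
      (hi.aestronglyMeasurable.mul (by fun_prop)) (ae_of_all _ hbound)
  refine ⟨s, hs0, fun a => ?_⟩
  rcases le_or_gt a m with ha | ha
  · have hsplit : ∫ z in Ioi a, h z * Real.exp (-z / s) =
        (∫ z in Ioi a, h z) + ∫ z in Ioi a, h z * (Real.exp (-z / s) - 1) := by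
      rw [← integral_add hi.integrableOn hgi.integrableOn]
      congr with z
      ring
    have herr : |∫ z in Ioi a, h z * (Real.exp (-z / s) - 1)| ≤ δ :=
      calc |∫ z in Ioi a, h z * (Real.exp (-z / s) - 1)|
          ≤ ∫ z in Ioi a, |h z * (Real.exp (-z / s) - 1)| := abs_integral_le_integral_abs
        _ ≤ ∫ z, |h z * (Real.exp (-z / s) - 1)| :=
          setIntegral_le_integral hgi.abs (ae_of_all _ fun z => abs_nonneg _)
        _ ≤ ∫ z, 2 * (C / s) * |h z| := integral_mono hgi.abs (hi.abs.const_mul _) hbound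
        _ = 2 * (C / s) * K := integral_const_mul _ _
        _ ≤ δ := hεK
    linarith [hle a ha, neg_le_of_abs_le herr]
  · exact setIntegral_nonneg measurableSet_Ioi fun z hz =>
      mul_nonneg (hnonneg z (ha.trans hz)) (Real.exp_pos _).le

lemma measure_le_toReal_eq_zero {Ω : Type*} [MeasurableSpace Ω] (P : Measure Ω) {X : Ω → ℝ}
    {C a : ℝ} (hX : ∀ ω, |X ω| ≤ C) (ha : a < -C) : (P {ω | X ω ≤ a}).toReal = 0 := by
  have : {ω | X ω ≤ a} = ∅ := by
    ext ω
    simpa using ha.trans_le (neg_le_of_abs_le (hX ω))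
  simp [this]

lemma measure_le_toReal_eq_one {Ω : Type*} [MeasurableSpace Ω] (P : Measure Ω)
    [IsProbabilityMeasure P] {X : Ω → ℝ} {a : ℝ} (hX : ∀ᵐ ω ∂P, X ω ≤ a) :
    (P {ω | X ω ≤ a}).toReal = 1 := by
  have : P {ω | X ω ≤ a} = P Set.univ :=
    measure_congr (Filter.eventuallyEq_univ.2 hX)
  simp [this]

/-- **Forward implication in the proof of Theorem 4.** If the bounded gamble `X` strongly
dominates the bounded gamble `Y` in the convex order (i.e. `esssup X > esssup Y` and
`∫_a^∞ (F_Y - F_X) > 0` for all `a < esssup X`), then there exists `s > 0` for which the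
exponentially weighted integral criterion `∫_a^∞ (F_Y(z) - F_X(z)) * exp (-z/s) dz ≥ 0`
holds for every `a`. -/
theorem exp_weighted_criterion_of_strong_convex_dominance
    {Ω : Type*} [MeasurableSpace Ω] (P : Measure Ω) [IsProbabilityMeasure P]
    (X Y : Ω → ℝ) (hXmeas : Measurable X) (hYmeas : Measurable Y)
    (hXbdd : ∃ C : ℝ, ∀ ω, |X ω| ≤ C) (hYbdd : ∃ C : ℝ, ∀ ω, |Y ω| ≤ C)
    (FX FY : ℝ → ℝ)
    (hFX : ∀ a, FX a = (P {ω | X ω ≤ a}).toReal)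
    (hFY : ∀ a, FY a = (P {ω | Y ω ≤ a}).toReal)
    (hmax : essSup Y P < essSup X P)
    (hconv : ∀ a : ℝ, a < essSup X P → 0 < ∫ z in Set.Ioi a, (FY z - FX z)) :
    ∃ s : ℝ, 0 < s ∧
      ∀ a : ℝ, 0 ≤ ∫ z in Set.Ioi a, (FY z - FX z) * Real.exp (-z / s) := by
  obtain ⟨A, hA⟩ := hXbdd
  obtain ⟨B, hB⟩ := hYbdd
  have hmonoX : Monotone FX := fun a b hab => by
    rw [hFX, hFX]
    exact measureReal_mono fun ω (hω : X ω ≤ a) => hω.trans hab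
  have hmonoY : Monotone FY := fun a b hab => by
    rw [hFY, hFY]
    exact measureReal_mono fun ω (hω : Y ω ≤ a) => hω.trans hab
  have hsupp : ∀ z, |A| + |B| + 1 ≤ |z| → FY z - FX z = 0 := by
    intro z hz
    have hA' := le_abs_self A
    have hB' := le_abs_self B
    have hA0 := abs_nonneg A
    have hB0 := abs_nonneg B
    rw [hFX, hFY]
    rcases le_abs'.1 hz with hz | hz
    · rw [measure_le_toReal_eq_zero P hA (by linarith),
        measure_le_toReal_eq_zero P hB (by linarith), sub_zero]
    · rw [measure_le_toReal_eq_one P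
          (ae_of_all _ fun ω => (le_of_abs_le (hA ω)).trans (by linarith)),
        measure_le_toReal_eq_one P
          (ae_of_all _ fun ω => (le_of_abs_le (hB ω)).trans (by linarith)),
        sub_self]
  have hint : Integrable fun z => FY z - FX z := by
    rw [← integrableOn_iff_integrable_of_support_subset
      (s := Set.Icc (-(|A| + |B| + 1)) (|A| + |B| + 1))]
    · exact (hmonoY.locallyIntegrable.sub hmonoX.locallyIntegrable).integrableOn_isCompact
        isCompact_Icc
    · intro z hz
      by_contra hz'
      refine hz (hsupp z ?_)
      contrapose! hz'
      exact abs_le.1 hz'.le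
  refine exists_forall_integral_Ioi_mul_exp_nonneg hint (by positivity) hsupp (m := essSup Y P)
    (fun z hz => ?_) (fun a ha => hconv a (ha.trans_lt hmax))
  have hY : ∀ᵐ ω ∂P, Y ω ≤ essSup Y P :=
    ae_le_essSup ⟨B, Filter.eventually_map.2 (ae_of_all _ fun ω => le_of_abs_le (hB ω))⟩
  rw [hFX, hFY, measure_le_toReal_eq_one P (hY.mono fun ω hω => hω.trans hz.le), sub_nonneg]
  exact measureReal_le_one
end

section
/- Let X and Y be bounded real random variables with cumulative distribution functions F_X and F_Y, and suppose the essential supremum of X differs from the essential supremum of Y. If there exists s > 0 such that ∫_{a}^{∞} (F_Y(z) - F_X(z))·exp(-z/s) dz ≥ 0 for every a ∈ ℝ, then esssup X > esssup Y and ∫_{a}^{∞} (F_Y(z) - F_X(z)) dz > 0 for every a < esssup X. -/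
open MeasureTheory ProbabilityTheory

lemma cdf_eq_one_of_essSup_le {Ω : Type*} [MeasurableSpace Ω] (P : Measure Ω)
    [IsProbabilityMeasure P] {X : Ω → ℝ} (hX : ∃ C : ℝ, ∀ ω, |X ω| ≤ C) {z : ℝ}
    (hz : essSup X P ≤ z) : (P {ω | X ω ≤ z}).toReal = 1 := by
  obtain ⟨C, hC⟩ := hX
  have hb : Filter.IsBoundedUnder (· ≤ ·) (ae P) X :=
    Filter.isBoundedUnder_of ⟨C, fun ω => (abs_le.1 (hC ω)).2⟩
  have h : ∀ᵐ ω ∂P, ω ∈ {ω | X ω ≤ z} := (ae_le_essSup hb).mono fun ω hω => hω.trans hz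
  rw [measure_congr (Filter.eventuallyEq_univ.2 h : {ω | X ω ≤ z} =ᵐ[P] Set.univ),
    measure_univ, ENNReal.toReal_one]

lemma cdf_lt_one_of_lt_essSup {Ω : Type*} [MeasurableSpace Ω] (P : Measure Ω)
    [IsProbabilityMeasure P] {X : Ω → ℝ} (hm : Measurable X)
    (hX : ∃ C : ℝ, ∀ ω, |X ω| ≤ C) {z : ℝ}
    (hz : z < essSup X P) : (P {ω | X ω ≤ z}).toReal < 1 := by
  obtain ⟨C, hC⟩ := hX
  refine lt_of_le_of_ne measureReal_le_one fun h => hz.not_ge ?_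
  have h1 : P {ω | X ω ≤ z} = 1 := by
    rw [← ENNReal.ofReal_toReal (measure_ne_top P _), h, ENNReal.ofReal_one]
  have h2 : ∀ᵐ ω ∂P, X ω ≤ z :=
    (prob_compl_eq_zero_iff (measurableSet_le hm measurable_const)).2 h1
  exact Filter.limsup_le_of_le
    (Filter.IsBoundedUnder.isCoboundedUnder_le
      (Filter.isBoundedUnder_of ⟨-C, fun ω => (abs_le.1 (hC ω)).1⟩)) h2

lemma setIntegral_Ioi_eq_intervalIntegral {f : ℝ → ℝ} {a b : ℝ} (hab : a ≤ b)
    (hf : ∀ z, b < z → f z = 0) : ∫ z in Set.Ioi a, f z = ∫ z in a..b, f z := by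
  rw [intervalIntegral.integral_of_le hab]
  refine (setIntegral_eq_of_subset_of_forall_sdiff_eq_zero measurableSet_Ioi
    Set.Ioc_subset_Ioi_self fun z hz => hf z ?_)
  by_contra h
  exact hz.2 ⟨hz.1, not_lt.1 h⟩

/-- Integration against `exp (z / s)`, expressed through the tail integrals of `f`. -/
lemma integral_mul_exp_eq_add_integral_tail {f : ℝ → ℝ} {a b s : ℝ} (hab : a ≤ b)
    (hf : IntervalIntegrable f volume a b) :
    ∫ z in a..b, f z * Real.exp (z / s) =
      Real.exp (a / s) * (∫ z in a..b, f z) +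
        ∫ c in a..b, Real.exp (c / s) / s * ∫ z in c..b, f z := by
  have hkc : Continuous fun c : ℝ => Real.exp (c / s) / s := by fun_prop
  have hk : ∀ z, ∫ c in a..z, Real.exp (c / s) / s = Real.exp (z / s) - Real.exp (a / s) := by
    intro z
    refine intervalIntegral.integral_eq_sub_of_hasDerivAt
      (f := fun c : ℝ => Real.exp (c / s)) (fun x _ => ?_)
      (hkc.intervalIntegrable _ _)
    simpa [div_eq_mul_inv] using ((hasDerivAt_id x).div_const s).exp
  have hswap : ∫ c in a..b, Real.exp (c / s) / s * ∫ z in c..b, f z =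
      ∫ z in a..b, f z * ∫ c in a..z, Real.exp (c / s) / s := by
    have hint : Integrable (Function.uncurry fun c z =>
        {p : ℝ × ℝ | p.1 < p.2}.indicator (fun p => Real.exp (p.1 / s) / s * f p.2) (c, z))
        ((volume.restrict (Set.Ioc a b)).prod (volume.restrict (Set.Ioc a b))) :=
      (((hkc.intervalIntegrable a b).1).mul_prod hf.1).indicator
        (measurableSet_lt measurable_fst measurable_snd)
    have h := integral_integral_swap hint
    rw [intervalIntegral.integral_of_le hab, intervalIntegral.integral_of_le hab]
    refine Eq.trans ?_ (h.trans ?_)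
    · refine setIntegral_congr_fun measurableSet_Ioc fun c hc => ?_
      have h1 : (fun z => {p : ℝ × ℝ | p.1 < p.2}.indicator
          (fun p => Real.exp (p.1 / s) / s * f p.2) (c, z)) =
          (Set.Ioi c).indicator fun z => Real.exp (c / s) / s * f z := by
        ext z; simp [Set.indicator_apply]
      simp only [h1]
      rw [setIntegral_indicator measurableSet_Ioi, Set.Ioc_inter_Ioi, max_eq_right hc.1.le,
        integral_const_mul, intervalIntegral.integral_of_le hc.2]
    · refine setIntegral_congr_fun measurableSet_Ioc fun z hz => ?_
      have h1 : (fun c => {p : ℝ × ℝ | p.1 < p.2}.indicator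
          (fun p => Real.exp (p.1 / s) / s * f p.2) (c, z)) =
          (Set.Iio z).indicator fun c => Real.exp (c / s) / s * f z := by
        ext c; simp [Set.indicator_apply]
      have h2 : Set.Ioc a b ∩ Set.Iio z = Set.Ioo a z := by
        ext c
        simp only [Set.mem_inter_iff, Set.mem_Ioc, Set.mem_Iio, Set.mem_Ioo]
        exact ⟨fun h => ⟨h.1.1, h.2⟩, fun h => ⟨⟨h.1, h.2.le.trans hz.2⟩, h.2⟩⟩
      simp only [h1]
      rw [setIntegral_indicator measurableSet_Iio, h2, integral_mul_const,
        intervalIntegral.integral_of_le hz.1.le, integral_Ioc_eq_integral_Ioo, mul_comm]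
  rw [hswap, ← intervalIntegral.integral_const_mul, ← intervalIntegral.integral_add
    (hf.const_mul _)]
  · refine intervalIntegral.integral_congr fun z _ => ?_
    simp only [hk]
    ring
  · simp only [hk]
    exact hf.mul_continuousOn (by fun_prop)

/-- **Converse implication in the proof of Theorem 4.** If the bounded gambles `X` and `Y`
have distinct essential suprema and the exponentially weighted integral criterion
`∫_a^∞ (F_Y(z) - F_X(z)) * exp (-z/s) dz ≥ 0` holds for some `s > 0` and every `a`, then
`X` strongly dominates `Y` in the convex order: `esssup X > esssup Y` and
`∫_a^∞ (F_Y - F_X) > 0` for every `a < esssup X`. -/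
theorem strong_convex_dominance_of_exp_weighted_criterion
    {Ω : Type*} [MeasurableSpace Ω] (P : Measure Ω) [IsProbabilityMeasure P]
    (X Y : Ω → ℝ) (hXmeas : Measurable X) (hYmeas : Measurable Y)
    (hXbdd : ∃ C : ℝ, ∀ ω, |X ω| ≤ C) (hYbdd : ∃ C : ℝ, ∀ ω, |Y ω| ≤ C)
    (FX FY : ℝ → ℝ)
    (hFX : ∀ a, FX a = (P {ω | X ω ≤ a}).toReal)
    (hFY : ∀ a, FY a = (P {ω | Y ω ≤ a}).toReal)
    (hne : essSup X P ≠ essSup Y P)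
    (hcrit : ∃ s : ℝ, 0 < s ∧
      ∀ a : ℝ, 0 ≤ ∫ z in Set.Ioi a, (FY z - FX z) * Real.exp (-z / s)) :
    essSup Y P < essSup X P ∧
      ∀ a : ℝ, a < essSup X P → 0 < ∫ z in Set.Ioi a, (FY z - FX z) := by
  obtain ⟨s, hs, hcrit⟩ := hcrit
  have hX1 : ∀ z, essSup X P ≤ z → FX z = 1 := fun z hz => by
    rw [hFX, cdf_eq_one_of_essSup_le P hXbdd hz]
  have hY1 : ∀ z, essSup Y P ≤ z → FY z = 1 := fun z hz => by
    rw [hFY, cdf_eq_one_of_essSup_le P hYbdd hz]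
  have hXlt : ∀ z, z < essSup X P → FX z < 1 := fun z hz => by
    rw [hFX]; exact cdf_lt_one_of_lt_essSup P hXmeas hXbdd hz
  have hYlt : ∀ z, z < essSup Y P → FY z < 1 := fun z hz => by
    rw [hFY]; exact cdf_lt_one_of_lt_essSup P hYmeas hYbdd hz
  have hXmono : Monotone FX := fun u v huv => by
    rw [hFX, hFX]; exact measureReal_mono fun ω (hω : X ω ≤ u) => hω.trans huv
  have hYmono : Monotone FY := fun u v huv => by
    rw [hFY, hFY]; exact measureReal_mono fun ω (hω : Y ω ≤ u) => hω.trans huv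
  set f : ℝ → ℝ := fun z => (FY z - FX z) * Real.exp (-z / s) with hf_def
  have hf : ∀ u v, IntervalIntegrable f volume u v := fun u v =>
    (hYmono.intervalIntegrable.sub hXmono.intervalIntegrable).mul_continuousOn (by fun_prop)
  have hlt : essSup Y P < essSup X P := by
    by_contra h
    have hXY : essSup X P < essSup Y P := lt_of_le_of_ne (not_lt.1 h) hne
    have h0 := hcrit (essSup X P)
    rw [setIntegral_Ioi_eq_intervalIntegral hXY.le fun z hz => by
      rw [hX1 z (hXY.trans hz).le, hY1 z hz.le, sub_self, zero_mul]] at h0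
    have hpos := intervalIntegral.intervalIntegral_pos_of_pos_on (hf _ _).neg
      (fun z hz => neg_pos.2 (mul_neg_of_neg_of_pos
        (by linarith [hX1 z hz.1.le, hYlt z hz.2]) (Real.exp_pos _))) hXY
    simp only [Pi.neg_apply, intervalIntegral.integral_neg] at hpos
    exact absurd h0 (neg_pos.1 hpos).not_ge
  refine ⟨hlt, fun a ha => ?_⟩
  set b := essSup X P
  have hzero : ∀ z, b < z → FY z - FX z = 0 := fun z hz => by
    rw [hX1 z hz.le, hY1 z (hlt.trans hz).le, sub_self]
  have htail : ∀ c, c ≤ b → 0 ≤ ∫ z in c..b, f z := fun c hc => by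
    rw [← setIntegral_Ioi_eq_intervalIntegral hc fun z hz => by
      simp only [hf_def, hzero z hz, zero_mul]]
    exact hcrit c
  have htail_pos : ∀ c, essSup Y P < c → c < b → 0 < ∫ z in c..b, f z := fun c hc hcb =>
    intervalIntegral.intervalIntegral_pos_of_pos_on (hf _ _)
      (fun z hz => mul_pos (by linarith [hY1 z (hc.trans hz.1).le, hXlt z hz.2])
        (Real.exp_pos _)) hcb
  have hcont : Continuous fun c => Real.exp (c / s) / s * ∫ z in c..b, f z := by
    have h := (intervalIntegral.continuous_primitive hf b).neg
    refine (by fun_prop : Continuous fun c : ℝ => Real.exp (c / s) / s).mul (h.congr fun c => ?_)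
    exact (intervalIntegral.integral_symm b c).symm
  have hmain : 0 < ∫ c in a..b, Real.exp (c / s) / s * ∫ z in c..b, f z := by
    have hmb : max a (essSup Y P) < b := max_lt ha hlt
    rw [← intervalIntegral.integral_add_adjacent_intervals
      (hcont.intervalIntegrable a (max a (essSup Y P))) (hcont.intervalIntegrable _ b)]
    refine add_pos_of_nonneg_of_pos ?_ ?_
    · exact intervalIntegral.integral_nonneg (le_max_left _ _) fun c hc =>
        mul_nonneg (by positivity) (htail c (hc.2.trans hmb.le))
    · exact intervalIntegral.intervalIntegral_pos_of_pos_on (hcont.intervalIntegrable _ _)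
        (fun c hc => mul_pos (by positivity)
          (htail_pos c ((le_max_right _ _).trans_lt hc.1) hc.2)) hmb
  have hcancel : ∀ z, FY z - FX z = f z * Real.exp (z / s) := fun z => by
    rw [hf_def, mul_assoc, ← Real.exp_add, neg_div, neg_add_cancel, Real.exp_zero, mul_one]
  rw [setIntegral_Ioi_eq_intervalIntegral ha.le hzero]
  simp only [hcancel]
  rw [integral_mul_exp_eq_add_integral_tail ha.le (hf a b)]
  exact add_pos_of_nonneg_of_pos (mul_nonneg (Real.exp_pos _).le (htail a ha.le)) hmain
end
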